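/- Let R be an unramified hypersurface and let M be a nonzero finitely generated R-module. Then M is Ext rigid: for every finitely generated R-module N, if Ext_R^n(M,N) = 0 for some n ≤ grade(M), then Ext_R^i(M,N) = 0 for all i ≤ n. -/

import Mathlib

open CategoryTheory IsLocalRing

universe u

/-- `extMod S n A B` is the `n`-th Ext module `Ext_S^n(A, B)` of `S`-modules `A` and `B`,
realized as an object of `ModuleCat S`. -/
noncomputable def extMod (S : Type u) [CommRing S] (n : ℕ)
    (A : Type u) [AddCommGroup A] [Module S A] (B : Type u) [AddCommGroup B] [Module S B] :
    ModuleCat.{u} S :=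
  ((Ext S (ModuleCat.{u} S) n).obj (Opposite.op (ModuleCat.of S A))).obj (ModuleCat.of S B)

/-- `moduleGrade S M = inf { n | Ext_S^n(M, S) ≠ 0 }`. -/
noncomputable def moduleGrade (S : Type u) [CommRing S]
    (M : Type u) [AddCommGroup M] [Module S M] : ℕ :=
  sInf {n : ℕ | ¬ Subsingleton (extMod S n M S)}

/-- A Noetherian local ring is regular if its maximal ideal can be generated by
`dim R` many elements. -/
def IsRegularLocal (R : Type u) [CommRing R] [IsLocalRing R] : Prop :=
  IsNoetherianRing R ∧ ∃ s : Finset R, Ideal.span (s : Set R) = maximalIdeal R ∧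
    ((s.card : ℕ∞) : WithBot ℕ∞) = ringKrullDim R

/-- A local ring `(R, m, k)` is unramified if it is equicharacteristic
(`char R = char k`), or it has mixed characteristic (`char R ≠ char k`) and
`char k ∉ m²`. -/
def IsUnramifiedLocal (R : Type u) [CommRing R] [IsLocalRing R] : Prop :=
  ringChar R = ringChar (ResidueField R) ∨
    (ringChar R ≠ ringChar (ResidueField R) ∧
      ((ringChar (ResidueField R) : R) ∉ (maximalIdeal R) ^ 2))

/-- A presentation of the `m`-adic completion of a local ring `R` as `Q/(x)` with
`(Q, n)` a regular local ring and `x ∈ n²` a nonzerodivisor. -/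
structure HypersurfacePresentation (R : Type u) [CommRing R] [IsLocalRing R] :
    Type (u + 1) where
  Q : Type u
  [commRing : CommRing Q]
  [localRing : IsLocalRing Q]
  regular : IsRegularLocal Q
  x : Q
  mem_sq : x ∈ (maximalIdeal Q) ^ 2
  nonzerodivisor : x ∈ nonZeroDivisors Q
  equiv : AdicCompletion (maximalIdeal R) R ≃+* Q ⧸ Ideal.span {x}

/-- A local ring `R` is a hypersurface if it is not regular and its `m`-adic completion
is isomorphic to `Q/(x)` for a regular local ring `(Q, n)` and a nonzerodivisor `x ∈ n²`. -/
def IsHypersurface (R : Type u) [CommRing R] [IsLocalRing R] : Prop :=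
  ¬ IsRegularLocal R ∧ Nonempty (HypersurfacePresentation R)

set_option linter.unusedSectionVars false

namespace ExtRigid

section Length
variable {S : Type u} [CommRing S] (P : Ideal S) [P.IsPrime]

/-- The length of the localization of `L` at the prime `P`. -/
noncomputable def lam (L : Type*) [AddCommGroup L] [Module S L] : ℕ∞ :=
  Module.length (Localization P.primeCompl) (LocalizedModule P.primeCompl L)

variable {P}
variable {L L' L'' : Type*} [AddCommGroup L] [Module S L] [AddCommGroup L'] [Module S L']
  [AddCommGroup L''] [Module S L'']

theorem lam_eq_zero_iff : lam P L = 0 ↔ ∀ x : L, ∃ s ∉ P, s • x = 0 := by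
  rw [lam, Module.length_eq_zero_iff, LocalizedModule.subsingleton_iff]
  simp only [Ideal.mem_primeCompl_iff]

theorem lam_exact (f : L →ₗ[S] L') (g : L' →ₗ[S] L'') (hf : Function.Injective f)
    (hg : Function.Surjective g) (h : Function.Exact f g) :
    lam P L' = lam P L + lam P L'' :=
  Module.length_eq_add_of_exact (LocalizedModule.map P.primeCompl f)
    (LocalizedModule.map P.primeCompl g) (LocalizedModule.map_injective _ _ hf)
    (LocalizedModule.map_surjective _ _ hg) (LocalizedModule.map_exact _ f g h)

theorem lam_of_subsingleton [Subsingleton L] : lam P L = 0 :=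
  lam_eq_zero_iff.2 fun x => ⟨1, (Ideal.ne_top_iff_one P).1 (Ideal.IsPrime.ne_top ‹_›),
    Subsingleton.elim _ _⟩

theorem lam_congr (e : L ≃ₗ[S] L') : lam P L = lam P L' := by
  have := lam_exact (P := P) e.toLinearMap (0 : L' →ₗ[S] PUnit) e.injective
    (Function.surjective_to_subsingleton _)
    ((e.toLinearMap.exact_zero_iff_surjective _).2 e.surjective)
  rw [this, lam_of_subsingleton (L := PUnit), add_zero]

theorem lam_quot (N : Submodule S L) : lam P L = lam P N + lam P (L ⧸ N) :=
  lam_exact N.subtype N.mkQ N.injective_subtype N.mkQ_surjective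
    (LinearMap.exact_subtype_mkQ N)

theorem lam_le_of_injective (f : L →ₗ[S] L') (hf : Function.Injective f) :
    lam P L ≤ lam P L' := by
  rw [lam_congr (LinearEquiv.ofInjective f hf), lam_quot (LinearMap.range f)]
  exact le_self_add

theorem lam_le_of_surjective (f : L →ₗ[S] L') (hf : Function.Surjective f) :
    lam P L' ≤ lam P L := by
  rw [lam_quot (LinearMap.ker f), lam_congr (f.quotKerEquivOfSurjective hf)]
  exact le_add_self

theorem lam_quotient_prime_ne_top (p : Ideal S) [p.IsPrime]
    (h : ∀ (Q : Ideal S) [Q.IsPrime], Q < P → lam Q (S ⧸ p) = 0) : lam P (S ⧸ p) ≠ ⊤ := by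
  by_cases hp : p ≤ P
  · rcases hp.lt_or_eq with hlt | rfl
    · obtain ⟨s, hs, h0⟩ := lam_eq_zero_iff.1 (h p hlt) 1
      rw [Algebra.smul_def, mul_one, Ideal.Quotient.algebraMap_eq] at h0
      exact absurd (Ideal.Quotient.eq_zero_iff_mem.1 h0) hs
    · have key : ∀ N : Submodule (Localization p.primeCompl)
          (LocalizedModule p.primeCompl (S ⧸ p)), N = ⊥ ∨ N = ⊤ := by
        intro N
        by_contra! hN
        obtain ⟨x, hx, hx0⟩ := (Submodule.ne_bot_iff _).1 hN.1
        apply hN.2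
        rw [eq_top_iff]
        rintro y -
        induction x using LocalizedModule.induction_on with
        | _ m s =>
        induction y using LocalizedModule.induction_on with
        | _ m' s' =>
        obtain ⟨a, rfl⟩ := Ideal.Quotient.mk_surjective m
        obtain ⟨b, rfl⟩ := Ideal.Quotient.mk_surjective m'
        have ha : a ∉ p := by
          intro ha
          apply hx0
          rw [Ideal.Quotient.eq_zero_iff_mem.2 ha, LocalizedModule.zero_mk]
        have := N.smul_mem (Localization.mk (s * b : S) (⟨a, ha⟩ * s' : p.primeCompl)) hx
        rw [LocalizedModule.mk_smul_mk] at this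
        convert this using 1
        rw [LocalizedModule.mk_eq]
        refine ⟨1, ?_⟩
        simp only [one_smul, Submonoid.smul_def, Submonoid.coe_mul, Algebra.smul_def, map_mul,
          Ideal.Quotient.algebraMap_eq]
        ring
      by_cases hs : Subsingleton (LocalizedModule p.primeCompl (S ⧸ p))
      · rw [lam, Module.length_eq_zero]; simp
      · rw [not_subsingleton_iff_nontrivial] at hs
        have : IsSimpleModule (Localization p.primeCompl)
          (LocalizedModule p.primeCompl (S ⧸ p)) :=
          (isSimpleModule_iff _ _).2 ⟨key⟩
        rw [lam, Module.length_eq_one]; simp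
  · obtain ⟨s, hs, hsP⟩ := Set.not_subset.1 hp
    have : lam P (S ⧸ p) = 0 := lam_eq_zero_iff.2 fun x => by
      obtain ⟨a, rfl⟩ := Ideal.Quotient.mk_surjective x
      refine ⟨s, hsP, ?_⟩
      rw [Algebra.smul_def, Ideal.Quotient.algebraMap_eq, ← map_mul]
      exact Ideal.Quotient.eq_zero_iff_mem.2 (p.mul_mem_right _ hs)
    simp [this]

theorem lam_ne_top [IsNoetherianRing S] [Module.Finite S L]
    (h : ∀ (Q : Ideal S) [Q.IsPrime], Q < P → lam Q L = 0) : lam P L ≠ ⊤ := by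
  induction ‹Module.Finite S L› using
    IsNoetherianRing.induction_on_isQuotientEquivQuotientPrime S with
  | subsingleton N => simp [lam_of_subsingleton]
  | quotient N p f =>
    rw [lam_congr f]
    exact lam_quotient_prime_ne_top _ fun Q _ hQ => by rw [← lam_congr f]; exact h Q hQ
  | exact N₁ N₂ N₃ f g hf hg hfg h₁ h₃ =>
    rw [lam_exact f g hf hg hfg]
    have := fun (Q : Ideal S) (hQp : Q.IsPrime) hQ => lam_exact (P := Q) f g hf hg hfg ▸ h Q hQ
    simp only [add_eq_zero] at this
    exact WithTop.add_ne_top.2 ⟨h₁ fun Q hQp hQ => (this Q hQp hQ).1,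
      h₃ fun Q hQp hQ => (this Q hQp hQ).2⟩

theorem lam_eq_zero_of_lt (h : lam P L ≠ ⊤) (Q : Ideal S) [Q.IsPrime]
    (hQ : Q < P) : lam Q L = 0 := by
  obtain ⟨hQP, s, hsP, hsQ⟩ := SetLike.lt_iff_le_and_exists.1 hQ
  rw [lam, Module.length_ne_top_iff, isFiniteLength_iff_isNoetherian_isArtinian] at h
  obtain ⟨_, _⟩ := h
  set A := Localization P.primeCompl
  set K := LocalizedModule P.primeCompl L
  let f : Module.End A K := algebraMap A _ (algebraMap S A s)
  obtain ⟨n, hn⟩ := IsArtinian.monotone_stabilizes (LinearMap.iterateRange f)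
  have hf : ∀ n x, (f ^ n) x = (algebraMap S A s) ^ n • x := by
    intro n x
    rw [← map_pow]; rfl
  have hbot : LinearMap.range (f ^ n) = ⊥ := by
    refine Submodule.eq_bot_of_le_smul_of_le_jacobson_bot (maximalIdeal A) _
      (IsNoetherian.noetherian _) ?_ (IsLocalRing.maximalIdeal_le_jacobson _)
    have := hn (n + 1) (Nat.le_succ n)
    change LinearMap.range (f ^ n) = LinearMap.range (f ^ (n + 1)) at this
    rw [this]
    rintro _ ⟨x, rfl⟩
    rw [hf, show (algebraMap S A s) ^ (n + 1) = algebraMap S A s * (algebraMap S A s) ^ n from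
      pow_succ' _ _, mul_smul, ← hf, ← this]
    refine Submodule.smul_mem_smul ?_ ⟨x, rfl⟩
    rw [mem_maximalIdeal, mem_nonunits_iff, IsLocalization.AtPrime.isUnit_to_map_iff A P]
    exact fun h => h hsP
  rw [lam_eq_zero_iff]
  intro x
  have h0 : (f ^ n) (LocalizedModule.mk x 1) = 0 := by
    rw [← Submodule.mem_bot A, ← hbot]; exact ⟨_, rfl⟩
  rw [hf, ← map_pow, algebraMap_smul, LocalizedModule.smul'_mk, ← LocalizedModule.zero_mk 1,
    LocalizedModule.mk_eq] at h0
  obtain ⟨⟨t, ht⟩, h0⟩ := h0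
  simp only [one_smul, Submonoid.mk_smul, smul_zero] at h0
  refine ⟨t * s ^ n, fun hm => ?_, by rw [mul_smul]; exact h0⟩
  rcases Ideal.IsPrime.mem_or_mem ‹_› hm with h | h
  · exact ht (hQP h)
  · exact hsQ (Ideal.IsPrime.mem_of_pow_mem ‹_› _ h)

theorem exists_smul_eq_zero [Module.Finite S L] (h : lam P L = 0) :
    ∃ s ∉ P, ∀ x : L, s • x = 0 := by
  rw [lam_eq_zero_iff] at h
  obtain ⟨T, hT⟩ := Module.Finite.fg_top (R := S) (M := L)
  choose s hs h0 using h
  refine ⟨∏ x ∈ T, s x, (Ideal.IsPrime.prod_mem_iff (p := P)).not.2 (by simp [hs]), fun x => ?_⟩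
  have hx : x ∈ Submodule.span S (T : Set L) := hT ▸ Submodule.mem_top
  induction hx using Submodule.span_induction with
  | mem x hx =>
    obtain ⟨c, hc⟩ := Finset.dvd_prod_of_mem s hx
    rw [hc, mul_comm, mul_smul, h0, smul_zero]
  | zero => simp
  | add x y _ _ hx hy => rw [smul_add, hx, hy, add_zero]
  | smul a x _ hx => rw [smul_comm, hx, smul_zero]

theorem lam_eq_zero_of_quot [Module.Finite S L] (I : Ideal S) (hI : I ≤ P)
    (h : lam P (L ⧸ (I • ⊤ : Submodule S L)) = 0) : lam P L = 0 := by
  obtain ⟨s, hs, h0⟩ := exists_smul_eq_zero h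
  obtain ⟨p, hp, -, hc, ha⟩ :=
    LinearMap.exists_monic_and_natDegree_eq_and_coeff_mem_pow_and_aeval_eq_zero S
    (algebraMap S (Module.End S L) s) I (by
      rintro _ ⟨x, rfl⟩
      have := h0 (Submodule.Quotient.mk x)
      rwa [← Submodule.Quotient.mk_smul, Submodule.Quotient.mk_eq_zero] at this)
  rw [lam_eq_zero_iff]
  intro x
  refine ⟨p.eval s, fun hm => hs ?_, ?_⟩
  · have h1 : p.eval s - s ^ p.natDegree ∈ P := by
      rw [Polynomial.eval_eq_sum_range, Finset.sum_range_succ, hp.coeff_natDegree, one_mul,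
        add_sub_cancel_right]
      refine sum_mem fun i hi => P.mul_mem_right _ (hI ?_)
      exact Ideal.pow_le_self (by simp at hi; omega) (hc i)
    exact Ideal.IsPrime.mem_of_pow_mem ‹_› _ ((P.sub_mem_iff_right hm).1 h1)
  · rw [Polynomial.aeval_algebraMap_apply, Polynomial.coe_aeval_eq_eval] at ha
    exact LinearMap.congr_fun ha x

theorem subsingleton_of_lam (h : ∀ (P : Ideal S) [P.IsPrime], lam P L = 0) :
    Subsingleton L := by
  refine subsingleton_of_forall_eq 0 fun x => ?_
  by_contra hx
  have hne : Ideal.torsionOf S L x ≠ ⊤ := by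
    rwa [ne_eq, Ideal.torsionOf_eq_top_iff]
  obtain ⟨m, hm, hle⟩ := Ideal.exists_le_maximal _ hne
  obtain ⟨s, hs, h0⟩ := lam_eq_zero_iff.1 (h m) x
  exact hs (hle ((Ideal.mem_torsionOf_iff _ _).2 h0))

end Length
end ExtRigid

namespace ExtRigid

section Subquotient
variable {S : Type u} [CommRing S] (P : Ideal S) [P.IsPrime]

/-- The length at `P` of the subquotient `Z / (W ∩ Z)`. -/
noncomputable def subLam {M : Type*} [AddCommGroup M] [Module S M] (Z W : Submodule S M) : ℕ∞ :=
  lam P (Z ⧸ W.comap Z.subtype)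

variable {P} {M M' : Type*} [AddCommGroup M] [Module S M] [AddCommGroup M'] [Module S M']

theorem subLam_congr {Z W : Submodule S M} {Z' W' : Submodule S M'} (φ : Z →ₗ[S] Z')
    (hs : ∀ z' ∈ Z', ∃ z, z' - φ z ∈ W') (hk : ∀ z, (φ z : M') ∈ W' ↔ (z : M) ∈ W) :
    subLam P Z W = subLam P Z' W' := by
  let ψ : Z →ₗ[S] Z' ⧸ W'.comap Z'.subtype := (Submodule.mkQ _) ∘ₗ φ
  have hker : LinearMap.ker ψ = W.comap Z.subtype := by
    ext z
    simp [ψ, hk]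
  have hsurj : Function.Surjective ψ := by
    intro y
    obtain ⟨⟨z', hz'⟩, rfl⟩ := Submodule.mkQ_surjective _ y
    obtain ⟨z, hz⟩ := hs z' hz'
    refine ⟨z, ?_⟩
    exact ((Submodule.Quotient.eq _).2 (by simpa using hz)).symm
  rw [subLam, subLam, ← hker]
  exact lam_congr (ψ.quotKerEquivOfSurjective hsurj)

theorem map_bot_of_le {f : M →ₗ[S] M'} {Z : Submodule S M} (h : Z ≤ LinearMap.ker f) :
    Z.map f = ⊥ := LinearMap.le_ker_iff_map.1 h

theorem subLam_map (f : M →ₗ[S] M') {Z W : Submodule S M} (hW : LinearMap.ker f ⊓ Z ≤ W)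
    (hle : W ≤ Z) : subLam P (Z.map f) (W.map f) = subLam P Z W := by
  symm
  refine subLam_congr (f.submoduleMap Z) ?_ ?_
  · rintro _ ⟨z, hz, rfl⟩
    exact ⟨⟨z, hz⟩, by simp⟩
  · rintro ⟨z, hz⟩
    simp only [LinearMap.submoduleMap_coe_apply]
    refine ⟨?_, fun h => ⟨z, h, rfl⟩⟩
    rintro ⟨w, hw, h⟩
    have : z - w ∈ W := hW ⟨by simp [h], Z.sub_mem hz (hle hw)⟩
    simpa using W.add_mem this hw

theorem subLam_sup (Z W : Submodule S M) : subLam P (Z ⊔ W) W = subLam P Z W := by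
  symm
  refine subLam_congr (Submodule.inclusion le_sup_left) ?_ (by simp)
  intro z' hz'
  obtain ⟨z, hz, w, hw, rfl⟩ := Submodule.mem_sup.1 hz'
  exact ⟨⟨z, hz⟩, by simpa⟩

theorem subLam_inf (Z W : Submodule S M) : subLam P Z (W ⊓ Z) = subLam P Z W :=
  subLam_congr LinearMap.id (fun z hz => ⟨⟨z, hz⟩, by simp⟩) (by simp)

theorem subLam_add {Z U W : Submodule S M} (hUZ : U ≤ Z) (hWU : W ≤ U) :
    subLam P Z W = subLam P U W + subLam P Z U := by
  refine lam_exact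
    (Submodule.mapQ _ _ (Submodule.inclusion hUZ) (by intro x hx; simpa using hx))
    (Submodule.mapQ _ _ LinearMap.id (by intro x hx; simpa using hWU hx)) ?_ ?_ ?_
  · rw [← LinearMap.ker_eq_bot, LinearMap.ker_eq_bot']
    intro m
    induction m using Submodule.Quotient.induction_on
    simp
  · intro y
    obtain ⟨y, rfl⟩ := Submodule.mkQ_surjective _ y
    exact ⟨Submodule.Quotient.mk y, rfl⟩
  · intro y
    induction y using Submodule.Quotient.induction_on with | _ y =>
    simp only [Submodule.mapQ_apply, LinearMap.id_apply, Submodule.Quotient.mk_eq_zero,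
      Submodule.mem_comap, Submodule.subtype_apply]
    constructor
    · intro h
      exact ⟨Submodule.Quotient.mk ⟨y, h⟩, rfl⟩
    · rintro ⟨x, hx⟩
      induction x using Submodule.Quotient.induction_on with | _ x =>
      rw [Submodule.mapQ_apply, Submodule.Quotient.eq] at hx
      have h2 := U.sub_mem x.2 (hWU hx)
      simpa using h2

end Subquotient

/-- Nonnegatively graded chain complexes of modules. -/
structure Cx (S : Type u) [CommRing S] where
  X : ℕ → Type u
  [grp : ∀ j, AddCommGroup (X j)]
  [mod : ∀ j, Module S (X j)]
  d : ∀ j, X (j + 1) →ₗ[S] X j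
  dd : ∀ j x, d j (d (j + 1) x) = 0

attribute [instance] Cx.grp Cx.mod

namespace Cx
variable {S : Type u} [CommRing S]

/-- Cycles. -/
def Z (X : Cx S) : ∀ j, Submodule S (X.X j)
  | 0 => ⊤
  | j + 1 => LinearMap.ker (X.d j)

/-- Boundaries. -/
def D (X : Cx S) (j : ℕ) : Submodule S (X.X j) := LinearMap.range (X.d j)

theorem D_le_Z (X : Cx S) : ∀ j, X.D j ≤ X.Z j
  | 0 => le_top
  | j + 1 => by rintro _ ⟨x, rfl⟩; exact X.dd j x

/-- Homology. -/
abbrev H (X : Cx S) (j : ℕ) : Type u := X.Z j ⧸ (X.D j).comap (X.Z j).subtype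

/-- The length at `P` of the homology. -/
noncomputable def hl (P : Ideal S) [P.IsPrime] (X : Cx S) (j : ℕ) : ℕ∞ := subLam P (X.Z j) (X.D j)

theorem hl_eq (P : Ideal S) [P.IsPrime] (X : Cx S) (j : ℕ) : hl P X j = lam P (X.H j) := rfl

/-- Short exact sequences of complexes. -/
structure SES (A B C : Cx S) where
  f : ∀ j, A.X j →ₗ[S] B.X j
  g : ∀ j, B.X j →ₗ[S] C.X j
  f_comm : ∀ j x, f j (A.d j x) = B.d j (f (j + 1) x)
  g_comm : ∀ j x, g j (B.d j x) = C.d j (g (j + 1) x)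
  inj : ∀ j, Function.Injective (f j)
  surj : ∀ j, Function.Surjective (g j)
  exact : ∀ j, Function.Exact (f j) (g j)

theorem SES.les {A B C : Cx S} (e : SES A B C) (P : Ideal S) [P.IsPrime] :
    ∃ ρ σ τ : ℕ → ℕ∞, τ 0 = 0 ∧ (∀ j, hl P A j = τ (j + 1) + ρ j) ∧
      (∀ j, hl P B j = ρ j + σ j) ∧ ∀ j, hl P C j = σ j + τ j := by
  have hfZ : ∀ j, (A.Z j).map (e.f j) = LinearMap.ker (e.g j) ⊓ B.Z j := by
    intro j
    ext b
    constructor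
    · rintro ⟨a, ha, rfl⟩
      refine ⟨(e.exact j).apply_apply_eq_zero a, ?_⟩
      cases j with
      | zero => trivial
      | succ j =>
        change B.d j _ = 0
        rw [← e.f_comm, show A.d j a = 0 from ha, map_zero]
    · rintro ⟨hb, hb'⟩
      obtain ⟨a, rfl⟩ := (e.exact j b).1 hb
      refine ⟨a, ?_, rfl⟩
      cases j with
      | zero => trivial
      | succ j =>
        apply e.inj j
        rw [e.f_comm, map_zero]
        exact hb'
  have hgD : ∀ j, (B.D j).map (e.g j) = C.D j := by
    intro j
    ext c
    constructor
    · rintro ⟨_, ⟨b, rfl⟩, rfl⟩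
      exact ⟨e.g _ b, (e.g_comm _ _).symm⟩
    · rintro ⟨c, rfl⟩
      obtain ⟨b, rfl⟩ := e.surj _ c
      exact ⟨_, ⟨b, rfl⟩, e.g_comm _ _⟩
  have hgZ : ∀ j, (B.Z j).map (e.g j) ≤ C.Z j := by
    intro j
    rintro _ ⟨b, hb, rfl⟩
    cases j with
    | zero => trivial
    | succ j =>
      change C.d j _ = 0
      rw [← e.g_comm, show B.d j b = 0 from hb, map_zero]
  refine ⟨fun j => subLam P ((A.Z j).map (e.f j) ⊔ B.D j) (B.D j),
    fun j => subLam P (B.Z j) ((A.Z j).map (e.f j) ⊔ B.D j),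
    fun j => subLam P (C.Z j) ((B.Z j).map (e.g j)), ?_, fun j => ?_, fun j => ?_, fun j => ?_⟩
  · have : C.Z 0 ≤ (B.Z 0).map (e.g 0) := by
      intro c _
      obtain ⟨b, rfl⟩ := e.surj 0 c
      exact ⟨b, trivial, rfl⟩
    have hs : Subsingleton (C.Z 0 ⧸ ((B.Z 0).map (e.g 0)).comap (C.Z 0).subtype) := by
      rw [Submodule.Quotient.subsingleton_iff, Submodule.comap_subtype_eq_top]
      exact this
    exact lam_of_subsingleton
  · set U := (B.D j).comap (e.f j) with hU
    have hUZ : U ≤ A.Z j := by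
      intro a ha
      cases j with
      | zero => trivial
      | succ j =>
        obtain ⟨b, hb⟩ := ha
        apply e.inj j
        rw [e.f_comm, ← hb, B.dd, map_zero]
    have hDU : A.D j ≤ U := by
      rintro _ ⟨a, rfl⟩
      exact ⟨e.f _ a, (e.f_comm _ _).symm⟩
    have hker : LinearMap.ker (e.f j) = ⊥ := LinearMap.ker_eq_bot.2 (e.inj j)
    rw [hl, subLam_add hUZ hDU]
    change _ + _ = subLam P (C.Z (j + 1)) ((B.Z (j + 1)).map (e.g (j + 1))) +
      subLam P ((A.Z j).map (e.f j) ⊔ B.D j) (B.D j)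
    congr 1
    · set N := (LinearMap.range (e.f j)).comap (B.d j) with hN
      have hZN : B.Z (j + 1) ≤ N := fun b hb => ⟨0, by rw [map_zero]; exact Eq.symm hb⟩
      have hAN : LinearMap.range (e.f (j + 1)) ≤ N := by
        rintro _ ⟨a, rfl⟩
        exact ⟨A.d j a, e.f_comm _ _⟩
      have hrk : LinearMap.range (e.f (j + 1)) = LinearMap.ker (e.g (j + 1)) :=
        ((e.exact _).linearMap_ker_eq).symm
      have h1 : N.map (B.d j) = U.map (e.f j) := by
        ext b
        constructor
        · rintro ⟨x, ⟨a, ha⟩, rfl⟩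
          exact ⟨a, ⟨x, ha.symm⟩, ha⟩
        · rintro ⟨a, ⟨x, hx⟩, rfl⟩
          exact ⟨x, ⟨a, hx.symm⟩, hx⟩
      have h2 : N.map (e.g (j + 1)) = C.Z (j + 1) := by
        ext c
        constructor
        · rintro ⟨x, ⟨a, ha⟩, rfl⟩
          change C.d j _ = 0
          rw [← e.g_comm, ← ha]
          exact (e.exact j).apply_apply_eq_zero a
        · intro hc
          obtain ⟨b, rfl⟩ := e.surj _ c
          refine ⟨b, (e.exact j _).1 ?_, rfl⟩
          rw [e.g_comm]
          exact hc
      have h3 : (B.Z (j + 1) ⊔ LinearMap.range (e.f (j + 1))).map (B.d j) =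
          (A.D j).map (e.f j) := by
        rw [Submodule.map_sup, show (B.Z (j + 1)).map (B.d j) = ⊥ from
          (map_bot_of_le le_rfl), bot_sup_eq, D,
          LinearMap.range_eq_map, LinearMap.range_eq_map, ← Submodule.map_comp,
          ← Submodule.map_comp]
        congr 1
        ext a
        exact (e.f_comm _ _).symm
      have h4 : (B.Z (j + 1) ⊔ LinearMap.range (e.f (j + 1))).map (e.g (j + 1)) =
          (B.Z (j + 1)).map (e.g (j + 1)) := by
        rw [Submodule.map_sup, hrk, map_bot_of_le le_rfl, sup_bot_eq]
      rw [← subLam_map (e.f j) (by simp [hker]) hDU, ← h1, ← h3,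
        subLam_map (B.d j) (inf_le_left.trans (le_sup_left : B.Z (j + 1) ≤ _)) (sup_le hZN hAN),
        ← h2, ← h4, subLam_map (e.g (j + 1)) (inf_le_left.trans (hrk ▸ le_sup_right))
          (sup_le hZN hAN)]
    · rw [← subLam_map (e.f j) (by simp [hker]) hUZ, subLam_sup, hU, Submodule.map_comap_eq,
        ← subLam_inf ((A.Z j).map (e.f j)) (B.D j)]
      congr 1
      rw [hfZ, inf_comm, ← (e.exact j).linearMap_ker_eq]
      refine le_antisymm (le_inf inf_le_left (le_inf inf_le_right (inf_le_left.trans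
        (D_le_Z B j)))) (le_inf inf_le_left (inf_le_right.trans inf_le_left))
  · exact subLam_add (sup_le (by rw [hfZ]; exact inf_le_right) (D_le_Z B j)) le_sup_right
  · rw [hl, subLam_add (hgZ j) (by rw [← hgD]; exact Submodule.map_mono (D_le_Z B j))]
    congr 1
    have h4 : (((A.Z j).map (e.f j)) ⊔ B.D j).map (e.g j) = C.D j := by
      rw [Submodule.map_sup, hgD, hfZ, map_bot_of_le inf_le_left, bot_sup_eq]
    rw [← h4, subLam_map]
    · rw [← hfZ]; exact le_sup_left
    · exact sup_le (by rw [hfZ]; exact inf_le_right) (D_le_Z B j)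

end Cx
end ExtRigid

namespace ExtRigid

theorem prime_induction {S : Type u} [CommRing S] [IsNoetherianRing S]
    {motive : (P : Ideal S) → P.IsPrime → Prop}
    (step : ∀ P hP, (∀ Q hQ, Q < P → motive Q hQ) → motive P hP) (P : Ideal S) (hP : P.IsPrime) :
    motive P hP := by
  induction h : P.height.toNat using Nat.strong_induction_on generalizing P with
  | _ n ih =>
  refine step P hP fun Q hQ hlt => ih _ ?_ Q hQ rfl
  rw [← h, ← ENat.natCast_lt_natCast, ENat.natCast_toNat (Ideal.height_ne_top hQ.ne_top),
    ENat.natCast_toNat (Ideal.height_ne_top hP.ne_top)]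
  exact Ideal.height_strict_mono_of_isPrime_of_isPrime hlt

namespace Cx
variable {S : Type u} [CommRing S]

/-- A module as a complex concentrated in degree zero. -/
def single (B : Type u) [AddCommGroup B] [Module S B] : Cx S where
  X | 0 => B
    | _ + 1 => PUnit.{u + 1}
  grp | 0 => (inferInstance : AddCommGroup B)
      | _ + 1 => (inferInstance : AddCommGroup PUnit.{u + 1})
  mod | 0 => (inferInstance : Module S B)
      | _ + 1 => (inferInstance : Module S PUnit.{u + 1})
  d _ := 0
  dd _ _ := rfl

/-- The complex moved up by one degree. -/
def shift (A : Cx S) : Cx S where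
  X | 0 => PUnit.{u + 1}
    | j + 1 => A.X j
  grp | 0 => (inferInstance : AddCommGroup PUnit.{u + 1})
      | j + 1 => (inferInstance : AddCommGroup (A.X j))
  mod | 0 => (inferInstance : Module S PUnit.{u + 1})
      | j + 1 => (inferInstance : Module S (A.X j))
  d | 0 => 0
    | j + 1 => -A.d j
  dd | 0, _ => rfl
     | j + 1, x => by
      change -A.d j (-A.d (j + 1) x) = 0
      rw [map_neg, neg_neg, A.dd]

/-- The mapping cone of multiplication by `y`. -/
def cone (A : Cx S) (y : S) : Cx S where
  X | 0 => A.X 0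
    | j + 1 => A.X (j + 1) × A.X j
  grp | 0 => (inferInstance : AddCommGroup (A.X 0))
      | j + 1 => (inferInstance : AddCommGroup (A.X (j + 1) × A.X j))
  mod | 0 => (inferInstance : Module S (A.X 0))
      | j + 1 => (inferInstance : Module S (A.X (j + 1) × A.X j))
  d | 0 => LinearMap.coprod (A.d 0) (y • LinearMap.id)
    | j + 1 => LinearMap.prod (LinearMap.coprod (A.d (j + 1)) (y • LinearMap.id))
        (-(A.d j) ∘ₗ LinearMap.snd _ _ _)
  dd | 0, x => by
        change A.d 0 (A.d 1 x.1 + y • x.2) + y • (-A.d 0 x.2) = 0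
        rw [map_add, A.dd, map_smul]
        module
     | j + 1, x => by
        change (A.d (j + 1) (A.d (j + 2) x.1 + y • x.2) + y • (-A.d (j + 1) x.2),
          -A.d j (-A.d (j + 1) x.2)) = (0, 0)
        rw [map_add, A.dd, map_smul, map_neg, A.dd]
        simp

/-- The functor `cone · y` on short exact sequences. -/
def SES.cone {A B C : Cx S} (e : SES A B C) (y : S) : SES (A.cone y) (B.cone y) (C.cone y) where
  f | 0 => e.f 0
    | j + 1 => LinearMap.prodMap (e.f (j + 1)) (e.f j)
  g | 0 => e.g 0
    | j + 1 => LinearMap.prodMap (e.g (j + 1)) (e.g j)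
  f_comm
    | 0, x => by
      change e.f 0 (A.d 0 x.1 + y • x.2) = B.d 0 (e.f 1 x.1) + y • e.f 0 x.2
      rw [map_add, map_smul, e.f_comm]
    | j + 1, x => by
      change (e.f (j + 1) (A.d (j + 1) x.1 + y • x.2), e.f j (-A.d j x.2)) =
        (B.d (j + 1) (e.f _ x.1) + y • e.f _ x.2, -B.d j (e.f _ x.2))
      rw [map_add, map_smul, e.f_comm, map_neg, e.f_comm]
  g_comm
    | 0, x => by
      change e.g 0 (B.d 0 x.1 + y • x.2) = C.d 0 (e.g 1 x.1) + y • e.g 0 x.2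
      rw [map_add, map_smul, e.g_comm]
    | j + 1, x => by
      change (e.g (j + 1) (B.d (j + 1) x.1 + y • x.2), e.g j (-B.d j x.2)) =
        (C.d (j + 1) (e.g _ x.1) + y • e.g _ x.2, -C.d j (e.g _ x.2))
      rw [map_add, map_smul, e.g_comm, map_neg, e.g_comm]
  inj
    | 0 => e.inj 0
    | j + 1 => Function.Injective.prodMap (e.inj (j + 1)) (e.inj j)
  surj
    | 0 => e.surj 0
    | j + 1 => Function.Surjective.prodMap (e.surj (j + 1)) (e.surj j)
  exact
    | 0 => e.exact 0
    | j + 1 => by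
      rintro ⟨b, b'⟩
      change (e.g _ b, e.g _ b') = (0, 0) ↔ _
      rw [Prod.mk.injEq, e.exact (j + 1) b, e.exact j b']
      constructor
      · rintro ⟨⟨a, rfl⟩, ⟨a', rfl⟩⟩
        exact ⟨(a, a'), rfl⟩
      · rintro ⟨⟨a, a'⟩, h⟩
        exact ⟨⟨a, congrArg Prod.fst h⟩, ⟨a', congrArg Prod.snd h⟩⟩

/-- The short exact sequence of a mapping cone. -/
def coneSES (A : Cx S) (y : S) : SES A (A.cone y) A.shift where
  f | 0 => LinearMap.id
    | j + 1 => LinearMap.inl S (A.X (j + 1)) (A.X j)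
  g | 0 => 0
    | j + 1 => LinearMap.snd S (A.X (j + 1)) (A.X j)
  f_comm
    | 0, x => by
      change A.d 0 x = A.d 0 x + y • (0 : A.X 0)
      rw [smul_zero, add_zero]
    | j + 1, x => by
      change (A.d (j + 1) x, 0) = (A.d (j + 1) x + y • (0 : A.X (j + 1)), -A.d j 0)
      rw [smul_zero, add_zero, map_zero, neg_zero]
  g_comm
    | 0, x => rfl
    | j + 1, x => rfl
  inj
    | 0 => Function.injective_id
    | j + 1 => LinearMap.inl_injective
  surj
    | 0 => fun x => ⟨0, rfl⟩
    | j + 1 => LinearMap.snd_surjective (R := S) (M := A.X (j + 1)) (M₂ := A.X j)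
  exact
    | 0 => fun x => ⟨fun _ => ⟨x, rfl⟩, fun _ => rfl⟩
    | j + 1 => by
      rintro ⟨a, b⟩
      change b = 0 ↔ _
      constructor
      · rintro rfl
        exact ⟨a, rfl⟩
      · rintro ⟨x, hx⟩
        exact (congrArg Prod.snd hx).symm

/-- If `y` is a nonzerodivisor on `A` with quotient `C`, then `cone A y` is an extension of
`C` by the contractible complex `cone A 1`. -/
def coneQuotSES {A C : Cx S} (y : S) (e : SES A A C) (he : ∀ j x, e.f j x = y • x) :
    SES (A.cone 1) (A.cone y) C where
  f | 0 => e.f 0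
    | j + 1 => LinearMap.prodMap (e.f (j + 1)) LinearMap.id
  g | 0 => e.g 0
    | j + 1 => e.g (j + 1) ∘ₗ LinearMap.fst _ _ _
  f_comm
    | 0, x => by
      change e.f 0 (A.d 0 x.1 + (1 : S) • x.2) = A.d 0 (e.f 1 x.1) + y • x.2
      rw [map_add, e.f_comm, one_smul, he 0 x.2]
    | j + 1, x => by
      change (e.f (j + 1) (A.d (j + 1) x.1 + (1 : S) • x.2), -A.d j x.2) =
        (A.d (j + 1) (e.f _ x.1) + y • x.2, -A.d j x.2)
      rw [map_add, e.f_comm, one_smul, he _ x.2]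
  g_comm
    | 0, x => by
      change e.g 0 (A.d 0 x.1 + y • x.2) = C.d 0 (e.g 1 x.1)
      rw [map_add, ← he, (e.exact 0).apply_apply_eq_zero, add_zero, e.g_comm]
    | j + 1, x => by
      change e.g (j + 1) (A.d (j + 1) x.1 + y • x.2) = C.d (j + 1) (e.g _ x.1)
      rw [map_add, ← he, (e.exact _).apply_apply_eq_zero, add_zero, e.g_comm]
  inj
    | 0 => e.inj 0
    | j + 1 => Function.Injective.prodMap (e.inj (j + 1)) Function.injective_id
  surj
    | 0 => e.surj 0
    | j + 1 => (e.surj (j + 1)).comp LinearMap.fst_surjective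
  exact
    | 0 => e.exact 0
    | j + 1 => by
      rintro ⟨a, b⟩
      change e.g (j + 1) a = 0 ↔ _
      rw [e.exact (j + 1) a]
      constructor
      · rintro ⟨x, rfl⟩
        exact ⟨(x, b), rfl⟩
      · rintro ⟨x, hx⟩
        exact ⟨x.1, congrArg Prod.fst hx⟩

/-- `y` annihilates the homology of `cone A y`. -/
theorem smul_Z_cone (A : Cx S) (y : S) (j : ℕ) (z : (A.cone y).X j) (hz : z ∈ (A.cone y).Z j) :
    y • z ∈ (A.cone y).D j := by
  cases j with
  | zero =>
    refine ⟨(0, z), ?_⟩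
    change A.X 0 at z
    change A.d 0 0 + y • z = y • z
    rw [map_zero, zero_add]
  | succ j =>
    obtain ⟨a, b⟩ := z
    refine ⟨(0, a), ?_⟩
    change (A.d (j + 1) 0 + y • a, -A.d j a) = (y • a, y • b)
    rw [map_zero, zero_add]
    congr 1
    have h : A.d j a + y • b = 0 := by
      cases j with
      | zero => exact hz
      | succ j => exact congrArg Prod.fst hz
    exact neg_eq_of_add_eq_zero_right h

/-- The Koszul complex on a list of elements with coefficients in a complex. -/
def K : List S → Cx S → Cx S
  | [], A => A
  | y :: ys, A => K ys (A.cone y)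

/-- Koszul complexes preserve short exact sequences. -/
def SES.K {A B C : Cx S} : ∀ (ys : List S), SES A B C → SES (K ys A) (K ys B) (K ys C)
  | [], e => e
  | y :: ys, e => SES.K ys (e.cone y)

/-- The length at `P` of the Koszul homology. -/
noncomputable def kh (P : Ideal S) [P.IsPrime] (ys : List S) (A : Cx S) (j : ℕ) : ℕ∞ :=
  hl P (K ys A) j

section Numerics
variable {P : Ideal S} [P.IsPrime] {A B C : Cx S}

theorem hl_cone_of_notMem {y : S} (hy : y ∉ P) (j : ℕ) : hl P (A.cone y) j = 0 := by
  refine lam_eq_zero_iff.2 fun x => ⟨y, hy, ?_⟩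
  obtain ⟨⟨x, hx⟩, rfl⟩ := Submodule.mkQ_surjective _ x
  rw [← map_smul]
  exact (Submodule.Quotient.mk_eq_zero _).2 (smul_Z_cone A y j x hx)

theorem SES.kles (e : SES A B C) (P : Ideal S) [P.IsPrime] (ys : List S) :
    ∃ ρ σ τ : ℕ → ℕ∞, τ 0 = 0 ∧ (∀ j, kh P ys A j = τ (j + 1) + ρ j) ∧
      (∀ j, kh P ys B j = ρ j + σ j) ∧ ∀ j, kh P ys C j = σ j + τ j :=
  (SES.K ys e).les P

theorem SES.kh_eq_of_left (e : SES A B C) {ys : List S} (h : ∀ j, kh P ys A j = 0) (j : ℕ) :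
    kh P ys B j = kh P ys C j := by
  obtain ⟨ρ, σ, τ, h0, hA, hB, hC⟩ := e.kles P ys
  simp only [h, eq_comm (a := (0 : ℕ∞)), add_eq_zero] at hA
  cases j with
  | zero => rw [hB, hC, h0, (hA 0).2, zero_add, add_zero]
  | succ j => rw [hB, hC, (hA j).1, (hA (j + 1)).2, zero_add, add_zero]

theorem SES.kh_eq_of_mid (e : SES A B C) {ys : List S} (h : ∀ j, kh P ys B j = 0) :
    kh P ys C 0 = 0 ∧ ∀ j, kh P ys C (j + 1) = kh P ys A j := by
  obtain ⟨ρ, σ, τ, h0, hA, hB, hC⟩ := e.kles P ys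
  simp only [h, eq_comm (a := (0 : ℕ∞)), add_eq_zero] at hB
  refine ⟨by rw [hC, (hB 0).2, h0, add_zero], fun j => ?_⟩
  rw [hC, hA, (hB j).1, (hB (j + 1)).2, zero_add, add_zero]

theorem hl_cone_one (j : ℕ) : hl P (A.cone 1) j = 0 :=
  hl_cone_of_notMem ((Ideal.ne_top_iff_one P).1 (Ideal.IsPrime.ne_top ‹_›)) j

theorem hl_shift_zero : hl P A.shift 0 = 0 :=
  ((A.coneSES 1).kh_eq_of_mid (ys := []) hl_cone_one).1

theorem hl_shift_succ (j : ℕ) : hl P A.shift (j + 1) = hl P A j :=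
  ((A.coneSES 1).kh_eq_of_mid (ys := []) hl_cone_one).2 j

theorem kh_eq_zero (ys : List S) (h : ∀ j, hl P A j = 0) (j : ℕ) : kh P ys A j = 0 := by
  induction ys generalizing A with
  | nil => exact h j
  | cons y ys ih =>
    refine ih fun j => ?_
    obtain ⟨ρ, σ, τ, h0, hA, hB, hC⟩ := (A.coneSES y).les P
    have h1 : ρ j = 0 := by
      have := h j; rw [hA, add_eq_zero] at this; exact this.2
    have h2 : σ j = 0 := by
      have : hl P A.shift j = 0 := by
        cases j with
        | zero => exact hl_shift_zero
        | succ j => rw [hl_shift_succ, h]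
      rw [hC, add_eq_zero] at this; exact this.1
    rw [hB, h1, h2, add_zero]

theorem kh_shift_zero (ys : List S) : kh P ys A.shift 0 = 0 :=
  ((A.coneSES 1).kh_eq_of_mid (kh_eq_zero ys hl_cone_one)).1

theorem kh_shift_succ (ys : List S) (j : ℕ) : kh P ys A.shift (j + 1) = kh P ys A j :=
  ((A.coneSES 1).kh_eq_of_mid (kh_eq_zero ys hl_cone_one)).2 j

theorem kh_cons_of_regular {y : S} {ys : List S} (e : SES A A C) (he : ∀ j x, e.f j x = y • x)
    (j : ℕ) : kh P (y :: ys) A j = kh P ys C j :=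
  (coneQuotSES y e he).kh_eq_of_left (kh_eq_zero ys hl_cone_one) j

theorem kh_of_notMem {y : S} {ys : List S} (hy : y ∈ ys) (hyP : y ∉ P) (j : ℕ) :
    kh P ys A j = 0 := by
  induction ys generalizing A with
  | nil => simp at hy
  | cons z ys ih =>
    rcases List.mem_cons.1 hy with rfl | h
    · exact kh_eq_zero ys (hl_cone_of_notMem hyP) j
    · exact ih h

theorem kh_of_length {n : ℕ} (ys : List S) (h : ∀ j, n < j → hl P A j = 0) (j : ℕ)
    (hj : n + ys.length < j) : kh P ys A j = 0 := by
  induction ys generalizing A n with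
  | nil => exact h j hj
  | cons y ys ih =>
    refine ih (n := n + 1) (fun j hj => ?_) (by simp at hj; omega)
    obtain ⟨ρ, σ, τ, h0, hA, hB, hC⟩ := (A.coneSES y).les P
    have h1 : ρ j = 0 := by
      have := h j (by omega); rw [hA, add_eq_zero] at this; exact this.2
    have h2 : σ j = 0 := by
      obtain ⟨j, rfl⟩ : ∃ i, j = i + 1 := ⟨j - 1, by omega⟩
      have : hl P A.shift (j + 1) = 0 := by
        rw [hl_shift_succ, h j (by omega)]
      rw [hC, add_eq_zero] at this; exact this.1
    rw [hB, h1, h2, add_zero]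

/-- All terms of the complex are finitely generated. -/
class Fin (A : Cx S) : Prop where
  out : ∀ j, Module.Finite S (A.X j)

instance [A.Fin] (j : ℕ) : Module.Finite S (A.X j) := Fin.out j

instance [A.Fin] (y : S) : (A.cone y).Fin where
  out
    | 0 => inferInstanceAs (Module.Finite S (A.X 0))
    | j + 1 => inferInstanceAs (Module.Finite S (A.X (j + 1) × A.X j))

instance [A.Fin] (ys : List S) : (K ys A).Fin := by
  induction ys generalizing A with
  | nil => assumption
  | cons y ys ih => exact ih (A := A.cone y)

instance (B : Type u) [AddCommGroup B] [Module S B] [Module.Finite S B] :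
    (single B : Cx S).Fin where
  out
    | 0 => inferInstanceAs (Module.Finite S B)
    | _ + 1 => inferInstanceAs (Module.Finite S PUnit.{u + 1})

theorem kh_ne_top [IsNoetherianRing S] [A.Fin] {ys : List S}
    (h : ∀ (Q : Ideal S) [Q.IsPrime], Q < P → ∀ j, kh Q ys A j = 0) (j : ℕ) :
    kh P ys A j ≠ ⊤ :=
  lam_ne_top fun Q _ hQ => h Q hQ j

theorem kh_zero_of_lt {ys : List S} {j : ℕ} (h : kh P ys A j ≠ ⊤) (Q : Ideal S) [Q.IsPrime]
    (hQ : Q < P) : kh Q ys A j = 0 :=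
  lam_eq_zero_of_lt h Q hQ

theorem hl_zero_of_kh [IsNoetherianRing S] [A.Fin] {ys : List S} (hys : ∀ y ∈ ys, y ∈ P)
    (h : kh P ys A 0 = 0) : hl P A 0 = 0 := by
  induction ys generalizing A with
  | nil => exact h
  | cons y ys ih =>
    have h1 := ih (A := A.cone y) (fun z hz => hys z (by simp [hz])) h
    refine lam_eq_zero_of_quot (Ideal.span {y})
      (by rw [Ideal.span_singleton_le_iff_mem]; exact hys y (by simp)) ?_
    let φ : (A.cone y).Z 0 →ₗ[S] A.H 0 := Submodule.mkQ ((A.D 0).comap (A.Z 0).subtype)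
    refine nonpos_iff_eq_zero.1 ((lam_le_of_surjective (Submodule.mapQ
      (((A.cone y).D 0).comap ((A.cone y).Z 0).subtype) _ φ ?_) ?_).trans_eq h1)
    · rintro ⟨_, _⟩ ⟨⟨a, b⟩, rfl⟩
      change A.X 1 at a
      change A.X 0 at b
      change (Submodule.mkQ ((A.D 0).comap (A.Z 0).subtype) ⟨A.d 0 a + y • b, trivial⟩) ∈
        (Ideal.span {y} • ⊤ : Submodule S (A.H 0))
      have : (⟨A.d 0 a + y • b, trivial⟩ : A.Z 0) = ⟨A.d 0 a, trivial⟩ + y • ⟨b, trivial⟩ := rfl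
      rw [this, map_add, map_smul]
      refine add_mem ?_ (Submodule.smul_mem_smul (Ideal.mem_span_singleton_self y) trivial)
      have h0 : (Submodule.mkQ ((A.D 0).comap (A.Z 0).subtype)) ⟨A.d 0 a, trivial⟩ = 0 :=
        (Submodule.Quotient.mk_eq_zero _).2 ⟨a, rfl⟩
      rw [h0]
      exact zero_mem _
    · intro x
      obtain ⟨x, rfl⟩ := Submodule.mkQ_surjective _ x
      obtain ⟨x, rfl⟩ := Submodule.mkQ_surjective _ x
      exact ⟨Submodule.Quotient.mk x, rfl⟩

theorem hl_single_zero (B : Type u) [AddCommGroup B] [Module S B] :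
    hl P (single B : Cx S) 0 = lam P B := by
  rw [hl, subLam, lam, show (single B : Cx S).D 0 = ⊥ from LinearMap.range_zero]
  have e : ((single B : Cx S).Z 0 ⧸ (⊥ : Submodule S _).comap ((single B : Cx S).Z 0).subtype)
      ≃ₗ[S] B :=
    (Submodule.quotEquivOfEqBot _ (by
      rw [Submodule.comap_bot, LinearMap.ker_eq_bot]; exact Subtype.val_injective)).trans
      (Submodule.topEquiv (R := S) (M := B))
  exact lam_congr e

theorem hl_of_subsingleton (j : ℕ) [Subsingleton (A.X j)] : hl P A j = 0 := by
  have : Subsingleton (A.Z j) := inferInstance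
  exact lam_of_subsingleton

theorem hl_single_succ (B : Type u) [AddCommGroup B] [Module S B] (j : ℕ) :
    hl P (single B : Cx S) (j + 1) = 0 := by
  have : Subsingleton ((single B : Cx S).X (j + 1)) := inferInstanceAs (Subsingleton PUnit.{u + 1})
  exact hl_of_subsingleton _

theorem kh_single_of_lam (B : Type u) [AddCommGroup B] [Module S B] (h : lam P B = 0)
    (ys : List S) (j : ℕ) : kh P ys (single B) j = 0 := by
  refine kh_eq_zero ys (fun j => ?_) j
  cases j with
  | zero => rw [hl_single_zero, h]
  | succ j => exact hl_single_succ B j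

theorem kh_single_length (B : Type u) [AddCommGroup B] [Module S B] (ys : List S) (j : ℕ)
    (hj : ys.length < j) : kh P ys (single B) j = 0 := by
  refine kh_of_length (n := 0) ys (fun j hj => ?_) j (by omega)
  obtain ⟨j, rfl⟩ : ∃ i, j = i + 1 := ⟨j - 1, by omega⟩
  exact hl_single_succ B j

theorem lam_zero_of_kh [IsNoetherianRing S] {B : Type u} [AddCommGroup B] [Module S B]
    [Module.Finite S B] {ys : List S} (hys : ∀ y ∈ ys, y ∈ P)
    (h : kh P ys (single B) 0 = 0) : lam P B = 0 := by
  rw [← hl_single_zero]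
  exact hl_zero_of_kh hys h

/-- A short exact sequence of modules as one of complexes. -/
def singleSES {A B C : Type u} [AddCommGroup A] [Module S A] [AddCommGroup B] [Module S B]
    [AddCommGroup C] [Module S C] (f : A →ₗ[S] B) (g : B →ₗ[S] C) (hf : Function.Injective f)
    (hg : Function.Surjective g) (hfg : Function.Exact f g) :
    SES (single A : Cx S) (single B) (single C) where
  f | 0 => f
    | _ + 1 => (LinearMap.id : PUnit.{u + 1} →ₗ[S] PUnit.{u + 1})
  g | 0 => g
    | _ + 1 => (LinearMap.id : PUnit.{u + 1} →ₗ[S] PUnit.{u + 1})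
  f_comm
    | 0, _ => map_zero f
    | _ + 1, _ => rfl
  g_comm
    | 0, _ => map_zero g
    | _ + 1, _ => rfl
  inj
    | 0 => hf
    | _ + 1 => Function.injective_id
  surj
    | 0 => hg
    | _ + 1 => Function.surjective_id
  exact
    | 0 => hfg
    | _ + 1 => fun x => ⟨fun _ => ⟨x, rfl⟩, fun _ => rfl⟩

end Numerics
end Cx
end ExtRigid

namespace ExtRigid

/-- The alternating sum of the first `N` terms of a sequence of lengths. -/
noncomputable def chi (N : ℕ) (t : ℕ → ℕ∞) : ℤ :=
  ∑ j ∈ Finset.range N, (-1) ^ j * ((t j).toNat : ℤ)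

theorem chi_succ (N : ℕ) (t : ℕ → ℕ∞) :
    chi (N + 1) t = ((t 0).toNat : ℤ) - chi N (fun j => t (j + 1)) := by
  rw [chi, Finset.sum_range_succ', chi, sub_eq_add_neg, add_comm, ← Finset.sum_neg_distrib]
  simp [pow_succ]

theorem chi_succ_last (N : ℕ) (t : ℕ → ℕ∞) (h : t N = 0) : chi (N + 1) t = chi N t := by
  rw [chi, Finset.sum_range_succ, h, chi]
  simp

theorem chi_eq_zero {N : ℕ} {t : ℕ → ℕ∞} (h : ∀ j, t j = 0) : chi N t = 0 :=
  Finset.sum_eq_zero fun j _ => by simp [h]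

theorem chi_les {A B C ρ σ τ : ℕ → ℕ∞} (hA : ∀ j, A j = τ (j + 1) + ρ j)
    (hB : ∀ j, B j = ρ j + σ j) (hC : ∀ j, C j = σ j + τ j) (fA : ∀ j, A j ≠ ⊤)
    (fC : ∀ j, C j ≠ ⊤) (N : ℕ) (hN : C N = 0) :
    chi N A + chi N C = chi N B + ((τ 0).toNat : ℤ) := by
  have fρ : ∀ j, ρ j ≠ ⊤ := fun j => (WithTop.add_ne_top.1 (hA j ▸ fA j)).2
  have fσ : ∀ j, σ j ≠ ⊤ := fun j => (WithTop.add_ne_top.1 (hC j ▸ fC j)).1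
  have fτ : ∀ j, τ j ≠ ⊤ := fun j => (WithTop.add_ne_top.1 (hC j ▸ fC j)).2
  have h : ∀ n, chi n A + chi n C = chi n B + ((τ 0).toNat : ℤ) - (-1) ^ n * (τ n).toNat := by
    intro n
    induction n with
    | zero => simp [chi]
    | succ n ih =>
      rw [chi, chi, chi, Finset.sum_range_succ, Finset.sum_range_succ, Finset.sum_range_succ,
        hA, hB, hC, ENat.toNat_add (fτ _) (fρ _), ENat.toNat_add (fρ _) (fσ _),
        ENat.toNat_add (fσ _) (fτ _), pow_succ]
      rw [chi, chi, chi] at ih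
      push_cast
      linear_combination ih
  rw [hC, add_eq_zero] at hN
  rw [h, hN.2]
  simp

namespace Cx
variable {S : Type u} [CommRing S]

theorem chi_cone {P : Ideal S} [P.IsPrime] {A : Cx S} (y : S) (ys : List S)
    (fA : ∀ j, kh P ys A j ≠ ⊤) (N : ℕ) (hN : kh P ys A N = 0) :
    chi (N + 1) (kh P (y :: ys) A) = 0 := by
  obtain ⟨ρ, σ, τ, h0, hA, hB, hC⟩ := (A.coneSES y).kles P ys
  have fC : ∀ j, kh P ys A.shift j ≠ ⊤ := by
    rintro (_ | j)
    · simp [kh_shift_zero]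
    · rw [kh_shift_succ]; exact fA j
  have h1 := chi_les hA hB hC fA fC (N + 1) (by rw [kh_shift_succ, hN])
  rw [h0, chi_succ N (kh P ys A.shift), kh_shift_zero, chi_succ_last _ _ hN] at h1
  simp only [kh_shift_succ] at h1
  change chi (N + 1) (kh P ys (A.cone y)) = 0
  simpa using h1.symm

/-- Elements killed by a power of `y`. -/
abbrev powTorsion (y : S) (B : Type u) [AddCommGroup B] [Module S B] : Submodule S B :=
  Submodule.torsion' S B (Submonoid.powers y)

theorem mem_powTorsion {y : S} {B : Type u} [AddCommGroup B] [Module S B] {x : B} :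
    x ∈ powTorsion y B ↔ ∃ n : ℕ, y ^ n • x = 0 := by
  rw [Submodule.mem_torsion'_iff]
  constructor
  · rintro ⟨⟨_, n, rfl⟩, h⟩
    exact ⟨n, h⟩
  · rintro ⟨n, h⟩
    exact ⟨⟨_, n, rfl⟩, h⟩

section
variable (B : Type u) [AddCommGroup B] [Module S B]

/-- Multiplication by a nonzerodivisor as a short exact sequence. -/
noncomputable def smulSES (y : S) (h : ∀ x : B, y • x = 0 → x = 0) :
    SES (single B : Cx S) (single B) (single (B ⧸ LinearMap.range (y • (LinearMap.id : B →ₗ[S] B)))) :=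
  singleSES (y • LinearMap.id) (Submodule.mkQ _)
    (by rw [← LinearMap.ker_eq_bot, LinearMap.ker_eq_bot']; exact h)
    (Submodule.mkQ_surjective _) (LinearMap.exact_map_mkQ_range _)

theorem kh_cons_single {P : Ideal S} [P.IsPrime] (y : S) (ys : List S)
    (h : ∀ x : B, y • x = 0 → x = 0) (j : ℕ) :
    kh P (y :: ys) (single B) j =
      kh P ys (single (B ⧸ LinearMap.range (y • (LinearMap.id : B →ₗ[S] B)))) j := by
  refine kh_cons_of_regular (smulSES B y h) ?_ j
  rintro (_ | j) x
  · rfl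
  · exact Subsingleton.elim (α := PUnit) _ _

/-- The sequence of a submodule and its quotient. -/
noncomputable def quotSES (L : Submodule S B) : SES (single L : Cx S) (single B) (single (B ⧸ L)) :=
  singleSES L.subtype L.mkQ L.injective_subtype L.mkQ_surjective (LinearMap.exact_subtype_mkQ L)

theorem smul_quot_powTorsion (y : S) (x : B ⧸ powTorsion y B) (h : y • x = 0) : x = 0 := by
  obtain ⟨x, rfl⟩ := Submodule.mkQ_surjective _ x
  rw [← map_smul, Submodule.mkQ_apply, Submodule.Quotient.mk_eq_zero, mem_powTorsion] at h
  obtain ⟨n, h⟩ := h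
  rw [Submodule.mkQ_apply, Submodule.Quotient.mk_eq_zero, mem_powTorsion]
  exact ⟨n + 1, by rw [pow_succ, mul_smul, h]⟩

theorem lam_powTorsion_of_notMem {P : Ideal S} [hP : P.IsPrime] {y : S} (hy : y ∉ P) :
    lam P (powTorsion y B) = 0 := by
  refine lam_eq_zero_iff.2 fun ⟨x, hx⟩ => ?_
  obtain ⟨n, h⟩ := mem_powTorsion.1 hx
  exact ⟨y ^ n, fun h => hy (hP.mem_of_pow_mem _ h), Subtype.ext h⟩

/-- The alternating sum decomposition along the torsion of the first Koszul element. -/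
theorem chi_step {P : Ideal S} [P.IsPrime] (y : S) (ys : List S) {N : ℕ} (hN : ys.length + 1 ≤ N)
    (hfin : ∀ j, kh P (y :: ys) (single B) (j + 1) ≠ ⊤)
    (h1 : ∀ j, kh P ys (single (powTorsion y B)) j ≠ ⊤)
    (h2 : ∀ j, kh P (y :: ys) (single (powTorsion y B)) j ≠ ⊤) :
    ∃ r s : ℕ∞, kh P (y :: ys) (single (powTorsion y B)) 0 = s + r ∧
      s ≤ kh P (y :: ys) (single (B ⧸ powTorsion y B)) 1 ∧
      chi N (fun j => kh P (y :: ys) (single B) (j + 1)) =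
        (r.toNat : ℤ) + chi N (fun j => kh P (y :: ys) (single (B ⧸ powTorsion y B)) (j + 1)) ∧
      (∀ j, kh P (y :: ys) (single (B ⧸ powTorsion y B)) (j + 1) ≠ ⊤) ∧
      r ≤ kh P (y :: ys) (single B) 0 ∧
      (kh P (y :: ys) (single B) 0 ≠ ⊤ →
        kh P (y :: ys) (single (B ⧸ powTorsion y B)) 0 ≠ ⊤ ) ∧
      (kh P (y :: ys) (single B) 0 ≠ ⊤ → chi (N + 1) (kh P (y :: ys) (single B)) =
        chi (N + 1) (kh P (y :: ys) (single (B ⧸ powTorsion y B)))) := by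
  obtain ⟨ρ, σ, τ, h0, hA, hB, hC⟩ := (quotSES B (powTorsion y B)).kles P (y :: ys)
  have fτ : ∀ j, τ (j + 1) ≠ ⊤ := fun j => (WithTop.add_ne_top.1 (hA j ▸ h2 j)).1
  have fρ : ∀ j, ρ j ≠ ⊤ := fun j => (WithTop.add_ne_top.1 (hA j ▸ h2 j)).2
  have fσ : ∀ j, σ (j + 1) ≠ ⊤ := fun j => (WithTop.add_ne_top.1 (hB _ ▸ hfin j)).2
  have fC : ∀ j, kh P (y :: ys) (single (B ⧸ powTorsion y B)) (j + 1) ≠ ⊤ := fun j => by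
    rw [hC]; exact WithTop.add_ne_top.2 ⟨fσ j, fτ j⟩
  have fC0 : kh P (y :: ys) (single B) 0 ≠ ⊤ →
      kh P (y :: ys) (single (B ⧸ powTorsion y B)) 0 ≠ ⊤ := by
    intro h
    rw [hC, h0, add_zero]
    exact (WithTop.add_ne_top.1 (hB _ ▸ h)).2
  have e1 := chi_les (fun j => hA (j + 1)) (fun j => hB (j + 1)) (fun j => hC (j + 1))
    (fun j => h2 (j + 1)) fC N (kh_single_length _ _ _ (by simp; omega))
  have e2 : chi (N + 1) (kh P (y :: ys) (single (powTorsion y B))) = 0 :=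
    chi_cone y ys h1 N (kh_single_length _ _ _ (by omega))
  refine ⟨ρ 0, τ 1, hA 0, ?_, ?_, fC, ?_, fC0, fun h => ?_⟩
  · rw [hC]; exact le_add_self
  · rw [chi_succ, hA 0, ENat.toNat_add (fτ 0) (fρ 0)] at e2
    push_cast at e2
    linear_combination -e1 - e2
  · rw [hB]; exact le_self_add
  · have := chi_les hA hB hC h2 (fun | 0 => fC0 h | j + 1 => fC j) (N + 1)
      (kh_single_length _ _ _ (by simp; omega))
    rw [e2, h0] at this
    simpa using this.symm

variable [IsNoetherianRing S]

/-- Nonnegativity of higher Koszul Euler characteristics, with the equality case. -/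
theorem kosz_nonneg (ys : List S) : ∀ (N : ℕ), ys.length ≤ N → ∀ (P : Ideal S) (_hP : P.IsPrime),
    (∀ y ∈ ys, y ∈ P) → ∀ (B : Type u) [AddCommGroup B] [Module S B] [Module.Finite S B],
    (∀ j, kh P ys (single B) (j + 1) ≠ ⊤) →
    0 ≤ chi N (fun j => kh P ys (single B) (j + 1)) ∧
      (chi N (fun j => kh P ys (single B) (j + 1)) = 0 →
        ∀ j, kh P ys (single B) (j + 1) = 0) := by
  induction ys with
  | nil =>
    intro N _ P hP _ B _ _ _ _
    have h : ∀ j, kh P [] (single B : Cx S) (j + 1) = 0 := fun j => hl_single_succ B j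
    exact ⟨(chi_eq_zero h).ge, fun _ => h⟩
  | cons y ys ih =>
    intro N hN P hP hys B _ _ _ hfin
    have key : ∀ (P : Ideal S) (hP : P.IsPrime), (∀ z ∈ y :: ys, z ∈ P) →
        (∀ j, kh P (y :: ys) (single B) (j + 1) ≠ ⊤) →
        0 ≤ chi N (fun j => kh P (y :: ys) (single B) (j + 1)) ∧
        (chi N (fun j => kh P (y :: ys) (single B) (j + 1)) = 0 →
        (∀ j, kh P (y :: ys) (single B) (j + 1) = 0) ∧ lam P (powTorsion y B) = 0) := by
      intro P hP
      induction P, hP using prime_induction (S := S) with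
      | step P hP ihP =>
      intro hys hfin
      have hQ : ∀ (Q : Ideal S) [Q.IsPrime], Q < P → (∃ z ∈ ys, z ∉ Q) ∨
          lam Q (powTorsion y B) = 0 := by
        intro Q _ hQ
        by_cases hy : y ∈ Q
        · by_cases hz : ∃ z ∈ ys, z ∉ Q
          · exact Or.inl hz
          · push Not at hz
            have h0 : ∀ j, kh Q (y :: ys) (single B) (j + 1) = 0 :=
              fun j => kh_zero_of_lt (hfin j) Q hQ
            refine Or.inr ((ihP Q ‹_› hQ ?_ (fun j => by simp [h0])).2 (chi_eq_zero h0)).2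
            rintro z hz'
            rcases List.mem_cons.1 hz' with rfl | h
            · exact hy
            · exact hz z h
        · exact Or.inr (lam_powTorsion_of_notMem B hy)
      have f1 : ∀ j, kh P ys (single (powTorsion y B)) j ≠ ⊤ := by
        refine kh_ne_top fun Q _ hlt j => ?_
        rcases hQ Q hlt with ⟨z, hz, hzQ⟩ | h
        · exact kh_of_notMem hz hzQ j
        · exact kh_single_of_lam _ h _ j
      have f2 : ∀ j, kh P (y :: ys) (single (powTorsion y B)) j ≠ ⊤ := by
        refine kh_ne_top fun Q _ hlt j => ?_
        rcases hQ Q hlt with ⟨z, hz, hzQ⟩ | h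
        · exact kh_of_notMem (List.mem_cons_of_mem _ hz) hzQ j
        · exact kh_single_of_lam _ h _ j
      obtain ⟨r, s, hrs, hs, hchi, hf, -, -⟩ := chi_step B y ys hN hfin f1 f2
      have hreg := smul_quot_powTorsion B y
      simp only [kh_cons_single _ _ _ hreg] at hf hchi hs
      obtain ⟨i1, i2⟩ := ih N (by simp at hN; omega) P hP
        (fun z hz => hys z (List.mem_cons_of_mem _ hz)) _ hf
      refine ⟨by rw [hchi]; positivity, fun h0 => ?_⟩
      have hr : r.toNat = 0 := by
        rw [hchi] at h0; omega
      have i3 := i2 (by rw [hchi, hr] at h0; simpa using h0)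
      have hr0 : r = 0 := by
        rcases ENat.toNat_eq_zero.1 hr with h | h
        · exact h
        · exact absurd (hrs.trans (by rw [h, add_top])) (f2 0)
      have hs0 : s = 0 := nonpos_iff_eq_zero.1 (hs.trans_eq (i3 0))
      have hΓ : lam P (powTorsion y B) = 0 := lam_zero_of_kh hys (by rw [hrs, hr0, hs0, add_zero])
      refine ⟨fun j => ?_, hΓ⟩
      rw [(quotSES B (powTorsion y B)).kh_eq_of_left (fun j => kh_single_of_lam _ hΓ _ j),
        kh_cons_single _ _ _ hreg]
      exact i3 j
    exact ⟨(key P hP hys hfin).1, fun h => ((key P hP hys hfin).2 h).1⟩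

theorem kh_finite_of_lam {B : Type u} [AddCommGroup B] [Module S B] [Module.Finite S B]
    {ys : List S} {P : Ideal S} [P.IsPrime]
    (h : ∀ (Q : Ideal S) [Q.IsPrime], Q < P → (∀ y ∈ ys, y ∈ Q) → lam Q B = 0) (j : ℕ) :
    kh P ys (single B) j ≠ ⊤ := by
  refine kh_ne_top (fun Q _ hlt j => ?_) j
  by_cases hz : ∃ z ∈ ys, z ∉ Q
  · obtain ⟨z, hz, hzQ⟩ := hz
    exact kh_of_notMem hz hzQ j
  · push Not at hz
    exact kh_single_of_lam _ (h Q hlt hz) _ j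

theorem lam_of_kh_finite {B : Type u} [AddCommGroup B] [Module S B] [Module.Finite S B]
    {ys : List S} {P : Ideal S} [P.IsPrime] (h : kh P ys (single B) 0 ≠ ⊤) (Q : Ideal S)
    [Q.IsPrime] (hlt : Q < P) (hys : ∀ y ∈ ys, y ∈ Q) : lam Q B = 0 :=
  lam_zero_of_kh hys (kh_zero_of_lt h Q hlt)

/-- Nonnegativity of the full Koszul Euler characteristic. -/
theorem kosz_full_nonneg (ys : List S) : ∀ (N : ℕ), ys.length ≤ N → ∀ (P : Ideal S)
    (_hP : P.IsPrime), (∀ y ∈ ys, y ∈ P) → ∀ (B : Type u) [AddCommGroup B] [Module S B]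
    [Module.Finite S B], kh P ys (single B) 0 ≠ ⊤ → 0 ≤ chi (N + 1) (kh P ys (single B)) := by
  induction ys with
  | nil =>
    intro N _ P hP _ B _ _ _ _
    have h : ∀ j, kh P [] (single B : Cx S) (j + 1) = 0 := fun j => hl_single_succ B j
    rw [chi_succ, chi_eq_zero h]
    simp
  | cons y ys ih =>
    intro N hN P hP hys B _ _ _ hfin
    have hQ := lam_of_kh_finite hfin
    have hΓ : ∀ (Q : Ideal S) [Q.IsPrime], Q < P → (∀ z ∈ ys, z ∈ Q) →
        lam Q (powTorsion y B) = 0 := by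
      intro Q _ hlt hz
      by_cases hy : y ∈ Q
      · refine nonpos_iff_eq_zero.1 ((lam_le_of_injective (powTorsion y B).subtype
          (powTorsion y B).injective_subtype).trans_eq (hQ Q hlt ?_))
        intro z hz'
        rcases List.mem_cons.1 hz' with rfl | h
        · exact hy
        · exact hz z h
      · exact lam_powTorsion_of_notMem B hy
    obtain ⟨r, s, -, -, -, -, -, h0, hchi⟩ := chi_step B y ys hN
      (fun j => kh_finite_of_lam (fun Q _ => hQ Q) (j + 1)) (kh_finite_of_lam hΓ)
      (kh_finite_of_lam fun Q _ hlt hz => hΓ Q hlt fun z h => hz z (List.mem_cons_of_mem _ h))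
    rw [hchi hfin]
    have := h0 hfin
    have hreg := smul_quot_powTorsion B y
    have e : kh P (y :: ys) (single (B ⧸ powTorsion y B)) = _ := funext (kh_cons_single _ _ _ hreg)
    rw [e] at this ⊢
    exact ih N (by simp at hN; omega) P hP (fun z hz => hys z (List.mem_cons_of_mem _ hz)) _ this

/-- A submodule with vanishing Euler characteristic of a module with vanishing higher Koszul
homology is zero. -/
theorem lam_zero_of_chi {ys : List S} {N : ℕ} (hN : ys.length ≤ N) {P : Ideal S} [hP : P.IsPrime]
    (hys : ∀ y ∈ ys, y ∈ P) {B : Type u} [AddCommGroup B] [Module S B] [Module.Finite S B]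
    (hB : ∀ j, kh P ys (single B) (j + 1) = 0) (L : Submodule S B)
    (hL : kh P ys (single L) 0 ≠ ⊤) (hchi : chi (N + 1) (kh P ys (single L)) = 0) :
    lam P L = 0 := by
  obtain ⟨ρ, σ, τ, h0, hA, hB', hC⟩ := (quotSES B L).kles P ys
  have fA : ∀ j, kh P ys (single L) j ≠ ⊤ := kh_finite_of_lam fun Q _ => lam_of_kh_finite hL Q
  have fτ : ∀ j, τ (j + 1) ≠ ⊤ := fun j => (WithTop.add_ne_top.1 (hA j ▸ fA j)).1
  have fρ : ∀ j, ρ j ≠ ⊤ := fun j => (WithTop.add_ne_top.1 (hA j ▸ fA j)).2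
  have hσ : ∀ j, σ (j + 1) = 0 := fun j => by
    have := hB j
    rw [hB', add_eq_zero] at this
    exact this.2
  have fC : ∀ j, kh P ys (single (B ⧸ L)) (j + 1) ≠ ⊤ := fun j => by
    rw [hC, hσ, zero_add]; exact fτ j
  have e1 := chi_les (fun j => hA (j + 1)) (fun j => hB' (j + 1)) (fun j => hC (j + 1))
    (fun j => fA (j + 1)) fC N (kh_single_length _ _ _ (by omega))
  rw [chi_eq_zero hB] at e1
  change _ = 0 + ((τ 1).toNat : ℤ) at e1
  have hA0 : kh P ys (single L) 0 = τ 1 + ρ 0 := hA 0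
  rw [chi_succ, hA0, ENat.toNat_add (fτ 0) (fρ 0)] at hchi
  push_cast at hchi
  obtain ⟨n1, n2⟩ := kosz_nonneg ys N hN P hP hys (B ⧸ L) fC
  have hρ : (ρ 0).toNat = 0 := by omega
  have hρ0 : ρ 0 = 0 := (ENat.toNat_eq_zero.1 hρ).resolve_right (fρ 0)
  have hτ : τ 1 = 0 := by
    have := n2 (by rw [hρ] at hchi; linear_combination e1 + hchi) 0
    rw [hC, add_eq_zero] at this
    exact this.2
  exact lam_zero_of_kh hys (by rw [hA, hτ, hρ0, add_zero])

end
end Cx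
end ExtRigid

namespace ExtRigid
open TensorProduct

theorem snake_inj {S : Type*} [CommRing S] {kT kN kW fT fN fW aT aN : Type*}
    [AddCommGroup kT] [Module S kT] [AddCommGroup kN] [Module S kN] [AddCommGroup kW] [Module S kW]
    [AddCommGroup fT] [Module S fT] [AddCommGroup fN] [Module S fN] [AddCommGroup fW] [Module S fW]
    [AddCommGroup aT] [Module S aT] [AddCommGroup aN] [Module S aN]
    {iT : kT →ₗ[S] fT} {pT : fT →ₗ[S] aT} {iN : kN →ₗ[S] fN} {pN : fN →ₗ[S] aN}
    {iW : kW →ₗ[S] fW} {jk : kT →ₗ[S] kN} {qk : kN →ₗ[S] kW} {jf : fT →ₗ[S] fN}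
    {qf : fN →ₗ[S] fW} {ja : aT →ₗ[S] aN} (hiW : Function.Injective iW)
    (hjf : Function.Injective jf) (hpT : Function.Surjective pT)
    (hT : ∀ x, pT (iT x) = 0) (hN : Function.Exact iN pN) (hk : Function.Exact jk qk)
    (hf : ∀ x, qf (jf x) = 0)
    (c1 : ∀ x, ja (pT x) = pN (jf x)) (c2 : ∀ x, iN (jk x) = jf (iT x))
    (c3 : ∀ x, iW (qk x) = qf (iN x)) : Function.Injective ja := by
  rw [injective_iff_map_eq_zero]
  intro x hx
  obtain ⟨x, rfl⟩ := hpT x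
  rw [c1] at hx
  obtain ⟨z, hz⟩ := (hN _).1 hx
  have h0 : qk z = 0 := hiW (by rw [c3, hz, hf, map_zero])
  obtain ⟨z, rfl⟩ := (hk _).1 h0
  rw [c2] at hz
  rw [← hjf hz, hT]

theorem inj_of_nakayama {S : Type*} [CommRing S] [IsNoetherianRing S] [IsLocalRing S] {M M' : Type*}
    [AddCommGroup M] [Module S M] [Module.Finite S M] [AddCommGroup M'] [Module S M']
    (f : M →ₗ[S] M') (h : ∀ x, f x = 0 → x ∈ maximalIdeal S • LinearMap.ker f) :
    Function.Injective f := by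
  have := isNoetherian_of_isNoetherianRing_of_finite S M
  exact LinearMap.ker_eq_bot.1 (Submodule.eq_bot_of_le_smul_of_le_jacobson_bot (maximalIdeal S) _
    (IsNoetherian.noetherian _) (fun x hx => h x hx)
    (by rw [IsLocalRing.jacobson_eq_maximalIdeal _ bot_ne_top]))

section
variable {Q : Type*} [CommRing Q] {S : Type*} [CommRing S] [Algebra Q S]
  {C C' C'' : Type*} [AddCommGroup C] [Module Q C] [AddCommGroup C'] [Module Q C']
  [AddCommGroup C''] [Module Q C'']
  {U U' U'' : Type*} [AddCommGroup U] [Module S U] [AddCommGroup U'] [Module S U']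
  [AddCommGroup U''] [Module S U'']

/-- The module `(S ⊗[Q] C) ⊗[S] U`. -/
def BT (Q : Type*) [CommRing Q] (S : Type*) [CommRing S] [Algebra Q S]
    (C : Type*) [AddCommGroup C] [Module Q C] (U : Type*) [AddCommGroup U] [Module S U] : Type _ :=
  (S ⊗[Q] C) ⊗[S] U

noncomputable instance : AddCommGroup (BT Q S C U) :=
  inferInstanceAs (AddCommGroup ((S ⊗[Q] C) ⊗[S] U))

noncomputable instance : Module S (BT Q S C U) :=
  inferInstanceAs (Module S ((S ⊗[Q] C) ⊗[S] U))

instance [Module.Finite Q C] [Module.Finite S U] : Module.Finite S (BT Q S C U) :=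
  inferInstanceAs (Module.Finite S ((S ⊗[Q] C) ⊗[S] U))

/-- Elementary tensors in `BT`. -/
def bt (Q : Type*) [CommRing Q] {S : Type*} [CommRing S] [Algebra Q S]
    {C : Type*} [AddCommGroup C] [Module Q C] {U : Type*} [AddCommGroup U] [Module S U]
    (x : S ⊗[Q] C) (u : U) : BT Q S C U := x ⊗ₜ[S] u

theorem bt_ind {p : BT Q S C U → Prop} (h0 : p 0) (ha : ∀ x y, p x → p y → p (x + y))
    (h1 : ∀ c u, p (bt Q (1 ⊗ₜ c) u)) (x : BT Q S C U) : p x := by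
  refine TensorProduct.induction_on (motive := p) x h0 (fun x u => ?_) ha
  refine TensorProduct.induction_on (motive := fun x => ∀ u : U, p (x ⊗ₜ[S] u)) x ?_ ?_ ?_ u
  · intro u; rw [zero_tmul]; exact h0
  · intro s c u
    have : (s ⊗ₜ[Q] c : S ⊗[Q] C) = s • (1 ⊗ₜ c) := by
      rw [TensorProduct.smul_tmul', smul_eq_mul, mul_one]
    rw [this, TensorProduct.smul_tmul]
    exact h1 c (s • u)
  · intro x y hx hy u
    rw [add_tmul]
    exact ha _ _ (hx u) (hy u)

theorem bt_add_right (x : S ⊗[Q] C) (u v : U) : bt Q x (u + v) = bt Q x u + bt Q x v :=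
  tmul_add _ _ _

theorem bt_add_left (x y : S ⊗[Q] C) (u : U) : bt Q (x + y) u = bt Q x u + bt Q y u :=
  add_tmul _ _ _

theorem smul_bt (s : S) (x : S ⊗[Q] C) (u : U) : s • bt Q x u = bt Q x (s • u) :=
  (TensorProduct.tmul_smul s x u).symm

theorem smul_bt_left (s : S) (x : S ⊗[Q] C) (u : U) : s • bt Q x u = bt Q (s • x) u :=
  TensorProduct.smul_tmul' s x u

instance [Subsingleton C] : Subsingleton (BT Q S C U) := by
  refine subsingleton_of_forall_eq 0 fun x => ?_
  induction x using bt_ind with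
  | h0 => rfl
  | ha x y hx hy => rw [hx, hy, add_zero]
  | h1 c u => rw [Subsingleton.elim c 0, tmul_zero, bt, zero_tmul]; rfl

/-- The functor `C ↦ (S ⊗ C) ⊗ U` on `Q`-linear maps. -/
noncomputable def atC (f : C →ₗ[Q] C') (U : Type*) [AddCommGroup U] [Module S U] :
    BT Q S C U →ₗ[S] BT Q S C' U := (f.baseChange S).rTensor U

/-- The functor `U ↦ (S ⊗ C) ⊗ U` on `S`-linear maps. -/
noncomputable def atU (Q : Type*) [CommRing Q] [Algebra Q S] (C : Type*) [AddCommGroup C]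
    [Module Q C] (g : U →ₗ[S] U') : BT Q S C U →ₗ[S] BT Q S C U' := g.lTensor (S ⊗[Q] C)

theorem atC_bt (f : C →ₗ[Q] C') (x : S ⊗[Q] C) (u : U) :
    atC f U (bt Q x u) = bt Q (f.baseChange S x) u := rfl

theorem atU_bt (g : U →ₗ[S] U') (x : S ⊗[Q] C) (u : U) :
    atU Q C g (bt Q x u) = bt Q x (g u) := rfl

theorem atU_atC (f : C →ₗ[Q] C') (g : U →ₗ[S] U') (x : BT Q S C U) :
    atU Q C' g (atC f U x) = atC f U' (atU Q C g x) := by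
  have h := (LinearMap.lTensor_comp_rTensor (S ⊗[Q] C) (f.baseChange S) g).trans
    (LinearMap.rTensor_comp_lTensor (S ⊗[Q] C) (f.baseChange S) g).symm
  exact LinearMap.congr_fun h x

theorem atC_id (x : BT Q S C U) : atC (LinearMap.id : C →ₗ[Q] C) U x = x := by
  rw [atC, LinearMap.baseChange_id, LinearMap.rTensor_id]; rfl

theorem atU_id (x : BT Q S C U) : atU Q C (LinearMap.id : U →ₗ[S] U) x = x := by
  rw [atU, LinearMap.lTensor_id]; rfl

theorem atC_comp (f : C →ₗ[Q] C') (f' : C' →ₗ[Q] C'') (x : BT Q S C U) :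
    atC (f' ∘ₗ f) U x = atC f' U (atC f U x) := by
  rw [atC, LinearMap.baseChange_comp, LinearMap.rTensor_comp]; rfl

theorem atU_comp (g : U →ₗ[S] U') (g' : U' →ₗ[S] U'') (x : BT Q S C U) :
    atU Q C (g' ∘ₗ g) x = atU Q C g' (atU Q C g x) := by
  rw [atU, LinearMap.lTensor_comp]; rfl

theorem atC_surj {f : C →ₗ[Q] C'} (hf : Function.Surjective f) :
    Function.Surjective (atC (S := S) f U) := by
  refine LinearMap.rTensor_surjective _ ?_
  rw [LinearMap.baseChange_eq_ltensor]
  exact LinearMap.lTensor_surjective _ hf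

theorem atU_surj {g : U →ₗ[S] U'} (hg : Function.Surjective g) :
    Function.Surjective (atU Q C g) := LinearMap.lTensor_surjective _ hg

theorem atC_exact {f : C →ₗ[Q] C'} {f' : C' →ₗ[Q] C''} (h : Function.Exact f f')
    (hf : Function.Surjective f') : Function.Exact (atC (S := S) f U) (atC f' U) := by
  refine rTensor_exact _ ?_ ?_
  · rw [LinearMap.baseChange_eq_ltensor, LinearMap.baseChange_eq_ltensor]
    exact lTensor_exact _ h hf
  · rw [LinearMap.baseChange_eq_ltensor]
    exact LinearMap.lTensor_surjective _ hf

theorem atU_exact {g : U →ₗ[S] U'} {g' : U' →ₗ[S] U''} (h : Function.Exact g g')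
    (hg : Function.Surjective g') : Function.Exact (atU Q C g) (atU Q C g') :=
  lTensor_exact _ h hg

theorem atC_smul (a : Q) (x : BT Q S C U) :
    atC (a • (LinearMap.id : C →ₗ[Q] C)) U x = algebraMap Q S a • x := by
  induction x using bt_ind with
  | h0 => simp
  | ha x y hx hy => rw [map_add, hx, hy, smul_add]
  | h1 c u =>
    rw [atC_bt, LinearMap.baseChange_tmul, LinearMap.smul_apply, LinearMap.id_apply, smul_bt_left,
      tmul_smul, algebraMap_smul]

theorem atC_inj_of_flat [Module.Flat Q S] [Module.Flat S U] {f : C →ₗ[Q] C'}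
    (hf : Function.Injective f) : Function.Injective (atC (S := S) f U) := by
  refine Module.Flat.rTensor_preserves_injective_linearMap _ ?_
  rw [LinearMap.baseChange_eq_ltensor]
  exact Module.Flat.lTensor_preserves_injective_linearMap _ hf

/-- `U` is flat over `Q` relative to finite modules killed by `J`. -/
def RelFlat (Q : Type u) [CommRing Q] (S : Type*) [CommRing S] [Algebra Q S] (J : Ideal Q)
    (U : Type*) [AddCommGroup U] [Module S U] : Prop :=
  ∀ (C C' : Type u) [AddCommGroup C] [Module Q C] [AddCommGroup C'] [Module Q C']
    [Module.Finite Q C] [Module.Finite Q C'] (f : C →ₗ[Q] C'), Function.Injective f →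
    (∀ a ∈ J, ∀ x : C', a • x = 0) → Function.Injective (atC (S := S) f U)

end

section
variable {Q : Type u} [CommRing Q] [IsNoetherianRing Q] [IsLocalRing Q]
  {S : Type*} [CommRing S] [IsNoetherianRing S] [IsLocalRing S]
  [Algebra Q S] [IsLocalHom (algebraMap Q S)]
  {U F V : Type*} [AddCommGroup U] [Module S U] [Module.Finite S U] [AddCommGroup F] [Module S F]
  [AddCommGroup V] [Module S V]

/-- A fibrewise injective map into a relatively flat module is universally injective. -/
theorem atU_inj {J : Ideal Q} (f : U →ₗ[S] F) (hF : RelFlat Q S J F)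
    (hk : Function.Injective (atU Q (Q ⧸ maximalIdeal Q) f)) {C : Type u} [AddCommGroup C]
    [Module Q C] [Module.Finite Q C] (hC : ∀ a ∈ J, ∀ x : C, a • x = 0) :
    Function.Injective (atU Q C f) := by
  suffices H : ∀ I : Ideal Q, ∀ (C : Type u) [AddCommGroup C] [Module Q C] [Module.Finite Q C],
      (∀ a ∈ I, ∀ x : C, a • x = 0) → (∀ a ∈ J, ∀ x : C, a • x = 0) →
      Function.Injective (atU Q C f) from H ⊥ C (by simp) hC
  clear! C
  intro I
  induction I using WellFoundedGT.induction with
  | ind I ih =>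
  intro C _ _ _ hI hJ
  revert hI hJ
  induction ‹Module.Finite Q C› using
    IsNoetherianRing.induction_on_isQuotientEquivQuotientPrime Q with
  | subsingleton N =>
    intro _ _
    exact Function.injective_of_subsingleton _
  | quotient N p e =>
    intro hI hJ
    have hmem : ∀ a : Q, (∀ x : N, a • x = 0) → a ∈ p.asIdeal := by
      intro a h
      have := h (e.symm 1)
      rw [← map_smul, LinearEquiv.map_eq_zero_iff] at this
      rw [← Ideal.Quotient.eq_zero_iff_mem, ← this, Algebra.smul_def, mul_one]
      rfl
    have hkill : ∀ a ∈ p.asIdeal, ∀ x : N, a • x = 0 := by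
      intro a ha x
      apply e.injective
      obtain ⟨q, hq⟩ := Ideal.Quotient.mk_surjective (e x)
      rw [map_smul, map_zero, ← hq, Algebra.smul_def, Ideal.Quotient.algebraMap_eq, ← map_mul,
        Ideal.Quotient.eq_zero_iff_mem]
      exact p.asIdeal.mul_mem_right _ ha
    have hIp : I ≤ p.asIdeal := fun a ha => hmem a (hI a ha)
    rcases hIp.lt_or_eq with hlt | heq
    · exact ih _ hlt N hkill hJ
    by_cases hm : maximalIdeal Q ≤ p.asIdeal
    · have hpm : p.asIdeal = maximalIdeal Q :=
        le_antisymm (IsLocalRing.le_maximalIdeal p.isPrime.ne_top) hm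
      have e' : N ≃ₗ[Q] Q ⧸ maximalIdeal Q := hpm ▸ e
      have hinj : Function.Injective (atC (S := S) (e' : N →ₗ[Q] Q ⧸ maximalIdeal Q) U) := by
        refine Function.LeftInverse.injective
          (g := atC (e'.symm : Q ⧸ maximalIdeal Q →ₗ[Q] N) U) fun x => ?_
        rw [← atC_comp]
        have : (e'.symm : Q ⧸ maximalIdeal Q →ₗ[Q] N) ∘ₗ (e' : N →ₗ[Q] Q ⧸ maximalIdeal Q) =
          LinearMap.id := by ext; simp
        rw [this, atC_id]
      intro x y hxy
      apply hinj
      apply hk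
      rw [atU_atC, atU_atC, hxy]
    · obtain ⟨a, ham, hap⟩ := SetLike.not_le_iff_exists.1 hm
      set m : N →ₗ[Q] N := a • LinearMap.id with hmdef
      have hminj : Function.Injective m := by
        rw [injective_iff_map_eq_zero]
        intro x hx
        have hx : a • x = 0 := hx
        have h1 := congrArg e hx
        obtain ⟨q, hq⟩ := Ideal.Quotient.mk_surjective (e x)
        rw [map_smul, map_zero, ← hq, Algebra.smul_def, Ideal.Quotient.algebraMap_eq, ← map_mul,
          Ideal.Quotient.eq_zero_iff_mem] at h1
        have := (p.isPrime.mem_or_mem h1).resolve_left hap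
        apply e.injective
        rw [← hq, map_zero, Ideal.Quotient.eq_zero_iff_mem]
        exact this
      have hgood : Function.Injective (atU Q (N ⧸ LinearMap.range m) f) := by
        refine ih (I ⊔ Ideal.span {a}) ?_ _ ?_ ?_
        · refine lt_of_le_of_ne le_sup_left fun h => hap ?_
          rw [← heq, h]
          exact Ideal.mem_sup_right (Ideal.mem_span_singleton_self a)
        · intro b hb x
          obtain ⟨x, rfl⟩ := Submodule.mkQ_surjective _ x
          obtain ⟨c, hc, d, hd, rfl⟩ := Submodule.mem_sup.1 hb
          obtain ⟨t, rfl⟩ := Ideal.mem_span_singleton'.1 hd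
          rw [add_smul, ← map_smul, hI c hc, map_zero, zero_add, ← map_smul, Submodule.mkQ_apply,
            Submodule.Quotient.mk_eq_zero]
          exact ⟨t • x, (smul_smul a t x).trans (by rw [mul_comm])⟩
        · intro b hb x
          obtain ⟨x, rfl⟩ := Submodule.mkQ_surjective _ x
          rw [← map_smul, hJ b hb, map_zero]
      have hrng := atC_exact (S := S) (U := U) (LinearMap.exact_map_mkQ_range m)
        (Submodule.mkQ_surjective _)
      refine inj_of_nakayama _ ?_
      intro x hx
      have h0 : atC (LinearMap.range m).mkQ U x = 0 :=
        hgood (by rw [atU_atC, hx, map_zero, map_zero])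
      obtain ⟨x, rfl⟩ := (hrng x).1 h0
      rw [atU_atC] at hx
      have hx' : atU Q N f x = 0 := hF _ _ m hminj hJ (by rw [hx, map_zero])
      rw [hmdef, atC_smul]
      refine Submodule.smul_mem_smul ?_ hx'
      exact (mem_maximalIdeal _).2 fun h => (mem_maximalIdeal _).1 ham
        (isUnit_of_map_unit (algebraMap Q S) a h)
  | exact N₁ N₂ N₃ g h hg hh hgh ih₁ ih₃ =>
    intro hI hJ
    have k1 : ∀ J : Ideal Q, (∀ a ∈ J, ∀ x : N₂, a • x = 0) → ∀ a ∈ J, ∀ x : N₁, a • x = 0 :=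
      fun J hJ a ha x => hg (by rw [map_smul, hJ a ha, map_zero])
    have k3 : ∀ J : Ideal Q, (∀ a ∈ J, ∀ x : N₂, a • x = 0) → ∀ a ∈ J, ∀ x : N₃, a • x = 0 := by
      intro J hJ a ha x
      obtain ⟨x, rfl⟩ := hh x
      rw [← map_smul, hJ a ha, map_zero]
    rw [injective_iff_map_eq_zero]
    intro x hx
    have h0 : atC h U x = 0 := ih₃ (k3 I hI) (k3 J hJ) (by rw [atU_atC, hx, map_zero, map_zero])
    obtain ⟨x, rfl⟩ := (atC_exact hgh hh x).1 h0
    rw [atU_atC] at hx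
    have h1 : atU Q N₁ f x = 0 := hF _ _ g hg hJ (by rw [hx, map_zero])
    have h2 : x = 0 := ih₁ (k1 I hI) (k1 J hJ) (by rw [h1, map_zero])
    rw [h2, map_zero]

theorem RelFlat.coker {J : Ideal Q} (f : U →ₗ[S] F) (g : F →ₗ[S] V) (hfg : Function.Exact f g)
    (hg : Function.Surjective g) (hF : RelFlat Q S J F)
    (hk : Function.Injective (atU Q (Q ⧸ maximalIdeal Q) f)) : RelFlat Q S J V := by
  intro C C' _ _ _ _ _ _ i hi hJ
  have hC'' := atU_inj f hF hk (C := C' ⧸ LinearMap.range i) (by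
    intro a ha x
    obtain ⟨x, rfl⟩ := Submodule.mkQ_surjective _ x
    rw [← map_smul, hJ a ha, map_zero])
  have er := LinearMap.exact_map_mkQ_range i
  have sr := (LinearMap.range i).mkQ_surjective
  have h1 := hF _ _ i hi hJ
  have h2 : Function.Surjective (atU Q C g) := atU_surj hg
  have h3 : Function.Exact (atU Q C f) (atU Q C g) := atU_exact hfg hg
  have h4 : Function.Exact (atU Q C' f) (atU Q C' g) := atU_exact hfg hg
  have h5 : Function.Exact (atC (S := S) i U) (atC (LinearMap.range i).mkQ U) := atC_exact er sr
  have h6 : Function.Exact (atC (S := S) i F) (atC (LinearMap.range i).mkQ F) := atC_exact er sr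
  have c1 : ∀ x, atC (S := S) i V (atU Q C g x) = atU Q C' g (atC i F x) :=
    fun x => (atU_atC i g x).symm
  have c2 : ∀ x, atU Q C' f (atC i U x) = atC i F (atU Q C f x) := fun x => atU_atC i f x
  have c3 : ∀ x, atU Q (C' ⧸ LinearMap.range i) f (atC (LinearMap.range i).mkQ U x) =
      atC (LinearMap.range i).mkQ F (atU Q C' f x) := fun x => atU_atC (LinearMap.range i).mkQ f x
  have h3' : ∀ x, atU Q C g (atU Q C f x) = 0 := h3.apply_apply_eq_zero
  have h6' : ∀ x, atC (S := S) (LinearMap.range i).mkQ F (atC i F x) = 0 :=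
    h6.apply_apply_eq_zero
  exact snake_inj (iT := atU Q C f) (pT := atU Q C g) (iN := atU Q C' f) (pN := atU Q C' g)
    (iW := atU Q (C' ⧸ LinearMap.range i) f) (jk := atC i U) (qk := atC (LinearMap.range i).mkQ U)
    (jf := atC i F) (qf := atC (LinearMap.range i).mkQ F) (ja := atC i V)
    hC'' h1 h2 h3' h4 h5 h6' c1 c2 c3

end
end ExtRigid

namespace ExtRigid
open TensorProduct

/-- One half of the data of a completed tensor square with common uniformizer `π₁ = π₂`. -/
structure Half (Q₁ Q₂ S : Type u) [CommRing Q₁] [IsLocalRing Q₁] [CommRing Q₂] [CommRing S]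
    [Algebra Q₁ S] [Algebra Q₂ S] (π₁ : Q₁) (π₂ : Q₂) : Prop where
  comp : algebraMap Q₁ S π₁ = algebraMap Q₂ S π₂
  mem : π₁ ∈ maximalIdeal Q₁
  reg : ∀ x : Q₂, π₂ * x = 0 → x = 0
  retract : ∃ ε : S →+* Q₂, (∀ q, ε (algebraMap Q₂ S q) = q) ∧
    ∀ a ∈ maximalIdeal Q₁, ∃ z, ε (algebraMap Q₁ S a) = π₂ * z
  gen : ∀ s : S, ∃ q : Q₂, s - algebraMap Q₂ S q ∈ (maximalIdeal Q₁).map (algebraMap Q₁ S)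

section
variable {Q S : Type*} [CommRing Q] [CommRing S] [Algebra Q S]
  {C : Type*} [AddCommGroup C] [Module Q C] {U : Type*} [AddCommGroup U] [Module S U]

theorem algebraMap_smul_bt (a : Q) (c : C) (u : U) :
    algebraMap Q S a • bt Q ((1 : S) ⊗ₜ[Q] c) u = bt Q ((1 : S) ⊗ₜ[Q] (a • c)) u := by
  rw [smul_bt_left, tmul_smul, algebraMap_smul]

theorem bt_algebraMap_smul (a : Q) (c : C) (u : U) :
    bt Q ((1 : S) ⊗ₜ[Q] c) (algebraMap Q S a • u) = bt Q ((1 : S) ⊗ₜ[Q] (a • c)) u := by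
  rw [← smul_bt, algebraMap_smul_bt]

theorem bt_zero_right (x : S ⊗[Q] C) : bt Q x (0 : U) = 0 := tmul_zero _ _

theorem bt_zero_left (u : U) : bt Q (0 : S ⊗[Q] C) u = 0 := zero_tmul _ _

theorem exists_fibre_map {I : Ideal Q} {W : Type*} [AddCommGroup W] [Module S W]
    (hW : ∀ a ∈ I, ∀ w : W, algebraMap Q S a • w = 0) (g : U →ₗ[S] W) :
    ∃ G : BT Q S (Q ⧸ I) U →ₗ[S] W, ∀ u, G (bt Q (1 ⊗ₜ 1) u) = g u := by
  let : Module Q W := Module.compHom W (algebraMap Q S)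
  have hsm : ∀ (q : Q) (w : W), q • w = algebraMap Q S q • w := fun _ _ => rfl
  have : IsScalarTower Q S W := ⟨fun q s w => by
    rw [hsm, Algebra.smul_def, mul_smul]⟩
  have : SMulCommClass S Q W := ⟨fun s q w => by rw [hsm, hsm, smul_comm]⟩
  let h1 : (Q ⧸ I) →ₗ[Q] (W →ₗ[S] W) :=
    Submodule.liftQ I (LinearMap.toSpanSingleton Q (W →ₗ[S] W) LinearMap.id) (by
      intro a ha
      rw [LinearMap.mem_ker]
      ext w
      exact hW a ha w)
  refine ⟨TensorProduct.lift ((LinearMap.lcomp S W g) ∘ₗ (LinearMap.liftBaseChange S h1)),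
    fun u => ?_⟩
  change (LinearMap.liftBaseChange S h1 (1 ⊗ₜ 1)) (g u) = g u
  rw [LinearMap.liftBaseChange_tmul, one_smul]
  change ((1 : Q) • (LinearMap.id : W →ₗ[S] W)) (g u) = g u
  simp

end

namespace Half
variable {Q₁ Q₂ S : Type u} [CommRing Q₁] [IsLocalRing Q₁] [CommRing Q₂] [CommRing S]
    [Algebra Q₁ S] [Algebra Q₂ S] {π₁ : Q₁} {π₂ : Q₂} (h : Half Q₁ Q₂ S π₁ π₂)
  {N : Type*} [AddCommGroup N] [Module Q₂ N]
include h

theorem exists_fibre (x : BT Q₁ S (Q₁ ⧸ maximalIdeal Q₁) (S ⊗[Q₂] N)) :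
    ∃ n : N, x = bt Q₁ (1 ⊗ₜ 1) (1 ⊗ₜ n) := by
  have hmem : ∀ t ∈ (maximalIdeal Q₁).map (algebraMap Q₁ S), ∀ u : S ⊗[Q₂] N,
      bt Q₁ ((1 : S) ⊗ₜ[Q₁] (1 : Q₁ ⧸ maximalIdeal Q₁)) (t • u) = 0 := by
    intro t ht u
    rw [Ideal.map] at ht
    induction ht using Submodule.span_induction generalizing u with
    | zero => rw [zero_smul, bt_zero_right]
    | add x y _ _ hx hy => rw [add_smul, bt_add_right, hx, hy, add_zero]
    | smul a x _ hx => rw [smul_assoc, smul_comm, hx]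
    | mem x hx =>
      obtain ⟨a, ha, rfl⟩ := hx
      rw [bt_algebraMap_smul, Algebra.smul_def, mul_one, Ideal.Quotient.algebraMap_eq,
        Ideal.Quotient.eq_zero_iff_mem.2 ha, tmul_zero, bt_zero_left]
  have key : ∀ u : S ⊗[Q₂] N, ∃ n : N,
      bt Q₁ ((1 : S) ⊗ₜ[Q₁] (1 : Q₁ ⧸ maximalIdeal Q₁)) u = bt Q₁ (1 ⊗ₜ 1) (1 ⊗ₜ n) := by
    intro u
    induction u using TensorProduct.induction_on with
    | zero => exact ⟨0, by rw [tmul_zero]⟩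
    | add x y hx hy =>
      obtain ⟨n, hn⟩ := hx
      obtain ⟨m, hm⟩ := hy
      exact ⟨n + m, by rw [bt_add_right, hn, hm, tmul_add, bt_add_right]⟩
    | tmul s n =>
      obtain ⟨q, hq⟩ := h.gen s
      refine ⟨q • n, ?_⟩
      have h1 : s ⊗ₜ[Q₂] n = (s - algebraMap Q₂ S q) • ((1 : S) ⊗ₜ[Q₂] n) + 1 ⊗ₜ (q • n) := by
        rw [smul_tmul', smul_eq_mul, mul_one, ← smul_tmul q (1 : S) n,
          ← Algebra.algebraMap_eq_smul_one, ← add_tmul, sub_add_cancel]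
      rw [h1, bt_add_right, hmem _ hq, zero_add]
  induction x using bt_ind with
  | h0 => exact ⟨0, by rw [tmul_zero, bt_zero_right]⟩
  | ha x y hx hy =>
    obtain ⟨n, rfl⟩ := hx
    obtain ⟨m, rfl⟩ := hy
    exact ⟨n + m, by rw [tmul_add, bt_add_right]⟩
  | h1 c u =>
    obtain ⟨q, rfl⟩ := Ideal.Quotient.mk_surjective c
    obtain ⟨n, hn⟩ := key (algebraMap Q₁ S q • u)
    refine ⟨n, ?_⟩
    rw [← hn, bt_algebraMap_smul, Algebra.smul_def, mul_one, Ideal.Quotient.algebraMap_eq]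

variable {K F : Type*} [AddCommGroup K] [Module Q₂ K] [AddCommGroup F] [Module Q₂ F]

theorem fibre_inj (f : K →ₗ[Q₂] F) (hf : ∀ n z, f n = π₂ • z → ∃ k, n = π₂ • k) :
    Function.Injective (atU Q₁ (Q₁ ⧸ maximalIdeal Q₁) (f.baseChange S)) := by
  rw [injective_iff_map_eq_zero]
  intro x hx
  obtain ⟨n, rfl⟩ := h.exists_fibre x
  rw [atU_bt, LinearMap.baseChange_tmul] at hx
  obtain ⟨ε, hε, hε'⟩ := h.retract
  let W := F ⧸ LinearMap.range (π₂ • (LinearMap.id : F →ₗ[Q₂] F))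
  let : Module S W := Module.compHom W ε
  have hsm : ∀ (s : S) (w : W), s • w = ε s • w := fun _ _ => rfl
  have : IsScalarTower Q₂ S W := ⟨fun q s w => by
    change ε (q • s) • w = q • ε s • w
    rw [Algebra.smul_def q s, map_mul, hε, mul_smul]⟩
  have hπ : ∀ w : W, π₂ • w = 0 := by
    intro w
    obtain ⟨w, rfl⟩ := Submodule.mkQ_surjective _ w
    rw [← map_smul, Submodule.mkQ_apply, Submodule.Quotient.mk_eq_zero]
    exact ⟨w, rfl⟩
  obtain ⟨G, hG⟩ := exists_fibre_map (Q := Q₁) (I := maximalIdeal Q₁) (W := W) (by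
      intro a ha w
      obtain ⟨z, hz⟩ := hε' a ha
      rw [hsm, hz, mul_smul, hπ])
    (LinearMap.liftBaseChange S (Submodule.mkQ (LinearMap.range (π₂ • (LinearMap.id : F →ₗ[Q₂] F)))))
  have h1 := hG (1 ⊗ₜ f n)
  rw [hx, map_zero, LinearMap.liftBaseChange_tmul, one_smul, Submodule.mkQ_apply, eq_comm,
    Submodule.Quotient.mk_eq_zero] at h1
  obtain ⟨z, hz⟩ := h1
  obtain ⟨k, rfl⟩ := hf n z hz.symm
  rw [tmul_smul, ← algebraMap_smul S π₂ ((1 : S) ⊗ₜ[Q₂] k), ← h.comp, bt_algebraMap_smul,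
    Algebra.smul_def, mul_one, Ideal.Quotient.algebraMap_eq,
    Ideal.Quotient.eq_zero_iff_mem.2 h.mem, tmul_zero, bt_zero_left]

end Half
end ExtRigid

namespace ExtRigid
open TensorProduct

theorem baseChange_exact {Q S : Type*} [CommRing Q] [CommRing S] [Algebra Q S] {A B C : Type*}
    [AddCommGroup A] [Module Q A] [AddCommGroup B] [Module Q B] [AddCommGroup C] [Module Q C]
    {f : A →ₗ[Q] B} {g : B →ₗ[Q] C} (h : Function.Exact f g) (hg : Function.Surjective g) :
    Function.Exact (f.baseChange S) (g.baseChange S) := by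
  rw [LinearMap.baseChange_eq_ltensor, LinearMap.baseChange_eq_ltensor]
  exact lTensor_exact _ h hg

theorem baseChange_surj {Q S : Type*} [CommRing Q] [CommRing S] [Algebra Q S] {B C : Type*}
    [AddCommGroup B] [Module Q B] [AddCommGroup C] [Module Q C]
    {g : B →ₗ[Q] C} (hg : Function.Surjective g) : Function.Surjective (g.baseChange S) := by
  rw [LinearMap.baseChange_eq_ltensor]
  exact LinearMap.lTensor_surjective _ hg

theorem baseChange_inj {Q S : Type*} [CommRing Q] [CommRing S] [Algebra Q S] [Module.Flat Q S]
    {B C : Type*} [AddCommGroup B] [Module Q B] [AddCommGroup C] [Module Q C]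
    {g : B →ₗ[Q] C} (hg : Function.Injective g) : Function.Injective (g.baseChange S) := by
  rw [LinearMap.baseChange_eq_ltensor]
  exact Module.Flat.lTensor_preserves_injective_linearMap _ hg

theorem RelFlat.quot {Q : Type u} [CommRing Q] {S : Type*} [CommRing S] [Algebra Q S] {J : Ideal Q}
    {F F' : Type*} [AddCommGroup F] [Module S F] [AddCommGroup F'] [Module S F']
    (h : RelFlat Q S J F) (g : F →ₗ[S] F') (hg : Function.Surjective g)
    (hker : ∀ x, g x = 0 → ∃ a ∈ J, ∃ y, x = algebraMap Q S a • y) : RelFlat Q S J F' := by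
  intro C C' _ _ _ _ _ _ f hf hJ
  have hzero : ∀ x : BT Q S C' (LinearMap.ker g), atU Q C' (LinearMap.ker g).subtype x = 0 := by
    intro x
    induction x using bt_ind with
    | h0 => rw [map_zero]
    | ha x y hx hy => rw [map_add, hx, hy, add_zero]
    | h1 c u =>
      obtain ⟨a, ha, y, hy⟩ := hker u u.2
      rw [atU_bt, Submodule.subtype_apply, hy, ← smul_bt, smul_bt_left]
      have : algebraMap Q S a • ((1 : S) ⊗ₜ[Q] c) = 0 := by
        rw [algebraMap_smul, ← tmul_smul, hJ a ha, tmul_zero]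
      rw [this, bt_zero_left]
  have hex : Function.Exact (atU Q C' (LinearMap.ker g).subtype) (atU Q C' g) :=
    atU_exact (LinearMap.exact_subtype_ker_map g) hg
  rw [injective_iff_map_eq_zero]
  intro x hx
  obtain ⟨x, rfl⟩ := atU_surj (Q := Q) (C := C) hg x
  rw [← atU_atC] at hx
  obtain ⟨z, hz⟩ := (hex _).1 hx
  rw [hzero, ← map_zero (atC f F)] at hz
  rw [← h _ _ f hf hJ hz, map_zero]

namespace Half
variable {Q₁ Q₂ S : Type u} [CommRing Q₁] [IsLocalRing Q₁] [CommRing Q₂] [CommRing S]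
    [Algebra Q₁ S] [Algebra Q₂ S] {π₁ : Q₁} {π₂ : Q₂} (h : Half Q₁ Q₂ S π₁ π₂)
    [IsNoetherianRing Q₁] [IsNoetherianRing Q₂] [IsNoetherianRing S] [IsLocalRing S]
    [IsLocalHom (algebraMap Q₁ S)] [Module.Flat Q₁ S]
  {N : Type u} [AddCommGroup N] [Module Q₂ N] [Module.Finite Q₂ N]

theorem relFlat_free (m : ℕ) (J : Ideal Q₁) : RelFlat Q₁ S J (S ⊗[Q₂] (Fin m → Q₂)) :=
  fun _ _ _ _ _ _ _ _ _ hf _ => atC_inj_of_flat hf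

include h

theorem relFlat_of_torsionFree (hN : ∀ x : N, π₂ • x = 0 → x = 0) :
    RelFlat Q₁ S ⊥ (S ⊗[Q₂] N) := by
  obtain ⟨m, p, hp⟩ := Module.Finite.exists_fin' Q₂ N
  refine RelFlat.coker (Q := Q₁) ((LinearMap.ker p).subtype.baseChange S) (p.baseChange S)
    (baseChange_exact (LinearMap.exact_subtype_ker_map p) hp) (baseChange_surj hp)
    (relFlat_free m ⊥) (h.fibre_inj _ fun n z hz => ?_)
  have : p z = 0 := hN _ (by rw [← map_smul, ← hz]; exact n.2)
  exact ⟨⟨z, this⟩, Subtype.ext hz⟩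

theorem relFlat_of_killed (hN : ∀ x : N, π₂ • x = 0) :
    RelFlat Q₁ S (Ideal.span {π₁}) (S ⊗[Q₂] N) := by
  obtain ⟨m, p, hp⟩ := Module.Finite.exists_fin' Q₂ N
  let R := LinearMap.range (π₂ • (LinearMap.id : (Fin m → Q₂) →ₗ[Q₂] (Fin m → Q₂)))
  have hR : R ≤ LinearMap.ker p := by
    rintro _ ⟨z, rfl⟩
    rw [LinearMap.mem_ker, LinearMap.smul_apply, map_smul, hN]
  have hF : RelFlat Q₁ S (Ideal.span {π₁}) (S ⊗[Q₂] ((Fin m → Q₂) ⧸ R)) := by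
    refine RelFlat.quot (relFlat_free (Q₂ := Q₂) m _) (R.mkQ.baseChange S)
      (baseChange_surj R.mkQ_surjective) fun x hx => ?_
    obtain ⟨y, rfl⟩ := (baseChange_exact (S := S) (LinearMap.exact_map_mkQ_range
      (π₂ • (LinearMap.id : (Fin m → Q₂) →ₗ[Q₂] (Fin m → Q₂)))) R.mkQ_surjective x).1 hx
    refine ⟨π₁, Ideal.mem_span_singleton_self _, y, ?_⟩
    rw [h.comp, algebraMap_smul, LinearMap.baseChange_smul, LinearMap.baseChange_id]
    rfl
  have hp' : Function.Surjective (R.liftQ p hR) := fun x => by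
    obtain ⟨x, rfl⟩ := hp x
    exact ⟨R.mkQ x, rfl⟩
  refine RelFlat.coker (Q := Q₁) ((LinearMap.ker (R.liftQ p hR)).subtype.baseChange S)
    ((R.liftQ p hR).baseChange S)
    (baseChange_exact (LinearMap.exact_subtype_ker_map _) hp') (baseChange_surj hp')
    hF (h.fibre_inj _ fun n z hz => ⟨0, Subtype.ext ?_⟩)
  rw [smul_zero]
  change (LinearMap.ker (R.liftQ p hR)).subtype n = 0
  rw [hz]
  obtain ⟨z, rfl⟩ := R.mkQ_surjective z
  rw [← map_smul, Submodule.mkQ_apply, Submodule.Quotient.mk_eq_zero]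
  exact ⟨z, rfl⟩

variable {A : Type u} [AddCommGroup A] [Module Q₁ A] [Module.Finite Q₁ A]
  {N' : Type u} [AddCommGroup N'] [Module Q₂ N'] [Module.Finite Q₂ N']

theorem inj_of_killed (hA : ∀ x : A, π₁ • x = 0) (hN : ∀ x : N, π₂ • x = 0) (f : N' →ₗ[Q₂] N)
    (hf : Function.Injective f) : Function.Injective (atU Q₁ A (f.baseChange S)) := by
  refine atU_inj (f.baseChange S) (h.relFlat_of_killed hN) (h.fibre_inj f fun n z hz => ⟨0, ?_⟩) ?_
  · rw [smul_zero]
    exact hf (by rw [hz, hN, map_zero])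
  · intro a ha x
    obtain ⟨b, rfl⟩ := Ideal.mem_span_singleton'.1 ha
    rw [mul_smul, hA, smul_zero]

theorem inj_of_torsionFree_coker [Module.Flat Q₂ S] (f : N' →ₗ[Q₂] N) (hf : Function.Injective f)
    (ht : ∀ x, π₂ • x ∈ LinearMap.range f → x ∈ LinearMap.range f) :
    Function.Injective (atU Q₁ A (f.baseChange S)) := by
  obtain ⟨m, p, hp⟩ := Module.Finite.exists_fin' Q₁ A
  have hW : RelFlat Q₁ S ⊥ (S ⊗[Q₂] (N ⧸ LinearMap.range f)) :=
    h.relFlat_of_torsionFree fun x hx => by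
      obtain ⟨x, rfl⟩ := Submodule.mkQ_surjective _ x
      rw [← map_smul, Submodule.mkQ_apply, Submodule.Quotient.mk_eq_zero] at hx
      rw [Submodule.mkQ_apply, Submodule.Quotient.mk_eq_zero]
      exact ht x hx
  let i := (LinearMap.ker p).subtype
  let q := (LinearMap.range f).mkQ
  have sq : Function.Surjective (q.baseChange S) := baseChange_surj (Submodule.mkQ_surjective _)
  have eq : Function.Exact (f.baseChange S) (q.baseChange S) :=
    baseChange_exact (LinearMap.exact_map_mkQ_range f) (Submodule.mkQ_surjective _)
  have e1 : Function.Exact (atC (S := S) i (S ⊗[Q₂] N)) (atC p (S ⊗[Q₂] N)) :=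
    atC_exact (LinearMap.exact_subtype_ker_map p) hp
  have e2 : Function.Exact (atC (S := S) i (S ⊗[Q₂] N')) (atC p (S ⊗[Q₂] N')) :=
    atC_exact (LinearMap.exact_subtype_ker_map p) hp
  have e3 : Function.Exact (atU Q₁ (LinearMap.ker p) (f.baseChange S)) (atU Q₁ _ (q.baseChange S)) :=
    atU_exact eq sq
  have e4 : Function.Exact (atU Q₁ (Fin m → Q₁) (f.baseChange S)) (atU Q₁ _ (q.baseChange S)) :=
    atU_exact eq sq
  have hjf : Function.Injective (atU Q₁ (Fin m → Q₁) (f.baseChange S)) :=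
    Module.Flat.lTensor_preserves_injective_linearMap _ (baseChange_inj hf)
  have hiW := hW _ _ i Subtype.val_injective (by simp)
  exact snake_inj (iT := atC i (S ⊗[Q₂] N')) (pT := atC p _) (iN := atC i (S ⊗[Q₂] N))
    (pN := atC p _) (iW := atC i _) (jk := atU Q₁ _ (f.baseChange S))
    (qk := atU Q₁ _ (q.baseChange S)) (jf := atU Q₁ _ (f.baseChange S))
    (qf := atU Q₁ _ (q.baseChange S)) (ja := atU Q₁ A (f.baseChange S))
    hiW hjf (atC_surj hp) (fun x => e2.apply_apply_eq_zero x) e1 e3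
    (fun x => e4.apply_apply_eq_zero x) (fun x => atU_atC _ _ _)
    (fun x => (atU_atC _ _ _).symm) (fun x => (atU_atC _ _ _).symm)

end Half

section Swap
variable {Q₁ Q₂ S : Type u} [CommRing Q₁] [CommRing Q₂] [CommRing S]
    [Algebra Q₁ S] [Algebra Q₂ S]
  {A A' : Type*} [AddCommGroup A] [Module Q₁ A] [AddCommGroup A'] [Module Q₁ A']
  {N N' : Type*} [AddCommGroup N] [Module Q₂ N] [AddCommGroup N'] [Module Q₂ N']

/-- Exchange of the two sides of the bifunctor `(S ⊗ A) ⊗ (S ⊗ N)`. -/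
noncomputable def swap (Q₁ Q₂ S : Type u) [CommRing Q₁] [CommRing Q₂] [CommRing S]
    [Algebra Q₁ S] [Algebra Q₂ S] (A N : Type*) [AddCommGroup A] [Module Q₁ A]
    [AddCommGroup N] [Module Q₂ N] :
    BT Q₁ S A (S ⊗[Q₂] N) ≃ₗ[S] BT Q₂ S N (S ⊗[Q₁] A) :=
  TensorProduct.comm S (S ⊗[Q₁] A) (S ⊗[Q₂] N)

theorem swap_atC (f : A →ₗ[Q₁] A') (x : BT Q₁ S A (S ⊗[Q₂] N)) :
    swap Q₁ Q₂ S A' N (atC f _ x) = atU Q₂ N (f.baseChange S) (swap Q₁ Q₂ S A N x) := by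
  induction x using bt_ind with
  | h0 => simp
  | ha x y hx hy => simp only [map_add, hx, hy]
  | h1 c u => rfl

theorem swap_atU (f : N →ₗ[Q₂] N') (x : BT Q₁ S A (S ⊗[Q₂] N)) :
    swap Q₁ Q₂ S A N' (atU Q₁ A (f.baseChange S) x) = atC f _ (swap Q₁ Q₂ S A N x) := by
  induction x using bt_ind with
  | h0 => simp
  | ha x y hx hy => simp only [map_add, hx, hy]
  | h1 c u => rfl

end Swap
end ExtRigid

namespace ExtRigid
namespace Cx
variable {S : Type u} [CommRing S] {P : Ideal S} [P.IsPrime] {X : Cx S}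

theorem hl_of_exact_zero (h : ∀ x, ∃ y, X.d 0 y = x) : hl P X 0 = 0 := by
  refine lam_eq_zero_iff.2 fun x => ⟨1, fun h => Ideal.IsPrime.ne_top ‹_›
    ((Ideal.eq_top_iff_one P).2 h), ?_⟩
  obtain ⟨⟨x, hx⟩, rfl⟩ := Submodule.mkQ_surjective _ x
  rw [one_smul]
  exact (Submodule.Quotient.mk_eq_zero _).2 (h x)

theorem hl_of_exact_succ {j : ℕ} (h : ∀ x, X.d j x = 0 → ∃ y, X.d (j + 1) y = x) :
    hl P X (j + 1) = 0 := by
  refine lam_eq_zero_iff.2 fun x => ⟨1, fun h => Ideal.IsPrime.ne_top ‹_›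
    ((Ideal.eq_top_iff_one P).2 h), ?_⟩
  obtain ⟨⟨x, hx⟩, rfl⟩ := Submodule.mkQ_surjective _ x
  rw [one_smul]
  exact (Submodule.Quotient.mk_eq_zero _).2 (h x hx)

theorem SES.kh_eq_of_right {A B C : Cx S} (e : SES A B C) {ys : List S}
    (h : ∀ j, kh P ys C j = 0) (j : ℕ) : kh P ys A j = kh P ys B j := by
  obtain ⟨ρ, σ, τ, h0, hA, hB, hC⟩ := e.kles P ys
  simp only [h, eq_comm (a := (0 : ℕ∞)), add_eq_zero] at hC
  rw [hA, hB, (hC j).1, (hC (j + 1)).2, zero_add, add_zero]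

/-- The complex with the degree zero term replaced by the boundaries. -/
def bdTrunc (X : Cx S) : Cx S where
  X | 0 => LinearMap.range (X.d 0)
    | j + 1 => X.X (j + 1)
  grp | 0 => (inferInstance : AddCommGroup (LinearMap.range (X.d 0)))
      | j + 1 => (inferInstance : AddCommGroup (X.X (j + 1)))
  mod | 0 => (inferInstance : Module S (LinearMap.range (X.d 0)))
      | j + 1 => (inferInstance : Module S (X.X (j + 1)))
  d | 0 => (X.d 0).rangeRestrict
    | j + 1 => X.d (j + 1)
  dd | 0, x => Subtype.ext (X.dd 0 x)
     | j + 1, x => X.dd (j + 1) x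

/-- The truncation sequence along an augmentation. -/
def augSES (X : Cx S) {M : Type u} [AddCommGroup M] [Module S M] (p : X.X 0 →ₗ[S] M)
    (hp : Function.Surjective p) (hk : Function.Exact (X.d 0) p) :
    SES X.bdTrunc X (single M) where
  f | 0 => (LinearMap.range (X.d 0)).subtype
    | j + 1 => (LinearMap.id : X.X (j + 1) →ₗ[S] X.X (j + 1))
  g | 0 => p
    | j + 1 => (0 : X.X (j + 1) →ₗ[S] PUnit.{u + 1})
  f_comm
    | 0, _ => rfl
    | _ + 1, _ => rfl
  g_comm
    | 0, x => hk.apply_apply_eq_zero x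
    | _ + 1, _ => rfl
  inj
    | 0 => Subtype.val_injective
    | _ + 1 => Function.injective_id
  surj
    | 0 => hp
    | _ + 1 => fun _ => ⟨0, rfl⟩
  exact
    | 0 => fun x => by
      change p x = 0 ↔ x ∈ Set.range (LinearMap.range (X.d 0)).subtype
      rw [hk x]
      simp
    | _ + 1 => fun x => ⟨fun _ => ⟨x, rfl⟩, fun _ => rfl⟩

/-- The complex of positive degree terms, moved down and starting with the cycles. -/
def cycTrunc (X : Cx S) : Cx S where
  X | 0 => LinearMap.ker (X.d 0)
    | j + 1 => X.X (j + 2)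
  grp | 0 => (inferInstance : AddCommGroup (LinearMap.ker (X.d 0)))
      | j + 1 => (inferInstance : AddCommGroup (X.X (j + 2)))
  mod | 0 => (inferInstance : Module S (LinearMap.ker (X.d 0)))
      | j + 1 => (inferInstance : Module S (X.X (j + 2)))
  d | 0 => -(X.d 1).codRestrict (LinearMap.ker (X.d 0)) (X.dd 0)
    | j + 1 => -X.d (j + 2)
  dd | 0, x => Subtype.ext (by
        change -X.d 1 (-X.d 2 x) = 0
        rw [map_neg, neg_neg, X.dd])
     | j + 1, x => by
        change -X.d (j + 2) (-X.d (j + 3) x) = 0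
        rw [map_neg, neg_neg, X.dd]

/-- The truncation sequence along the cycles. -/
def cycSES (X : Cx S) :
    SES X.cycTrunc.shift X.bdTrunc ((single (LinearMap.range (X.d 0))).cone 1) where
  f | 0 => (0 : PUnit.{u + 1} →ₗ[S] LinearMap.range (X.d 0))
    | 1 => (LinearMap.ker (X.d 0)).subtype
    | j + 2 => (LinearMap.id : X.X (j + 2) →ₗ[S] X.X (j + 2))
  g | 0 => (LinearMap.id : LinearMap.range (X.d 0) →ₗ[S] LinearMap.range (X.d 0))
    | 1 => LinearMap.prod (0 : X.X 1 →ₗ[S] PUnit.{u + 1}) (X.d 0).rangeRestrict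
    | j + 2 => (0 : X.X (j + 2) →ₗ[S] PUnit.{u + 1} × PUnit.{u + 1})
  f_comm
    | 0, x => Subtype.ext x.2.symm
    | 1, x => by
      change (- -(X.d 1).codRestrict (LinearMap.ker (X.d 0)) (X.dd 0) x : LinearMap.ker (X.d 0)).1
        = X.d 1 x
      rw [neg_neg]
      rfl
    | j + 2, x => by
      change - -X.d (j + 2) x = X.d (j + 2) x
      rw [neg_neg]
  g_comm
    | 0, x => by
      exact ((zero_add _).trans (one_smul S _)).symm
    | 1, x => Prod.ext rfl (Subtype.ext ((X.dd 0 x).trans neg_zero.symm))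
    | j + 2, x => rfl
  inj
    | 0 => fun _ _ _ => rfl
    | 1 => Subtype.val_injective
    | j + 2 => Function.injective_id
  surj
    | 0 => Function.surjective_id
    | 1 => by
      rintro ⟨_, ⟨_, y, rfl⟩⟩
      exact ⟨y, rfl⟩
    | j + 2 => fun _ => ⟨0, rfl⟩
  exact
    | 0 => fun x => ⟨fun h => ⟨PUnit.unit, h.symm⟩, fun ⟨_, h⟩ => h.symm⟩
    | 1 => fun x => by
      constructor
      · intro h
        exact ⟨⟨x, congrArg Subtype.val (congrArg Prod.snd h)⟩, rfl⟩
      · rintro ⟨⟨x, hx⟩, rfl⟩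
        exact Prod.ext rfl (Subtype.ext hx)
    | j + 2 => fun x => ⟨fun _ => ⟨x, rfl⟩, fun _ => rfl⟩

theorem kh_bdTrunc_zero (ys : List S) : kh P ys X.bdTrunc 0 = 0 := by
  rw [← X.cycSES.kh_eq_of_right (kh_eq_zero ys hl_cone_one), kh_shift_zero]

theorem kh_of_augmentation {M : Type u} [AddCommGroup M] [Module S M] (p : X.X 0 →ₗ[S] M)
    (hp : Function.Surjective p) (hk : Function.Exact (X.d 0) p)
    (hX : ∀ j x, X.d j x = 0 → ∃ y, X.d (j + 1) y = x) (ys : List S) (j : ℕ) :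
    kh P ys X j = kh P ys (single M) j := by
  refine (X.augSES p hp hk).kh_eq_of_left (kh_eq_zero ys fun j => ?_) j
  cases j with
  | zero => exact hl_of_exact_zero fun x => (X.d 0).surjective_rangeRestrict x
  | succ j =>
    refine hl_of_exact_succ fun x hx => ?_
    cases j with
    | zero => exact hX 0 x (congrArg Subtype.val hx)
    | succ j => exact hX (j + 1) x hx

/-- The Koszul homology of `X` when `X` is exact in degrees at least two. -/
theorem kh_bdTrunc_succ {L : Type u} [AddCommGroup L] [Module S L]
    (q : LinearMap.ker (X.d 0) →ₗ[S] L) (hq : Function.Surjective q)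
    (hk : ∀ z, q z = 0 ↔ ∃ y, X.d 1 y = z)
    (hX : ∀ j x, X.d (j + 1) x = 0 → ∃ y, X.d (j + 2) y = x) (ys : List S) (j : ℕ) :
    kh P ys X.bdTrunc (j + 1) = kh P ys (single L) j := by
  rw [← X.cycSES.kh_eq_of_right (kh_eq_zero ys hl_cone_one), kh_shift_succ]
  refine kh_of_augmentation (X := X.cycTrunc) q hq
    (fun z : LinearMap.ker (X.d 0) => (hk z).trans ?_) (fun j x hx => ?_) ys j
  · constructor
    · rintro ⟨y, hy⟩
      refine ⟨(-y : X.X 2), Subtype.ext ?_⟩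
      change -X.d 1 (-y) = z.1
      rw [map_neg, neg_neg, hy]
    · rintro ⟨(y : X.X 2), rfl⟩
      refine ⟨(-y : X.X 2), ?_⟩
      change X.d 1 (-y) = -X.d 1 y
      exact map_neg _ _
  · cases j with
    | zero =>
      obtain ⟨y, hy⟩ := hX 0 x (neg_eq_zero.1 (congrArg Subtype.val hx))
      exact ⟨(-y : X.X 3), (by rw [map_neg, neg_neg, hy] : -X.d 2 (-y) = x)⟩
    | succ j =>
      obtain ⟨y, hy⟩ := hX (j + 1) x (neg_eq_zero.1 hx)
      exact ⟨(-y : X.X (j + 4)), (by rw [map_neg, neg_neg, hy] : -X.d (j + 3) (-y) = x)⟩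

end Cx
end ExtRigid

namespace ExtRigid
open TensorProduct Cx

variable {S : Type u} [CommRing S]

theorem exists_descend {E A B : Type*} [AddCommGroup E] [Module S E] [AddCommGroup A] [Module S A]
    [AddCommGroup B] [Module S B] (p : E →ₗ[S] A) (hp : Function.Surjective p) (f : E →ₗ[S] B)
    (h : ∀ x, p x = 0 → f x = 0) : ∃ g : A →ₗ[S] B, ∀ x, g (p x) = f x := by
  let e := p.quotKerEquivOfSurjective hp
  refine ⟨(Submodule.liftQ (LinearMap.ker p) f h) ∘ₗ e.symm.toLinearMap, fun x => ?_⟩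
  have : e.symm (p x) = Submodule.Quotient.mk x := e.symm_apply_eq.2 rfl
  change Submodule.liftQ (LinearMap.ker p) f h (e.symm (p x)) = f x
  rw [this]
  rfl

/-- Modules supported only at `P` below `P` on the locus of `ys`, with vanishing Koszul Euler
characteristic. -/
def Small (P : Ideal S) [P.IsPrime] (ys : List S) (L : Type u) [AddCommGroup L] [Module S L] :
    Prop :=
  kh P ys (single L) 0 ≠ ⊤ ∧ chi (ys.length + 1) (kh P ys (single L)) = 0

namespace Small
variable [IsNoetherianRing S] {P : Ideal S} [hP : P.IsPrime] {ys : List S}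
  {A L C : Type u} [AddCommGroup A] [Module S A] [Module.Finite S A] [AddCommGroup L] [Module S L]
  [Module.Finite S L] [AddCommGroup C] [Module S C] [Module.Finite S C]

theorem finite {L : Type u} [AddCommGroup L] [Module S L] [Module.Finite S L]
    (h : kh P ys (single L) 0 ≠ ⊤) (j : ℕ) : kh P ys (single L) j ≠ ⊤ :=
  kh_finite_of_lam (fun Q _ => lam_of_kh_finite h Q) j

/-- The class of small modules is closed under submodules, quotients and extensions. -/
theorem ses (hys : ∀ y ∈ ys, y ∈ P) (f : A →ₗ[S] L) (g : L →ₗ[S] C) (hf : Function.Injective f)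
    (hg : Function.Surjective g) (hfg : Function.Exact f g) :
    Small P ys L ↔ Small P ys A ∧ Small P ys C := by
  have key : kh P ys (single A) 0 ≠ ⊤ → kh P ys (single C) 0 ≠ ⊤ →
      chi (ys.length + 1) (kh P ys (single A)) + chi (ys.length + 1) (kh P ys (single C)) =
        chi (ys.length + 1) (kh P ys (single L)) ∧ kh P ys (single L) 0 ≠ ⊤ := by
    intro h1 h2
    obtain ⟨ρ, σ, τ, h0, hA, hB, hC⟩ := (singleSES f g hf hg hfg).kles P ys
    have := chi_les hA hB hC (finite h1) (finite h2) (ys.length + 1)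
      (kh_single_length C ys (ys.length + 1) (Nat.lt_succ_self _))
    refine ⟨by rw [this, h0]; simp, ?_⟩
    have fA := finite h1 0
    have fC := finite h2 0
    rw [hA] at fA
    rw [hC] at fC
    rw [hB]
    exact WithTop.add_ne_top.2 ⟨(WithTop.add_ne_top.1 fA).2, (WithTop.add_ne_top.1 fC).1⟩
  constructor
  · rintro ⟨h, hc⟩
    have h1 : kh P ys (single A) 0 ≠ ⊤ := kh_finite_of_lam (fun Q _ hlt hy =>
      le_antisymm ((lam_le_of_injective f hf).trans (lam_of_kh_finite h Q hlt hy).le) bot_le) 0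
    have h2 : kh P ys (single C) 0 ≠ ⊤ := kh_finite_of_lam (fun Q _ hlt hy =>
      le_antisymm ((lam_le_of_surjective g hg).trans (lam_of_kh_finite h Q hlt hy).le) bot_le) 0
    have h3 := kosz_full_nonneg ys _ le_rfl P hP hys A h1
    have h4 := kosz_full_nonneg ys _ le_rfl P hP hys C h2
    have h5 := (key h1 h2).1
    exact ⟨⟨h1, by linarith⟩, ⟨h2, by linarith⟩⟩
  · rintro ⟨⟨h1, c1⟩, h2, c2⟩
    have := key h1 h2
    exact ⟨this.2, by rw [← this.1, c1, c2, add_zero]⟩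

theorem of_injective (hys : ∀ y ∈ ys, y ∈ P) (h : Small P ys L) (f : A →ₗ[S] L)
    (hf : Function.Injective f) : Small P ys A :=
  ((ses hys f (LinearMap.range f).mkQ hf (Submodule.mkQ_surjective _)
    (LinearMap.exact_map_mkQ_range f)).1 h).1

theorem of_surjective (hys : ∀ y ∈ ys, y ∈ P) (h : Small P ys L) (f : L →ₗ[S] C)
    (hf : Function.Surjective f) : Small P ys C := by
  have := isNoetherian_of_isNoetherianRing_of_finite S L
  exact ((ses hys (LinearMap.ker f).subtype f (Submodule.injective_subtype _) hf
    (LinearMap.exact_subtype_ker_map f)).1 h).2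

theorem of_exact (hys : ∀ y ∈ ys, y ∈ P) (hA : Small P ys A) (hC : Small P ys C) (f : A →ₗ[S] L)
    (g : L →ₗ[S] C) (hg : Function.Surjective g) (hfg : Function.Exact f g) : Small P ys L := by
  have := isNoetherian_of_isNoetherianRing_of_finite S L
  refine (ses hys (LinearMap.range f).subtype g (Submodule.injective_subtype _) hg ?_).2
    ⟨of_surjective hys hA f.rangeRestrict f.surjective_rangeRestrict, hC⟩
  intro x
  rw [hfg x]
  simp

/-- Subquotients of small modules are small. -/
theorem of_subquotient (hys : ∀ y ∈ ys, y ∈ P) (hL : Small P ys L) (f : A →ₗ[S] L) (g : A →ₗ[S] C)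
    (hg : Function.Surjective g) (h : ∀ x, f x = 0 → g x = 0) : Small P ys C := by
  have := isNoetherian_of_isNoetherianRing_of_finite S L
  obtain ⟨q, hq⟩ := exists_descend f.rangeRestrict f.surjective_rangeRestrict g
    fun x hx => h x (congrArg Subtype.val hx)
  refine of_surjective hys (of_injective hys hL (LinearMap.range f).subtype
    (Submodule.injective_subtype _)) q fun c => ?_
  obtain ⟨x, rfl⟩ := hg c
  exact ⟨_, hq x⟩

end Small

/-- Finite modules with nonzero localizations at `P` have nonzero tensor product at `P`. -/
theorem lam_tensor_eq_zero {P : Ideal S} [P.IsPrime] {A B : Type u} [AddCommGroup A] [Module S A]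
    [Module.Finite S A] [AddCommGroup B] [Module S B] [Module.Finite S B]
    (h : lam P (A ⊗[S] B) = 0) : lam P A = 0 ∨ lam P B = 0 := by
  have key : ∀ (L : Type u) [AddCommGroup L] [Module S L] [Module.Finite S L],
      lam P L = 0 ↔ ¬ Nontrivial (P.ResidueField ⊗[S] L) := by
    intro L _ _ _
    rw [lam_eq_zero_iff, ← Module.mem_support_iff_nontrivial_residueField_tensorProduct (M := L) ⟨P, ‹_›⟩,
      Module.notMem_support_iff']
  rw [key] at h
  rw [key, key]
  by_contra! hc
  obtain ⟨h1, h2⟩ := hc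
  refine h ?_
  have := (TensorProduct.AlgebraTensorModule.distribBaseChange S P.ResidueField A B).toEquiv
  have h3 : Nontrivial ((P.ResidueField ⊗[S] A) ⊗[P.ResidueField] (P.ResidueField ⊗[S] B)) :=
    Module.FaithfullyFlat.lTensor_nontrivial _ _ _
  exact this.nontrivial

end ExtRigid

namespace ExtRigid
open TensorProduct Cx

/-- Dévissage of a class of modules along powers of an element. -/
theorem devissage {Q : Type u} [CommRing Q] (a : Q) {C : Type u} [AddCommGroup C] [Module Q C]
    (p : Submodule Q C → Prop) (h0 : ∀ A : Submodule Q C, (∀ x ∈ A, a • x = 0) → p A)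
    (hs : ∀ A : Submodule Q C, p (A ⊓ LinearMap.ker (a • (LinearMap.id : C →ₗ[Q] C))) →
      p (A.map (a • (LinearMap.id : C →ₗ[Q] C))) → p A) (n : ℕ) :
    ∀ A : Submodule Q C, (∀ x ∈ A, a ^ n • x = 0) → p A := by
  induction n with
  | zero =>
    refine fun A hA => h0 A fun x hx => ?_
    have := hA x hx
    rw [pow_zero, one_smul] at this
    rw [this, smul_zero]
  | succ n ih =>
    refine fun A hA => hs A (h0 _ fun x hx => hx.2) (ih _ ?_)
    rintro _ ⟨x, hx, rfl⟩
    have := hA x hx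
    rwa [pow_succ, mul_smul] at this

theorem exists_pow_torsion {Q : Type u} [CommRing Q] [IsNoetherianRing Q] (a : Q) (C : Type u)
    [AddCommGroup C] [Module Q C] [Module.Finite Q C] :
    ∃ n : ℕ, ∀ x ∈ powTorsion a C, a ^ n • x = 0 := by
  obtain ⟨s, hs⟩ := (inferInstance : Module.Finite Q (powTorsion a C))
  have : ∃ n : ℕ, ∀ x ∈ s, a ^ n • x = 0 := by
    choose k hk using fun x : powTorsion a C => mem_powTorsion.1 x.2
    refine ⟨s.sup k, fun x hx => ?_⟩
    obtain ⟨l, hl⟩ := Nat.exists_eq_add_of_le (Finset.le_sup hx : k x ≤ s.sup k)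
    rw [hl, add_comm, pow_add, mul_smul]
    rw [Subtype.ext (hk x) (a1 := a ^ k x • x) (a2 := 0), smul_zero]
  obtain ⟨n, hn⟩ := this
  refine ⟨n, fun x hx => ?_⟩
  have h1 : (⊤ : Submodule Q (powTorsion a C)) ≤
      LinearMap.ker (a ^ n • (LinearMap.id : powTorsion a C →ₗ[Q] powTorsion a C)) := by
    rw [← hs, Submodule.span_le]
    exact hn
  exact congrArg Subtype.val (h1 (Submodule.mem_top (x := ⟨x, hx⟩)))

namespace Half
variable {Q₁ Q₂ S : Type u} [CommRing Q₁] [IsLocalRing Q₁] [CommRing Q₂] [IsLocalRing Q₂]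
    [CommRing S] [IsLocalRing S]
    [Algebra Q₁ S] [Algebra Q₂ S] {π₁ : Q₁} {π₂ : Q₂} (h : Half Q₁ Q₂ S π₁ π₂)
    (h' : Half Q₂ Q₁ S π₂ π₁)
    [IsNoetherianRing Q₁] [IsNoetherianRing Q₂] [IsNoetherianRing S]
    [IsLocalHom (algebraMap Q₁ S)] [IsLocalHom (algebraMap Q₂ S)]
    [Module.Flat Q₁ S] [Module.Flat Q₂ S]
  {C : Type u} [AddCommGroup C] [Module Q₁ C] [Module.Finite Q₁ C]
  {m : ℕ} {N' N : Type u} [AddCommGroup N'] [Module Q₂ N'] [Module.Finite Q₂ N']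
  [AddCommGroup N] [Module Q₂ N] [Module.Finite Q₂ N]
  (i : N' →ₗ[Q₂] (Fin m → Q₂)) (r : (Fin m → Q₂) →ₗ[Q₂] N)

variable (Q₁ S C) in
/-- The torsion of the completed product of `C` and the cokernel of `i`. -/
noncomputable def beta : Submodule S (BT Q₁ S C (S ⊗[Q₂] N')) :=
  LinearMap.ker (atU Q₁ C (i.baseChange S))

section
include h h'
variable {i r} (hi : Function.Injective i) (hr : Function.Surjective r) (hir : Function.Exact i r)
include hi hr hir

theorem torsionFree_of_inj (x : N') (hx : π₂ • x = 0) : x = 0 := by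
  refine hi ((funext fun k => h.reg _ ?_).trans (map_zero i).symm)
  have := congrFun (congrArg i hx) k
  simpa using this

variable {P : Ideal S} [hP : P.IsPrime] {ys : List S} (hys : ∀ y ∈ ys, y ∈ P)
include hys

theorem small_of_killed (hβ : Small P ys (beta Q₁ S C i)) (A : Submodule Q₁ C)
    (hA : ∀ x ∈ A, π₁ • x = 0) (D : Submodule Q₂ N) (hD : ∀ x ∈ D, π₂ • x = 0) :
    Small P ys (BT Q₁ S A (S ⊗[Q₂] D)) := by
  have hNt := h.torsionFree_of_inj h' hi hr hir
  let E := D.comap r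
  let rE : E →ₗ[Q₂] D := r.restrict fun x hx => hx
  have hrE : Function.Surjective rE := fun ⟨x, hx⟩ => by
    obtain ⟨y, rfl⟩ := hr x
    exact ⟨⟨y, hx⟩, rfl⟩
  have hE : ∀ x : E, ∃ y : N', i y = π₂ • x.1 := fun x => (hir _).1 (by
    rw [map_smul]; exact hD _ x.2)
  let e := LinearEquiv.ofInjective i hi
  let g : E →ₗ[Q₂] N' := e.symm.toLinearMap ∘ₗ
    (π₂ • (LinearMap.id : (Fin m → Q₂) →ₗ[Q₂] (Fin m → Q₂))).restrict
      (p := E) (q := LinearMap.range i) fun x hx => hE ⟨x, hx⟩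
  have hg : ∀ x : E, i (g x) = π₂ • x.1 := fun x =>
    congrArg Subtype.val (e.apply_symm_apply _)
  let N'' := N' ⧸ LinearMap.range (π₂ • (LinearMap.id : N' →ₗ[Q₂] N'))
  have hN'' : ∀ x : N'', π₂ • x = 0 := by
    intro x
    obtain ⟨x, rfl⟩ := Submodule.mkQ_surjective _ x
    rw [← map_smul]
    exact (Submodule.Quotient.mk_eq_zero _).2 ⟨x, rfl⟩
  let pr : N' →ₗ[Q₂] N'' := Submodule.mkQ _
  obtain ⟨k, hk⟩ := exists_descend rE hrE (pr ∘ₗ g) (by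
    intro x hx
    obtain ⟨y, hy⟩ := (hir x.1).1 (congrArg Subtype.val hx)
    refine (Submodule.Quotient.mk_eq_zero _).2 ⟨y, hi ?_⟩
    rw [hg, ← hy]
    exact map_smul _ _ _)
  have hkinj : Function.Injective k := by
    rw [← LinearMap.ker_eq_bot, LinearMap.ker_eq_bot']
    intro x hx
    obtain ⟨x, rfl⟩ := hrE x
    rw [hk] at hx
    obtain ⟨y, hy⟩ := (Submodule.Quotient.mk_eq_zero _).1 hx
    have : x.1 = i y := by
      refine funext fun k => sub_eq_zero.1 (h.reg _ ?_)
      have h1 := congrFun ((hg x).symm.trans ((congrArg i hy).symm.trans (map_smul i π₂ y))) k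
      rw [mul_sub, sub_eq_zero]
      exact h1
    exact Subtype.ext ((congrArg r this).trans (hir.apply_apply_eq_zero y))
  have hinj := h.inj_of_killed (A := A) (fun x => Subtype.ext (hA _ x.2)) hN'' k hkinj
  have hAC : Function.Injective (atC (S := S) A.subtype (S ⊗[Q₂] N')) :=
    h.relFlat_of_torsionFree hNt _ _ _ A.injective_subtype (by
      rintro a rfl x; exact zero_smul _ _)
  let H : BT Q₁ S A (S ⊗[Q₂] E) →ₗ[S] beta Q₁ S C i :=
    (atC A.subtype _ ∘ₗ atU Q₁ A (g.baseChange S)).codRestrict _ (by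
      intro x
      change atU Q₁ C (i.baseChange S) (atC A.subtype _ (atU Q₁ A (g.baseChange S) x)) = 0
      rw [atU_atC]
      have : atU Q₁ A (i.baseChange S) (atU Q₁ A (g.baseChange S) x) = 0 := by
        induction x using bt_ind with
        | h0 => simp
        | ha x y hx hy => rw [map_add, map_add, hx, hy, add_zero]
        | h1 c u =>
          have h2 : (i.baseChange S) (g.baseChange S u) =
              algebraMap Q₁ S π₁ • (E.subtype.baseChange S u) := by
            rw [h.comp]
            induction u using TensorProduct.induction_on with
            | zero => simp
            | add x y hx hy => simp only [map_add, hx, hy, smul_add]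
            | tmul s x =>
              simp only [LinearMap.baseChange_tmul, hg, tmul_smul, algebraMap_smul]
              rfl
          rw [atU_bt, atU_bt, h2, bt_algebraMap_smul,
            (Subtype.ext (hA _ c.2) : π₁ • c = 0), tmul_zero, bt_zero_left]
      rw [this, map_zero])
  refine Small.of_subquotient hys hβ H (atU Q₁ A (rE.baseChange S))
    (atU_surj (baseChange_surj hrE)) fun x hx => hinj ?_
  have h1 : atU Q₁ A (g.baseChange S) x = 0 :=
    hAC ((congrArg Subtype.val hx).trans (map_zero _).symm)
  rw [map_zero, ← atU_comp, ← LinearMap.baseChange_comp,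
    show k ∘ₗ rE = pr ∘ₗ g from LinearMap.ext hk, LinearMap.baseChange_comp, atU_comp, h1, map_zero]

theorem small_of_torsion (hβ : Small P ys (beta Q₁ S C i)) (n l : ℕ) (A : Submodule Q₁ C)
    (hA : ∀ x ∈ A, π₁ ^ n • x = 0) (D : Submodule Q₂ N) (hD : ∀ x ∈ D, π₂ ^ l • x = 0) :
    Small P ys (BT Q₁ S A (S ⊗[Q₂] D)) := by
  refine devissage π₂ (fun D : Submodule Q₂ N => Small P ys (BT Q₁ S A (S ⊗[Q₂] D)))
    (fun D hD => ?_) (fun D h1 h2 => ?_) l D hD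
  · refine devissage π₁ (fun A : Submodule Q₁ C => Small P ys (BT Q₁ S A (S ⊗[Q₂] D)))
      (fun A hA => h.small_of_killed h' hi hr hir hys hβ A hA D hD) (fun A h1 h2 => ?_) n A hA
    have hg := LinearMap.submoduleMap_surjective (π₁ • (LinearMap.id : C →ₗ[Q₁] C)) A
    refine Small.of_exact hys h1 h2 (atC (Submodule.inclusion inf_le_left) _)
      (atC ((π₁ • (LinearMap.id : C →ₗ[Q₁] C)).submoduleMap A) _) (atC_surj hg)
      (atC_exact (fun x => ⟨fun hx => ⟨⟨x.1, x.2, congrArg Subtype.val hx⟩, rfl⟩, ?_⟩) hg)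
    rintro ⟨y, rfl⟩
    exact Subtype.ext y.2.2
  · have hg := LinearMap.submoduleMap_surjective (π₂ • (LinearMap.id : N →ₗ[Q₂] N)) D
    refine Small.of_exact hys h1 h2 (atU _ _ ((Submodule.inclusion inf_le_left).baseChange S))
      (atU _ _ (((π₂ • (LinearMap.id : N →ₗ[Q₂] N)).submoduleMap D).baseChange S))
      (atU_surj (baseChange_surj hg))
      (atU_exact (baseChange_exact
        (fun x => ⟨fun hx => ⟨⟨x.1, x.2, congrArg Subtype.val hx⟩, rfl⟩, ?_⟩) hg)
        (baseChange_surj hg))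
    rintro ⟨y, rfl⟩
    exact Subtype.ext y.2.2

theorem lam_torsion (hβ : Small P ys (beta Q₁ S C i))
    (hB : ∀ j, kh P ys (single (BT Q₁ S C (S ⊗[Q₂] N))) (j + 1) = 0) :
    lam P (S ⊗[Q₁] powTorsion π₁ C) = 0 ∨ lam P (S ⊗[Q₂] powTorsion π₂ N) = 0 := by
  refine lam_tensor_eq_zero ?_
  obtain ⟨n, hn⟩ := exists_pow_torsion π₁ C
  obtain ⟨l, hl⟩ := exists_pow_torsion π₂ N
  have hs := h.small_of_torsion h' hi hr hir hys hβ n l _ hn _ hl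
  let f : BT Q₁ S (powTorsion π₁ C) (S ⊗[Q₂] powTorsion π₂ N) →ₗ[S] BT Q₁ S C (S ⊗[Q₂] N) :=
    atC (powTorsion π₁ C).subtype _ ∘ₗ atU _ _ ((powTorsion π₂ N).subtype.baseChange S)
  have hf1 := h.inj_of_torsionFree_coker (A := powTorsion π₁ C) (powTorsion π₂ N).subtype
    (Submodule.injective_subtype _) (by
      rintro x ⟨y, hy⟩
      obtain ⟨k, hk⟩ := mem_powTorsion.1 y.2
      refine ⟨⟨x, mem_powTorsion.2 ⟨k + 1, ?_⟩⟩, rfl⟩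
      rw [pow_succ, mul_smul, ← hy]
      exact hk)
  have hf2 := h'.inj_of_torsionFree_coker (A := N) (powTorsion π₁ C).subtype
    (Submodule.injective_subtype _) (by
      rintro x ⟨y, hy⟩
      obtain ⟨k, hk⟩ := mem_powTorsion.1 y.2
      refine ⟨⟨x, mem_powTorsion.2 ⟨k + 1, ?_⟩⟩, rfl⟩
      rw [pow_succ, mul_smul, ← hy]
      exact hk)
  have hf : Function.Injective f := by
    intro x y hxy
    refine hf1 ((swap Q₁ Q₂ S _ _).injective (hf2 ?_))
    rw [← swap_atC, ← swap_atC]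
    exact congrArg _ hxy
  let e := LinearEquiv.ofInjective f hf
  have hs' : Small P ys (LinearMap.range f) :=
    Small.of_surjective hys hs e.toLinearMap e.surjective
  have := lam_zero_of_chi le_rfl hys hB (LinearMap.range f) hs'.1 hs'.2
  exact le_antisymm ((lam_le_of_injective e.toLinearMap e.injective).trans this.le) bot_le

theorem lam_beta (hβ : Small P ys (beta Q₁ S C i))
    (hB : ∀ j, kh P ys (single (BT Q₁ S C (S ⊗[Q₂] N))) (j + 1) = 0) :
    lam P (beta Q₁ S C i) = 0 := by
  have hNt := h.torsionFree_of_inj h' hi hr hir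
  rcases h.lam_torsion h' hi hr hir hys hβ hB with h0 | h0
  · obtain ⟨s, hsP, hs⟩ := exists_smul_eq_zero h0
    refine lam_eq_zero_iff.2 fun x => ⟨s, hsP, Subtype.ext ?_⟩
    change s • x.1 = 0
    let T := powTorsion π₁ C
    have hCb : RelFlat Q₂ S ⊥ (S ⊗[Q₁] (C ⧸ T)) :=
      h'.relFlat_of_torsionFree fun x hx => smul_quot_powTorsion C π₁ x hx
    have hx : atC (S := S) T.mkQ (S ⊗[Q₂] N') x.1 = 0 := by
      refine (swap Q₁ Q₂ S _ _).injective (hCb _ _ i hi (by rintro a rfl x; exact zero_smul _ _) ?_)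
      rw [← swap_atU, atU_atC, (x.2 : atU Q₁ C (i.baseChange S) x.1 = 0)]
      simp
    obtain ⟨y, hy⟩ := (atC_exact (LinearMap.exact_subtype_mkQ T) T.mkQ_surjective _).1 hx
    rw [← hy, ← map_smul]
    suffices s • y = 0 by rw [this, map_zero]
    clear hy
    induction y using bt_ind with
    | h0 => simp
    | ha x y hx hy => rw [smul_add, hx, hy, add_zero]
    | h1 c u => rw [smul_bt_left, hs, bt_zero_left]
  · obtain ⟨s, hsP, hs⟩ := exists_smul_eq_zero h0
    refine lam_eq_zero_iff.2 fun x => ⟨s, hsP, Subtype.ext ?_⟩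
    change s • x.1 = 0
    let E := (powTorsion π₂ N).comap r
    let rE : E →ₗ[Q₂] powTorsion π₂ N := r.restrict fun x hx => hx
    have hrE : Function.Surjective rE := fun ⟨x, hx⟩ => by
      obtain ⟨y, rfl⟩ := hr x
      exact ⟨⟨y, hx⟩, rfl⟩
    let j : N' →ₗ[Q₂] E := i.codRestrict E fun x => by
      rw [Submodule.mem_comap, hir.apply_apply_eq_zero]
      exact zero_mem _
    have hj : Function.Injective j := fun x y hxy => hi (congrArg Subtype.val hxy)
    have hjr : Function.Exact j rE := fun x => by
      refine ⟨fun hx => ?_, ?_⟩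
      · obtain ⟨y, hy⟩ := (hir x.1).1 (congrArg Subtype.val hx)
        exact ⟨y, Subtype.ext hy⟩
      · rintro ⟨y, rfl⟩
        exact Subtype.ext (hir.apply_apply_eq_zero y)
    have hE := h.inj_of_torsionFree_coker (A := C) E.subtype E.injective_subtype (by
      rintro x ⟨y, hy⟩
      obtain ⟨k, hk⟩ := mem_powTorsion.1 y.2
      refine ⟨⟨x, mem_powTorsion.2 ⟨k + 1, ?_⟩⟩, rfl⟩
      rw [pow_succ, mul_smul, ← map_smul, ← hy]
      exact hk)
    have hx : atU Q₁ C (j.baseChange S) x.1 = 0 := by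
      refine hE ?_
      rw [← atU_comp, ← LinearMap.baseChange_comp, map_zero]
      exact x.2
    have hjS : Function.Injective (j.baseChange S) := baseChange_inj hj
    let e := LinearEquiv.ofInjective _ hjS
    let σ : S ⊗[Q₂] E →ₗ[S] S ⊗[Q₂] N' := e.symm.toLinearMap ∘ₗ
      (s • (LinearMap.id : S ⊗[Q₂] E →ₗ[S] S ⊗[Q₂] E)).codRestrict _ (fun x => by
        refine (baseChange_exact hjr hrE _).1 ?_
        rw [LinearMap.smul_apply, map_smul, hs])
    have hσ : σ ∘ₗ j.baseChange S = s • LinearMap.id := by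
      refine LinearMap.ext fun x => ?_
      refine hjS ((congrArg Subtype.val (e.apply_symm_apply _)).trans ?_)
      exact (map_smul (j.baseChange S) s x).symm
    have := atU_comp (Q := Q₁) (j.baseChange S) σ x.1
    rw [hx, map_zero, hσ] at this
    rw [← this]
    exact (LinearMap.congr_fun (LinearMap.lTensor_smul (S ⊗[Q₁] C) s LinearMap.id) x.1).trans
      (congrArg (s • ·) (atU_id x.1)) |>.symm

end
end Half
end ExtRigid

namespace ExtRigid
open TensorProduct

namespace Cx

/-- Exactness in positive degrees. -/
def Acyclic {S : Type u} [CommRing S] (X : Cx S) : Prop :=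
  ∀ j x, X.d j x = 0 → ∃ y, X.d (j + 1) y = x

section
variable {S : Type u} [CommRing S] {A B X : Cx S}

/-- The first homology and higher exactness of the cokernel of an injective map of resolutions. -/
theorem SES.exists_cycle_map (e : SES A B X) (hA : A.Acyclic) (hB : B.Acyclic) {a b : Type u}
    [AddCommGroup a] [Module S a] [AddCommGroup b] [Module S b] (p : A.X 0 →ₗ[S] a)
    (hp : Function.Surjective p) (hpe : Function.Exact (A.d 0) p) (q : B.X 0 →ₗ[S] b)
    (hqe : Function.Exact (B.d 0) q) (φ : a →ₗ[S] b) (hφ : ∀ x, φ (p x) = q (e.f 0 x)) :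
    (∃ r : LinearMap.ker (X.d 0) →ₗ[S] LinearMap.ker φ, Function.Surjective r ∧
      ∀ z, r z = 0 ↔ ∃ y, X.d 1 y = z) ∧
    ∀ j x, X.d (j + 1) x = 0 → ∃ y, X.d (j + 2) y = x := by
  have hfg : ∀ j x, e.g j (e.f j x) = 0 := fun j x => (e.exact j).apply_apply_eq_zero x
  constructor
  · let W : Submodule S (B.X 1) := (LinearMap.range (e.f 0)).comap (B.d 0)
    let ι := LinearEquiv.ofInjective (e.f 0) (e.inj 0)
    let l : W →ₗ[S] A.X 0 := ι.symm.toLinearMap ∘ₗ (B.d 0).restrict fun x hx => hx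
    have hl : ∀ x : W, e.f 0 (l x) = B.d 0 x := fun x =>
      congrArg Subtype.val (ι.apply_symm_apply _)
    let w₁ : W →ₗ[S] LinearMap.ker (X.d 0) := (e.g 1 ∘ₗ W.subtype).codRestrict _ (fun x => by
      change X.d 0 (e.g 1 x) = 0
      rw [← e.g_comm, ← hl, hfg])
    let w₂ : W →ₗ[S] LinearMap.ker φ := (p ∘ₗ l).codRestrict _ (fun x => by
      change φ (p (l x)) = 0
      rw [hφ, hl, hqe.apply_apply_eq_zero])
    have h₁ : Function.Surjective w₁ := by
      rintro ⟨x, hx⟩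
      obtain ⟨y, rfl⟩ := e.surj 1 x
      exact ⟨⟨y, (e.exact 0 _).1 ((e.g_comm 0 y).trans hx)⟩, rfl⟩
    have h₂ : Function.Surjective w₂ := by
      rintro ⟨x, hx⟩
      obtain ⟨y, rfl⟩ := hp x
      rw [LinearMap.mem_ker, hφ] at hx
      obtain ⟨z, hz⟩ := (hqe _).1 hx
      exact ⟨⟨z, y, hz.symm⟩, Subtype.ext (congrArg p (e.inj 0 ((hl _).trans hz)))⟩
    have h₃ : ∀ x : W, w₂ x = 0 ↔ ∃ y, X.d 1 y = (w₁ x).1 := by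
      intro x
      constructor
      · intro hx
        obtain ⟨y, hy⟩ := (hpe _).1 (congrArg Subtype.val hx)
        have : B.d 0 (x.1 - e.f 1 y) = 0 := by
          rw [map_sub, ← e.f_comm, hy, hl, sub_self]
        obtain ⟨z, hz⟩ := hB 0 _ this
        refine ⟨e.g 2 z, ?_⟩
        rw [← e.g_comm, hz, map_sub, hfg, sub_zero]
        rfl
      · rintro ⟨y, hy⟩
        obtain ⟨z, rfl⟩ := e.surj 2 y
        obtain ⟨t, ht⟩ := (e.exact 1 (x.1 - B.d 1 z)).1 (by
          rw [map_sub, e.g_comm, hy]; exact sub_self _)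
        refine Subtype.ext ((hpe _).2 ⟨t, e.inj 0 ?_⟩)
        rw [hl, e.f_comm, ht, map_sub, B.dd, sub_zero]
    obtain ⟨r, hr⟩ := exists_descend w₁ h₁ w₂ fun x hx =>
      (h₃ x).2 ⟨0, (map_zero _).trans (congrArg Subtype.val hx).symm⟩
    refine ⟨r, fun x => ?_, fun z => ?_⟩
    · obtain ⟨y, rfl⟩ := h₂ x
      exact ⟨_, hr y⟩
    · obtain ⟨y, rfl⟩ := h₁ z
      rw [hr, h₃]
  · intro j x hx
    obtain ⟨y, rfl⟩ := e.surj _ x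
    rw [← e.g_comm] at hx
    obtain ⟨a', ha⟩ := (e.exact _ _).1 hx
    obtain ⟨c, hc⟩ := hA j a' (e.inj _ (by rw [e.f_comm, ha, B.dd, map_zero]))
    obtain ⟨z, hz⟩ := hB (j + 1) (y - e.f _ c) (by rw [map_sub, ← e.f_comm, hc, ha, sub_self])
    exact ⟨e.g _ z, by rw [← e.g_comm, hz, map_sub, hfg, sub_zero]⟩

/-- Koszul homology of a complex with homology in degrees zero and one. -/
theorem kh_two_step {M L : Type u} [AddCommGroup M] [Module S M] [AddCommGroup L] [Module S L]
    (p : X.X 0 →ₗ[S] M) (hp : Function.Surjective p) (hk : Function.Exact (X.d 0) p)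
    (r : LinearMap.ker (X.d 0) →ₗ[S] L) (hr : Function.Surjective r)
    (hrk : ∀ z, r z = 0 ↔ ∃ y, X.d 1 y = z)
    (hX : ∀ j x, X.d (j + 1) x = 0 → ∃ y, X.d (j + 2) y = x) (P : Ideal S) [P.IsPrime]
    (ys : List S) : ∃ ρ σ τ : ℕ → ℕ∞, τ 0 = 0 ∧ (∀ j, kh P ys (single L) j = τ (j + 1) + ρ j) ∧
      (∀ j, kh P ys X (j + 1) = ρ j + σ j) ∧
      ∀ j, kh P ys (single M) (j + 1) = σ j + τ j := by
  obtain ⟨ρ, σ, τ, h0, hA, hB, hC⟩ := (X.augSES p hp hk).kles P ys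
  have h1 := hA 0
  rw [kh_bdTrunc_zero, eq_comm, add_eq_zero] at h1
  exact ⟨fun j => ρ (j + 1), fun j => σ (j + 1), fun j => τ (j + 1), h1.1,
    fun j => by rw [← hA (j + 1), kh_bdTrunc_succ r hr hrk hX], fun j => hB _, fun j => hC _⟩

end

section
variable {Q : Type u} [CommRing Q] (S : Type u) [CommRing S] [Algebra Q S]

/-- The complex `(S ⊗ G) ⊗ U`. -/
noncomputable def tens (G : Cx Q) (U : Type u) [AddCommGroup U] [Module S U] : Cx S where
  X j := BT Q S (G.X j) U
  d j := atC (G.d j) U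
  dd j x := by
    rw [← atC_comp, show G.d j ∘ₗ G.d (j + 1) = 0 from LinearMap.ext (G.dd j)]
    rw [atC, LinearMap.baseChange_zero, LinearMap.rTensor_zero]
    rfl

variable {S} {G : Cx Q} {U U' U'' : Type u} [AddCommGroup U] [Module S U] [AddCommGroup U']
  [Module S U'] [AddCommGroup U''] [Module S U'']

noncomputable def tensSES (G : Cx Q) [∀ j, Module.Flat Q (G.X j)] (f : U →ₗ[S] U')
    (g : U' →ₗ[S] U'') (hf : Function.Injective f) (hg : Function.Surjective g)
    (hfg : Function.Exact f g) : SES (G.tens S U) (G.tens S U') (G.tens S U'') where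
  f j := atU Q (G.X j) f
  g j := atU Q (G.X j) g
  f_comm j x := atU_atC (G.d j) f x
  g_comm j x := atU_atC (G.d j) g x
  inj _ := Module.Flat.lTensor_preserves_injective_linearMap f hf
  surj _ := atU_surj hg
  exact _ := atU_exact hfg hg

theorem tens_acyclic [G.Fin] (hG : G.Acyclic) (hU : RelFlat Q S ⊥ U) : (G.tens S U).Acyclic := by
  intro j (x : BT Q S (G.X (j + 1)) U) (hx : atC (G.d j) U x = 0)
  have h1 : atC (G.d j).rangeRestrict U x = 0 :=
    hU _ _ (LinearMap.range (G.d j)).subtype (Submodule.injective_subtype _)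
      (by rintro a rfl x; exact zero_smul _ _) (by
        rw [← atC_comp, map_zero]
        exact hx)
  refine (atC_exact (f := G.d (j + 1)) (f' := (G.d j).rangeRestrict) (fun y => ?_)
    (G.d j).surjective_rangeRestrict _).1 h1
  constructor
  · exact fun hy => hG j y (congrArg Subtype.val hy)
  · rintro ⟨z, rfl⟩
    exact Subtype.ext (G.dd j z)

end
end Cx

open Cx

namespace Half
variable {Q₁ Q₂ S : Type u} [CommRing Q₁] [IsLocalRing Q₁] [CommRing Q₂] [IsLocalRing Q₂]
    [CommRing S] [IsLocalRing S]
    [Algebra Q₁ S] [Algebra Q₂ S] {π₁ : Q₁} {π₂ : Q₂} (h : Half Q₁ Q₂ S π₁ π₂)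
    (h' : Half Q₂ Q₁ S π₂ π₁)
    [IsNoetherianRing Q₁] [IsNoetherianRing Q₂] [IsNoetherianRing S]
    [IsLocalHom (algebraMap Q₁ S)] [IsLocalHom (algebraMap Q₂ S)]
    [Module.Flat Q₁ S] [Module.Flat Q₂ S]
  {C : Type u} [AddCommGroup C] [Module Q₁ C] [Module.Finite Q₁ C]
  {m : ℕ} {N' N : Type u} [AddCommGroup N'] [Module Q₂ N'] [Module.Finite Q₂ N']
  [AddCommGroup N] [Module Q₂ N] [Module.Finite Q₂ N]
  {i : N' →ₗ[Q₂] (_root_.Fin m → Q₂)} {r : (_root_.Fin m → Q₂) →ₗ[Q₂] N}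
  (hi : Function.Injective i) (hr : Function.Surjective r) (hir : Function.Exact i r)
  {G : Cx Q₁} [G.Fin] [∀ j, Module.Flat Q₁ (G.X j)] (hG : G.Acyclic) (p : G.X 0 →ₗ[Q₁] C)
  (hp : Function.Surjective p) (hk : Function.Exact (G.d 0) p)

include h h' hi hr hir hG hp hk

/-- One step of the induction over the spectrum: a nonpositive higher Euler characteristic forces
vanishing. -/
theorem kh_step {ys : List S} {P : Ideal S} [P.IsPrime] (hys : ∀ y ∈ ys, y ∈ P)
    (hlt : ∀ (Q : Ideal S) [Q.IsPrime], Q < P → (∀ y ∈ ys, y ∈ Q) →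
      lam Q (beta Q₁ S C i) = 0 ∧ ∀ j, kh Q ys (G.tens S (S ⊗[Q₂] N)) (j + 1) = 0)
    (hchi : (∀ j, kh P ys (G.tens S (S ⊗[Q₂] N)) (j + 1) ≠ ⊤) →
      (∀ j, ys.length < j → kh P ys (G.tens S (S ⊗[Q₂] N)) (j + 1) = 0) →
      chi (ys.length + 1) (fun j => kh P ys (G.tens S (S ⊗[Q₂] N)) (j + 1)) ≤ 0) :
    lam P (beta Q₁ S C i) = 0 ∧ ∀ j, kh P ys (G.tens S (S ⊗[Q₂] N)) (j + 1) = 0 := by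
  obtain ⟨⟨q, hq, hqk⟩, hX⟩ := (G.tensSES (i.baseChange S) (r.baseChange S) (baseChange_inj hi)
    (baseChange_surj hr) (baseChange_exact hir hr)).exists_cycle_map
    (tens_acyclic hG (h.relFlat_of_torsionFree (h.torsionFree_of_inj h' hi hr hir)))
    (tens_acyclic hG (relFlat_free m ⊥)) (atC p _) (atC_surj hp) (atC_exact hk hp)
    (atC p _) (atC_exact hk hp) (atU Q₁ C (i.baseChange S)) (fun x => atU_atC p _ x)
  have les : ∀ (Q : Ideal S) [Q.IsPrime], ∃ ρ σ τ : ℕ → ℕ∞, τ 0 = 0 ∧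
      (∀ j, kh Q ys (single (beta Q₁ S C i)) j = τ (j + 1) + ρ j) ∧
      (∀ j, kh Q ys (G.tens S (S ⊗[Q₂] N)) (j + 1) = ρ j + σ j) ∧
      ∀ j, kh Q ys (single (BT Q₁ S C (S ⊗[Q₂] N))) (j + 1) = σ j + τ j := fun Q _ =>
    kh_two_step (X := G.tens S (S ⊗[Q₂] N))
      (atC p _) (atC_surj hp) (atC_exact hk hp) q hq hqk hX Q ys
  have fβ : ∀ j, kh P ys (single (beta Q₁ S C i)) j ≠ ⊤ :=
    kh_finite_of_lam fun Q _ hQ hy => (hlt Q hQ hy).1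
  have fB : ∀ j, kh P ys (single (BT Q₁ S C (S ⊗[Q₂] N))) (j + 1) ≠ ⊤ := by
    refine fun j => lam_ne_top fun Q _ hQ => ?_
    by_cases hy : ∀ y ∈ ys, y ∈ Q
    · obtain ⟨ρ, σ, τ, h0, hA, hB, hC⟩ := les Q
      obtain ⟨e1, e2⟩ := hlt Q hQ hy
      have h1 : ∀ j, τ (j + 1) = 0 := fun j => by
        have := hA j
        rw [kh_single_of_lam _ e1, eq_comm, add_eq_zero] at this
        exact this.1
      have h2 := hB j
      rw [e2, eq_comm, add_eq_zero] at h2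
      refine (hC j).trans ?_
      rw [h2.2, zero_add]
      cases j with
      | zero => exact h0
      | succ j => exact h1 j
    · push Not at hy
      obtain ⟨y, hy, hyQ⟩ := hy
      exact kh_of_notMem hy hyQ _
  obtain ⟨ρ, σ, τ, h0, hA, hB, hC⟩ := les P
  have fX : ∀ j, kh P ys (G.tens S (S ⊗[Q₂] N)) (j + 1) ≠ ⊤ := fun j => by
    have h1 := fβ j
    have h2 := fB j
    rw [hA] at h1
    rw [hC] at h2
    rw [hB]
    exact WithTop.add_ne_top.2 ⟨(WithTop.add_ne_top.1 h1).2, (WithTop.add_ne_top.1 h2).1⟩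
  have e := chi_les hA hB hC fβ fB (ys.length + 1)
    (kh_single_length _ ys _ (by omega))
  have n1 := kosz_full_nonneg ys _ le_rfl P ‹_› hys (beta Q₁ S C i) (fβ 0)
  have n2 := kosz_nonneg ys (ys.length + 1) (Nat.le_succ _) P ‹_› hys
    (BT Q₁ S C (S ⊗[Q₂] N)) fB
  have n3 := hchi fX fun j hj => by
    have h1 := hA j
    have h2 := hC j
    rw [kh_single_length _ ys _ hj, eq_comm, add_eq_zero] at h1
    rw [kh_single_length _ ys _ (by omega), eq_comm, add_eq_zero] at h2
    rw [hB, h1.2, h2.1, add_zero]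
  rw [h0] at e
  simp only [ENat.toNat_zero, Nat.cast_zero, add_zero] at e
  have hBz := n2.2 (by linarith [n2.1])
  have hβz := h.lam_beta h' hi hr hir hys ⟨fβ 0, by linarith [n2.1]⟩ hBz
  refine ⟨hβz, fun j => ?_⟩
  have h1 := hA j
  have h2 := hC j
  rw [kh_single_of_lam _ hβz, eq_comm, add_eq_zero] at h1
  rw [hBz, eq_comm, add_eq_zero] at h2
  rw [hB, h1.2, h2.1, add_zero]

end Half
end ExtRigid

namespace ExtRigid
open TensorProduct

namespace Cx
variable {Q : Type u} [CommRing Q] {S : Type u} [CommRing S] [Algebra Q S]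

theorem atU_smul {C : Type u} [AddCommGroup C] [Module Q C] {U : Type u} [AddCommGroup U]
    [Module S U] (s : S) (x : BT Q S C U) :
    atU Q C (s • (LinearMap.id : U →ₗ[S] U)) x = s • x :=
  (LinearMap.congr_fun (LinearMap.lTensor_smul (S ⊗[Q] C) s LinearMap.id) x).trans
    (congrArg (s • ·) (atU_id x))

variable {P : Ideal S} [P.IsPrime] (G : Cx Q) [∀ j, Module.Flat Q (G.X j)]

theorem hl_tens_congr {U V : Type u} [AddCommGroup U] [Module S U] [AddCommGroup V] [Module S V]
    (φ : U →ₗ[S] V) (hφ : Function.Bijective φ) (j : ℕ) :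
    hl P (G.tens S U) j = hl P (G.tens S V) j := by
  let e := G.tensSES (0 : PUnit.{u + 1} →ₗ[S] U) φ (fun _ _ _ => rfl) hφ.2 (fun x => by
    rw [map_eq_zero_iff φ hφ.1]
    exact ⟨fun h => ⟨PUnit.unit, h.symm⟩, fun ⟨_, h⟩ => h.symm⟩)
  have hz : ∀ j, hl P (G.tens S PUnit.{u + 1}) j = 0 := fun j => by
    have : Subsingleton ((G.tens S PUnit.{u + 1}).X j) := by
      refine subsingleton_of_forall_eq 0 fun x : BT Q S (G.X j) PUnit => ?_
      induction x using bt_ind with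
      | h0 => rfl
      | ha x y hx hy => rw [hx, hy]; exact add_zero 0
      | h1 c u => exact bt_zero_right _
    exact hl_of_subsingleton j
  exact e.kh_eq_of_left (ys := []) hz j

/-- Koszul homology of a tensored complex along a sequence with commuting retractions. -/
theorem kh_tens_of_retract (ys : List S) (hnd : ys.Nodup) {U V : Type u} [AddCommGroup U]
    [Module S U] [AddCommGroup V] [Module S V] (φ : U →ₗ[S] V) (hφ : Function.Surjective φ)
    (hk : LinearMap.ker φ = Ideal.span {y | y ∈ ys} • (⊤ : Submodule S U))
    (hr : ∀ z ∈ ys, ∃ r : U →+ U, (∀ u, r (z • u) = u) ∧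
      ∀ w ∈ ys, w ≠ z → ∀ u, r (w • u) = w • r u) (j : ℕ) :
    kh P ys (G.tens S U) j = hl P (G.tens S V) j := by
  induction ys generalizing U with
  | nil =>
    refine G.hl_tens_congr φ ⟨?_, hφ⟩ j
    rw [← LinearMap.ker_eq_bot, hk]
    simp
  | cons y ys ih =>
    obtain ⟨hy, hnd⟩ := List.nodup_cons.1 hnd
    let f : U →ₗ[S] U := y • LinearMap.id
    have hf : Function.Injective f := by
      obtain ⟨r, hr1, -⟩ := hr y (by simp)
      exact Function.LeftInverse.injective (g := r) hr1
    rw [kh_cons_of_regular (G.tensSES f (LinearMap.range f).mkQ hf (Submodule.mkQ_surjective _)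
      (LinearMap.exact_map_mkQ_range f)) fun j x => atU_smul y x]
    have hle : LinearMap.range f ≤ LinearMap.ker φ := by
      rintro _ ⟨u, rfl⟩
      rw [hk]
      exact Submodule.smul_mem_smul (Ideal.subset_span (by simp)) Submodule.mem_top
    refine ih hnd ((LinearMap.range f).liftQ φ hle) ?_ ?_ ?_
    · intro v
      obtain ⟨u, rfl⟩ := hφ v
      exact ⟨Submodule.Quotient.mk u, rfl⟩
    · rw [Submodule.ker_liftQ, hk]
      have h1 : ({z | z ∈ y :: ys} : Set S) = {y} ∪ {z | z ∈ ys} := by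
        ext; simp
      have h2 : (Ideal.span {y} • (⊤ : Submodule S U)) = LinearMap.range f := by
        rw [Submodule.ideal_span_singleton_smul]
        ext u
        rw [Submodule.mem_smul_pointwise_iff_exists]
        simp [f]
      rw [h1, Ideal.span_union, Submodule.sup_smul, Submodule.map_sup, h2, Submodule.map_smul'',
        Submodule.map_top, Submodule.range_mkQ, Submodule.mkQ_map_self, bot_sup_eq]
    · intro z hz
      obtain ⟨r, hr1, hr2⟩ := hr z (by simp [hz])
      have hyz : y ≠ z := fun h => hy (h ▸ hz)
      let r' : U ⧸ LinearMap.range f →+ U ⧸ LinearMap.range f :=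
        QuotientAddGroup.map (LinearMap.range f).toAddSubgroup (LinearMap.range f).toAddSubgroup r
          (by
            rintro _ ⟨u, rfl⟩
            exact ⟨r u, (hr2 y (by simp) hyz u).symm⟩)
      refine ⟨r', fun u => ?_, fun w hw hwz u => ?_⟩
      · obtain ⟨u, rfl⟩ := Submodule.mkQ_surjective _ u
        exact congrArg Submodule.Quotient.mk (hr1 u)
      · obtain ⟨u, rfl⟩ := Submodule.mkQ_surjective _ u
        exact congrArg Submodule.Quotient.mk (hr2 w (by simp [hw]) hwz u)

end Cx
end ExtRigid

namespace ExtRigid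
open TensorProduct Cx

/-- A section of the second structure map of `S`, with kernel generated by coordinates. -/
structure Diag (Q₂ S : Type u) [CommRing Q₂] [CommRing S] [Algebra Q₂ S] (ys : List S)
    (δ : S → Q₂) : Prop where
  nodup : ys.Nodup
  gen : ∀ s, s - algebraMap Q₂ S (δ s) ∈ Ideal.span {y | y ∈ ys}
  retract : ∀ z ∈ ys, ∃ r : S →ₗ[Q₂] S, (∀ s, r (z * s) = s) ∧
    ∀ w ∈ ys, w ≠ z → ∀ s, r (w * s) = w * r s

section
variable {Q₁ Q₂ S : Type u} [CommRing Q₁] [CommRing Q₂] [CommRing S]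
  [Algebra Q₁ S] [Algebra Q₂ S] {ys : List S} {δ : S → Q₂}

/-- Homology of a complex tensored with a module on the diagonal, as Koszul homology. -/
theorem Diag.kh_tens (hδ : Diag Q₂ S ys δ) (V : Type u) [AddCommGroup V] [Module S V]
    [Module Q₂ V] [IsScalarTower Q₂ S V] (hV : ∀ y ∈ ys, ∀ v : V, y • v = 0) (G : Cx Q₁)
    [∀ j, Module.Flat Q₁ (G.X j)] (P : Ideal S) [P.IsPrime] (j : ℕ) :
    kh P ys (G.tens S (S ⊗[Q₂] V)) j = hl P (G.tens S V) j := by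
  let φ : S ⊗[Q₂] V →ₗ[S] V := (LinearMap.id : V →ₗ[Q₂] V).liftBaseChange S
  have hφ : ∀ s v, φ (s ⊗ₜ v) = s • v := fun s v => LinearMap.liftBaseChange_tmul _ _ _ _
  refine G.kh_tens_of_retract ys hδ.nodup φ (fun v => ⟨1 ⊗ₜ v, (hφ 1 v).trans (one_smul _ _)⟩)
    (le_antisymm ?_ ?_) ?_ j
  · have key : ∀ x : S ⊗[Q₂] V, x - (1 : S) ⊗ₜ φ x ∈
        (Ideal.span {y | y ∈ ys} • ⊤ : Submodule S (S ⊗[Q₂] V)) := by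
      intro x
      induction x using TensorProduct.induction_on with
      | zero => simp
      | add x y hx hy =>
        rw [map_add, tmul_add, add_sub_add_comm]
        exact add_mem hx hy
      | tmul s v =>
        have h1 := hδ.gen s
        have h2 : s • v = δ s • v := by
          have : ∀ a ∈ Ideal.span {y | y ∈ ys}, a • v = 0 := fun a ha => by
            have : Ideal.span {y | y ∈ ys} ≤ Ideal.torsionOf S V v :=
              Ideal.span_le.2 fun y hy => hV y hy v
            exact this ha
          have := this _ h1
          rwa [sub_smul, sub_eq_zero, algebraMap_smul] at this
        have h3 : s ⊗ₜ[Q₂] v - (1 : S) ⊗ₜ φ (s ⊗ₜ v) =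
            (s - algebraMap Q₂ S (δ s)) • ((1 : S) ⊗ₜ[Q₂] v) := by
          rw [hφ, h2, tmul_smul, smul_tmul', smul_tmul', smul_eq_mul, mul_one, sub_tmul,
            Algebra.algebraMap_eq_smul_one]
        rw [h3]
        exact Submodule.smul_mem_smul h1 trivial
    intro x hx
    have := key x
    rwa [LinearMap.mem_ker.1 hx, tmul_zero, sub_zero] at this
  · rw [Submodule.smul_le]
    intro a ha x _
    have : Ideal.span {y | y ∈ ys} ≤ Ideal.torsionOf S V (φ x) :=
      Ideal.span_le.2 fun y hy => hV y hy _
    rw [LinearMap.mem_ker, map_smul]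
    exact this ha
  · intro z hz
    obtain ⟨r, h1, h2⟩ := hδ.retract z hz
    refine ⟨(r.rTensor V).toAddMonoidHom, fun u => ?_, fun w hw hwz u => ?_⟩
    · change r.rTensor V (z • u) = u
      induction u using TensorProduct.induction_on with
      | zero => simp
      | add x y hx hy => rw [smul_add, map_add, hx, hy]
      | tmul s v => rw [smul_tmul', LinearMap.rTensor_tmul, smul_eq_mul, h1]
    · change r.rTensor V (w • u) = w • r.rTensor V u
      induction u using TensorProduct.induction_on with
      | zero => simp
      | add x y hx hy => rw [smul_add, map_add, map_add, smul_add, hx, hy]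
      | tmul s v =>
        rw [smul_tmul', LinearMap.rTensor_tmul, LinearMap.rTensor_tmul, smul_eq_mul, h2 w hw hwz,
          smul_tmul', smul_eq_mul]

end

section
variable {r q ρ σ τ : ℕ → ℕ∞} (hA : ∀ j, r j = τ (j + 1) + ρ j)
    (hB : ∀ j, q j = ρ j + σ j) (hC : ∀ j, r (j + 2) = σ (j + 1) + τ (j + 1)) (h0 : ∃ K, ∀ j, K ≤ j → r j = 0)
include hA hB hC h0

theorem zero_double {N : ℕ} (hq : ∀ j, N ≤ j → q (j + 1) = 0) (j : ℕ) (hj : N ≤ j) :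
    τ (j + 1) = 0 ∧ r (j + 1) = 0 := by
  obtain ⟨K, hK⟩ := h0
  have hq' : ∀ j, N ≤ j → ρ (j + 1) = 0 ∧ σ (j + 1) = 0 := fun j hj =>
    add_eq_zero.1 ((hB _).symm.trans (hq j hj))
  have e1 : ∀ j, N ≤ j → r (j + 1) = τ (j + 2) := fun j hj => by
    rw [hA, (hq' j hj).1, add_zero]
  have e2 : ∀ j, N ≤ j → r (j + 2) = τ (j + 1) := fun j hj => by
    rw [hC, (hq' j hj).2, zero_add]
  have hτ : ∀ m j, N ≤ j → K ≤ j + 2 * m → τ (j + 1) = 0 := by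
    intro m
    induction m with
    | zero =>
      intro j hj hm
      rw [← e2 j hj, hK _ (by omega)]
    | succ m ih =>
      intro j hj hm
      rw [← e2 j hj, e1 (j + 1) (by omega)]
      exact ih (j + 2) (by omega) (by omega)
  refine ⟨hτ K j hj (by omega), ?_⟩
  rw [e1 j hj]
  exact hτ K (j + 1) (by omega) (by omega)

/-- The numerical step: long exact sequence of the truncated double. -/
theorem chi_double (h1 : r 1 = 0) (hr : ∀ j, r (j + 1) ≠ ⊤) {N : ℕ}
    (hq : ∀ j, N ≤ j → q (j + 1) = 0) : chi N (fun j => q (j + 1)) ≤ 0 := by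
  have fτ : ∀ j, τ (j + 1) ≠ ⊤ := fun j => (WithTop.add_ne_top.1 (hC j ▸ hr (j + 1))).2
  have fσ : ∀ j, σ (j + 1) ≠ ⊤ := fun j => (WithTop.add_ne_top.1 (hC j ▸ hr (j + 1))).1
  have fρ : ∀ j, ρ (j + 1) ≠ ⊤ := fun j => (WithTop.add_ne_top.1 (hA (j + 1) ▸ hr j)).2
  have key : ∀ n, chi n (fun j => q (j + 1)) = ((r 1).toNat : ℤ) - (τ 1).toNat -
      (-1) ^ n * ((r (n + 1)).toNat - (τ (n + 1)).toNat) := by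
    intro n
    induction n with
    | zero => simp [chi]
    | succ n ih =>
      rw [chi, Finset.sum_range_succ, ← chi, ih]
      have a := hA (n + 1)
      have c := hC n
      apply_fun ENat.toNat at a c
      rw [ENat.toNat_add (fτ _) (fρ _)] at a
      rw [ENat.toNat_add (fσ _) (fτ _)] at c
      rw [hB, ENat.toNat_add (fρ _) (fσ _)]
      have a' : ((r (n + 1)).toNat : ℤ) = (τ (n + 2)).toNat + (ρ (n + 1)).toNat := by
        exact_mod_cast a
      have c' : ((r (n + 2)).toNat : ℤ) = (σ (n + 1)).toNat + (τ (n + 1)).toNat := by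
        exact_mod_cast c
      rw [show n + 1 + 1 = n + 2 from rfl, a', c', pow_succ]
      push_cast
      ring
  obtain ⟨h2, h3⟩ := zero_double hA hB hC h0 hq N le_rfl
  rw [key, h1, h2, h3]
  simp

end

/-- Sequences of maps of modules, not necessarily forming a complex. -/
structure PreCx (Q : Type u) [CommRing Q] where
  X : ℕ → Type u
  [grp : ∀ j, AddCommGroup (X j)]
  [mod : ∀ j, Module Q (X j)]
  d : ∀ j, X (j + 1) →ₗ[Q] X j

attribute [instance] PreCx.grp PreCx.mod

namespace PreCx
variable {Q : Type u} [CommRing Q] (A : PreCx Q)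

/-- The differential of the double complex. -/
def doubleD (g : Q) (t : ∀ j, A.X (j + 2) →ₗ[Q] A.X j) (j : ℕ) :
    A.X (j + 2) × A.X (j + 1) →ₗ[Q] A.X (j + 1) × A.X j :=
  ((A.d (j + 1)).coprod (g • LinearMap.id)).prod (-(t j).coprod (A.d j))

/-- The double complex attached to a complex modulo `g`. -/
def double (g : Q) (t : ∀ j, A.X (j + 2) →ₗ[Q] A.X j)
    (ht : ∀ j x, A.d j (A.d (j + 1) x) = g • t j x)
    (hc : ∀ j x, t j (A.d (j + 2) x) = A.d j (t (j + 1) x)) : Cx Q where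
  X j := A.X (j + 1) × A.X j
  d := A.doubleD g t
  dd j := by
    rintro ⟨x, y⟩
    ext
    · simp [doubleD, ht, hc]
    · simp [doubleD, ht, hc]

variable {A} {g : Q} {t : ∀ j, A.X (j + 2) →ₗ[Q] A.X j}
    {ht : ∀ j x, A.d j (A.d (j + 1) x) = g • t j x}
    {hc : ∀ j x, t j (A.d (j + 2) x) = A.d j (t (j + 1) x)}

theorem double_acyclic (hg : ∀ j (x : A.X j), g • x = 0 → x = 0)
    (hex : ∀ j (x : A.X (j + 2)), (∃ y, A.d (j + 1) x = g • y) →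
      ∃ w u, x = A.d (j + 2) w + g • u) : (A.double g t ht hc).Acyclic := by
  rintro j ⟨x, y⟩ h
  have h1 : A.d (j + 1) x + g • y = 0 := congrArg Prod.fst h
  obtain ⟨w, u, rfl⟩ := hex j x ⟨-y, by rw [smul_neg]; exact eq_neg_of_add_eq_zero_left h1⟩
  refine ⟨(w, u), Prod.ext rfl ?_⟩
  change -(t (j + 1) w + A.d (j + 1) u) = y
  rw [map_add, ht, map_smul] at h1
  have := hg _ (t (j + 1) w + A.d (j + 1) u + y) (by rw [smul_add, smul_add, h1])
  rw [neg_eq_iff_add_eq_zero, this]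

section
variable (S : Type u) [CommRing S] [Algebra Q S] (V : Type u) [AddCommGroup V] [Module S V]

theorem atC_smul_zero {C : Type u} [AddCommGroup C] [Module Q C] {C' : Type u} [AddCommGroup C']
    [Module Q C'] (hV : ∀ v : V, algebraMap Q S g • v = 0) (f : C →ₗ[Q] C') (x : BT Q S C V) :
    atC (g • f) V x = 0 := by
  rw [show g • f = (g • LinearMap.id) ∘ₗ f from rfl, atC_comp, atC_smul]
  induction atC f V x using bt_ind with
  | h0 => exact smul_zero _
  | ha x y hx hy => rw [smul_add, hx, hy, add_zero]
  | h1 c u => rw [smul_bt, hV, bt_zero_right]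

/-- A complex modulo `g` tensored with a module killed by `g`. -/
noncomputable def tens (ht : ∀ j x, A.d j (A.d (j + 1) x) = g • t j x)
    (hV : ∀ v : V, algebraMap Q S g • v = 0) : Cx S where
  X j := BT Q S (A.X j) V
  d j := atC (A.d j) V
  dd j x := by
    rw [← atC_comp, show A.d j ∘ₗ A.d (j + 1) = g • t j from LinearMap.ext (ht j)]
    exact atC_smul_zero S V hV _ x

end
end PreCx

namespace Cx
variable {S : Type u} [CommRing S]

/-- The complex with negated differential. -/
def neg (A : Cx S) : Cx S where
  X := A.X
  d j := -A.d j
  dd j x := by simp [A.dd]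

/-- The complex without its last term. -/
def drop (A : Cx S) : Cx S where
  X j := A.X (j + 1)
  d j := A.d (j + 1)
  dd j x := A.dd (j + 1) x

theorem hl_neg (A : Cx S) (P : Ideal S) [P.IsPrime] (j : ℕ) : hl P A.neg j = hl P A j := by
  have h1 : A.neg.D j = A.D j := LinearMap.range_neg _
  have h2 : A.neg.Z j = A.Z j := by
    cases j with
    | zero => rfl
    | succ j =>
      ext x
      exact neg_eq_zero
  exact congrArg₂ (subLam P) h2 h1

end Cx

namespace PreCx
variable {Q : Type u} [CommRing Q] {A : PreCx Q}
variable {g : Q} {t : ∀ j, A.X (j + 2) →ₗ[Q] A.X j}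
    {ht : ∀ j x, A.d j (A.d (j + 1) x) = g • t j x}
    {hc : ∀ j x, t j (A.d (j + 2) x) = A.d j (t (j + 1) x)}

section
variable {S : Type u} [CommRing S] [Algebra Q S] {V : Type u} [AddCommGroup V]
    [Module S V] (hV : ∀ v : V, algebraMap Q S g • v = 0)

theorem atC_inr_inj {C C' : Type u} [AddCommGroup C] [Module Q C] [AddCommGroup C'] [Module Q C'] :
    Function.Injective (atC (S := S) (LinearMap.inr Q C C') V) := by
  refine Function.LeftInverse.injective (g := atC (LinearMap.snd Q C C') V) fun x => ?_
  rw [← atC_comp, LinearMap.snd_comp_inr]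
  exact atC_id x

include hV

theorem atC_double_inr (j : ℕ) (x : BT Q S (A.X (j + 1)) V) :
    atC (LinearMap.inr Q (A.X (j + 1)) (A.X j)) V (-atC (A.d j) V x) =
      atC (A.doubleD g t j) V (atC (LinearMap.inr Q (A.X (j + 2)) (A.X (j + 1))) V x) := by
  rw [map_neg, ← atC_comp, ← sub_eq_zero, neg_sub_left, neg_eq_zero]
  refine Eq.trans ?_ (atC_smul_zero (g := g) S V hV (LinearMap.inl Q (A.X (j + 1)) (A.X j)) x)
  have h : g • LinearMap.inl Q (A.X (j + 1)) (A.X j) =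
      (A.doubleD g t j) ∘ₗ (LinearMap.inr Q (A.X (j + 2)) (A.X (j + 1))) +
        LinearMap.inr Q (A.X (j + 1)) (A.X j) ∘ₗ A.d j := by
    ext x
    · simp [doubleD]
    · simp [doubleD]
  rw [h, ← atC_comp, atC, atC, atC, LinearMap.baseChange_add, LinearMap.rTensor_add]
  rfl

theorem atC_double_fst (j : ℕ) (x : BT Q S (A.X (j + 2) × A.X (j + 1)) V) :
    atC (LinearMap.fst Q (A.X (j + 1)) (A.X j)) V (atC (A.doubleD g t j) V x) =
      atC (A.d (j + 1)) V (atC (LinearMap.fst Q (A.X (j + 2)) (A.X (j + 1))) V x) := by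
  have h : LinearMap.fst Q (A.X (j + 1)) (A.X j) ∘ₗ A.doubleD g t j =
      A.d (j + 1) ∘ₗ LinearMap.fst Q (A.X (j + 2)) (A.X (j + 1)) +
        g • LinearMap.snd Q (A.X (j + 2)) (A.X (j + 1)) := by
    ext x
    · simp [doubleD]
    · simp [doubleD]
  rw [← atC_comp, h, ← atC_comp, ← sub_eq_zero]
  refine Eq.trans ?_ (atC_smul_zero (g := g) S V hV
    (LinearMap.snd Q (A.X (j + 2)) (A.X (j + 1))) x)
  rw [atC, atC, atC, LinearMap.baseChange_add, LinearMap.rTensor_add]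
  exact add_sub_cancel_left _ _

end

noncomputable def doubleSES (S : Type u) [CommRing S] [Algebra Q S] (V : Type u) [AddCommGroup V]
    [Module S V] (hV : ∀ v : V, algebraMap Q S g • v = 0) :
    SES (A.tens S V ht hV).neg ((A.double g t ht hc).tens S V) (A.tens S V ht hV).drop where
  f j := atC (LinearMap.inr Q (A.X (j + 1)) (A.X j)) V
  g j := atC (LinearMap.fst Q (A.X (j + 1)) (A.X j)) V
  f_comm j x := atC_double_inr hV j x
  g_comm j x := atC_double_fst hV j x
  inj _ := atC_inr_inj
  surj _ := atC_surj LinearMap.fst_surjective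
  exact _ := atC_exact Function.Exact.inr_fst LinearMap.fst_surjective

end PreCx

end ExtRigid

namespace ExtRigid
open TensorProduct Cx

namespace Cx
variable {S : Type u} [CommRing S] {B : Cx S}

theorem hl_eq_zero {P : Ideal S} [P.IsPrime] {j : ℕ}
    (h : ∀ x, B.d j x = 0 → ∃ y, B.d (j + 1) y = x) : hl P B (j + 1) = 0 := by
  have : Subsingleton (B.H (j + 1)) := by
    refine Submodule.Quotient.subsingleton_iff.2 (eq_top_iff.2 ?_)
    rintro ⟨x, hx⟩ -
    exact h x hx
  exact lam_of_subsingleton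

theorem acyclic_of_hl (h : ∀ (P : Ideal S) [P.IsPrime] (j : ℕ), hl P B (j + 1) = 0) :
    B.Acyclic := by
  intro j x hx
  have := subsingleton_of_lam (L := B.H (j + 1)) fun P _ => h P j
  rw [Submodule.Quotient.subsingleton_iff] at this
  exact this.ge (Submodule.mem_top (x := (⟨x, hx⟩ : B.Z (j + 1))))

end Cx

namespace Half
variable {Q₁ Q₂ S : Type u} [CommRing Q₁] [IsLocalRing Q₁] [CommRing Q₂] [IsLocalRing Q₂]
    [CommRing S] [IsLocalRing S]
    [Algebra Q₁ S] [Algebra Q₂ S] {π₁ : Q₁} {π₂ : Q₂} (h : Half Q₁ Q₂ S π₁ π₂)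
    (h' : Half Q₂ Q₁ S π₂ π₁)
    [IsNoetherianRing Q₁] [IsNoetherianRing Q₂] [IsNoetherianRing S]
    [IsLocalHom (algebraMap Q₁ S)] [IsLocalHom (algebraMap Q₂ S)]
    [Module.Flat Q₁ S] [Module.Flat Q₂ S]
    {ys : List S} {δ : S → Q₂} (hδ : Diag Q₂ S ys δ)
    {A : PreCx Q₁} [∀ j, Module.Finite Q₁ (A.X j)] [∀ j, Module.Free Q₁ (A.X j)]
    (hbd : ∃ K, ∀ j, K ≤ j → Subsingleton (A.X j))
    {g : Q₁} (hg : ∀ j (x : A.X j), g • x = 0 → x = 0) {t : ∀ j, A.X (j + 2) →ₗ[Q₁] A.X j}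
    (ht : ∀ j x, A.d j (A.d (j + 1) x) = g • t j x)
    (hex : ∀ j (x : A.X (j + 2)), (∃ y, A.d (j + 1) x = g • y) →
      ∃ w u, x = A.d (j + 2) w + g • u)
    (V : Type u) [AddCommGroup V] [Module S V] [Module Q₂ V] [IsScalarTower Q₂ S V]
    [Module.Finite Q₂ V] (hys : ∀ y ∈ ys, ∀ v : V, y • v = 0)
    (hV : ∀ v : V, algebraMap Q₁ S g • v = 0)

include h h' hδ hbd hg hex hys

/-- Vanishing of the first homology forces vanishing of all higher homology. -/
theorem acyclic_of_first (h1 : ∀ x : (A.tens S V ht hV).X 1, (A.tens S V ht hV).d 0 x = 0 →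
    ∃ y, (A.tens S V ht hV).d 1 y = x) : (A.tens S V ht hV).Acyclic := by
  have hc : ∀ j x, t j (A.d (j + 2) x) = A.d j (t (j + 1) x) := fun j x => by
    rw [← sub_eq_zero]
    refine hg j _ ?_
    rw [smul_sub, ← ht, ← map_smul, ← ht, sub_self]
  set B : Cx S := A.tens S V ht hV with hB
  let G : Cx Q₁ := A.double g t ht hc
  have hG : G.Acyclic := PreCx.double_acyclic hg hex
  have : G.Fin := ⟨fun j => inferInstanceAs (Module.Finite Q₁ (A.X (j + 1) × A.X j))⟩
  have : ∀ j, Module.Flat Q₁ (G.X j) :=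
    fun j => by
      have : Module.Free Q₁ (G.X j) := inferInstanceAs (Module.Free Q₁ (A.X (j + 1) × A.X j))
      infer_instance
  have : Module.Finite S V := Module.Finite.of_restrictScalars_finite Q₂ S V
  have : B.Fin := ⟨fun j => inferInstanceAs (Module.Finite S (BT Q₁ S (A.X j) V))⟩
  obtain ⟨m, r, hr⟩ := Module.Finite.exists_fin' Q₂ V
  let i := (LinearMap.ker r).subtype
  have hir : Function.Exact i r := LinearMap.exact_subtype_ker_map r
  have hi : Function.Injective i := Submodule.injective_subtype _
  let p := (LinearMap.range (G.d 0)).mkQ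
  have hp : Function.Surjective p := Submodule.mkQ_surjective _
  have hk : Function.Exact (G.d 0) p := LinearMap.exact_map_mkQ_range _
  have les := fun (P : Ideal S) [P.IsPrime] =>
    (PreCx.doubleSES (A := A) (ht := ht) (hc := hc) S V hV).les P
  have hB1 : ∀ (P : Ideal S) [P.IsPrime], hl P B 1 = 0 :=
    fun P _ => hl_eq_zero h1
  have hBK : ∃ K, ∀ (P : Ideal S) [P.IsPrime] j, K ≤ j → hl P B j = 0 := by
    obtain ⟨K, hK⟩ := hbd
    refine ⟨K, fun P _ j hj => ?_⟩
    have := hK j hj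
    have : Subsingleton (B.X j) := inferInstanceAs (Subsingleton (BT Q₁ S (A.X j) V))
    exact hl_of_subsingleton j
  obtain ⟨K, hBK⟩ := hBK
  have hl0 : ∀ (Q : Ideal S) [Q.IsPrime] j, ∀ y ∈ ys, y ∉ Q → hl Q B (j + 1) = 0 := by
    intro Q _ j y hy hyQ
    refine lam_eq_zero_iff.2 fun x => ⟨y, hyQ, ?_⟩
    obtain ⟨x, rfl⟩ := Submodule.mkQ_surjective _ x
    rw [← map_smul, Submodule.mkQ_apply, Submodule.Quotient.mk_eq_zero]
    refine ⟨0, (map_zero _).trans ?_⟩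
    have key : ∀ z : BT Q₁ S (A.X (j + 1)) V, y • z = 0 := fun z => by
      induction z using bt_ind with
      | h0 => exact smul_zero _
      | ha a b ha hb => rw [smul_add, ha, hb, add_zero]
      | h1 c u => rw [smul_bt, hys y hy, bt_zero_right]
    exact (key x.1).symm
  have main : ∀ (P : Ideal S) (hP : P.IsPrime), (∀ y ∈ ys, y ∈ P) →
      (lam P (beta Q₁ S (G.X 0 ⧸ LinearMap.range (G.d 0)) i) = 0 ∧
        ∀ j, kh P ys (G.tens S (S ⊗[Q₂] V)) (j + 1) = 0) ∧ ∀ j, hl P B (j + 1) = 0 := by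
    intro P hP
    induction P, hP using prime_induction (S := S) with | step P hP ih =>
    intro hyP
    obtain ⟨ρ, σ, τ, h0, eA, eB, eC⟩ := les P
    have eA' : ∀ j, hl P B j = τ (j + 1) + ρ j := fun j => (B.hl_neg P j).symm.trans (eA j)
    have eB' : ∀ j, kh P ys (G.tens S (S ⊗[Q₂] V)) j = ρ j + σ j := fun j =>
      (hδ.kh_tens V hys G P j).trans (eB j)
    have eC' : ∀ j, hl P B (j + 2) = σ (j + 1) + τ (j + 1) := fun j => eC (j + 1)
    have hfin : ∀ j, hl P B (j + 1) ≠ ⊤ := fun j => by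
      rw [hl_eq]
      refine lam_ne_top fun Q hQ hlt => ?_
      by_cases hy : ∀ y ∈ ys, y ∈ Q
      · exact (ih Q hQ hlt hy).2 j
      · push Not at hy
        obtain ⟨y, hy, hyQ⟩ := hy
        exact hl0 Q j y hy hyQ
    have hz := h.kh_step h' hi hr hir hG p hp hk hyP (fun Q hQ hlt hy => (ih Q hQ hlt hy).1)
      (fun _ hq => chi_double eA' eB' eC' ⟨K, hBK P⟩ (hB1 P) hfin fun j hj => hq j (by omega))
    exact ⟨hz, fun j => (zero_double eA' eB' eC' ⟨K, hBK P⟩ (N := 0) (fun j _ => hz.2 j) j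
      (Nat.zero_le _)).2⟩
  refine acyclic_of_hl fun P hP j => ?_
  by_cases hy : ∀ y ∈ ys, y ∈ P
  · exact (main P hP hy).2 j
  · push Not at hy
    obtain ⟨y, hy, hyP⟩ := hy
    exact hl0 P j y hy hyP

end Half
end ExtRigid

namespace ExtRigid

section PowerSeriesIdeals
open MvPowerSeries
variable {σ : Type*} {T : Type*} [CommRing T]

/-- The ideal generated by `I` and the variables. -/
noncomputable def extIdeal (σ : Type*) {T : Type*} [CommRing T] (I : Ideal T) :
    Ideal (MvPowerSeries σ T) :=
  I.map C ⊔ Ideal.span (Set.range X)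

theorem C_mem_extIdeal {I : Ideal T} {a : T} (ha : a ∈ I) : C a ∈ extIdeal σ I :=
  Ideal.mem_sup_left (Ideal.mem_map_of_mem _ ha)

theorem X_mem_extIdeal (I : Ideal T) (i : σ) : X i ∈ extIdeal σ I :=
  Ideal.mem_sup_right (Ideal.subset_span ⟨i, rfl⟩)

theorem monomial_one_mem_pow (d : σ →₀ ℕ) :
    monomial d (1 : T) ∈ (Ideal.span (Set.range X) : Ideal (MvPowerSeries σ T)) ^ d.degree := by
  classical
  induction d using Finsupp.induction_linear with
  | zero => simp
  | add a b ha hb =>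
    have : monomial (a + b) (1 : T) = monomial a 1 * monomial b 1 := by
      rw [monomial_mul_monomial, one_mul]
    rw [this, map_add, pow_add]
    exact Ideal.mul_mem_mul ha hb
  | single i n =>
    rw [Finsupp.degree_single, ← X_pow_eq]
    exact Ideal.pow_mem_pow (Ideal.subset_span (Set.mem_range_self i)) _

theorem mem_pow_span_X [Finite σ] {n : ℕ} {f : MvPowerSeries σ T}
    (hf : ∀ d : σ →₀ ℕ, d.degree < n → coeff d f = 0) :
    f ∈ (Ideal.span (Set.range X) : Ideal (MvPowerSeries σ T)) ^ n := by
  classical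
  have hch : ∀ e : σ →₀ ℕ, n ≤ e.degree → ∃ d ≤ e, d.degree = n := by
    intro e
    induction e using Finsupp.induction_linear generalizing n with
    | zero => exact fun h => ⟨0, le_rfl, by simp at h ⊢; omega⟩
    | add a b ha hb =>
      intro h
      rw [map_add] at h
      by_cases h' : n ≤ a.degree
      · obtain ⟨d, hd, e⟩ := ha (fun _ _ => hf _ (by assumption)) h'
        exact ⟨d, hd.trans (self_le_add_right _ _), e⟩
      · obtain ⟨d, hd, e⟩ := hb (n := n - a.degree) (fun _ _ => hf _ (by omega)) (by omega)
        exact ⟨a + d, by gcongr, by rw [map_add]; omega⟩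
    | single i k =>
      intro h
      rw [Finsupp.degree_single] at h
      exact ⟨Finsupp.single i n, by simpa using h, Finsupp.degree_single _ _⟩
  choose c hc hcn using hch
  have hfin : {d : σ →₀ ℕ | d.degree = n}.Finite := Finsupp.finite_of_degree_le n |>.subset
    fun d hd => le_of_eq hd
  let D := hfin.toFinset
  let g : (σ →₀ ℕ) → MvPowerSeries σ T := fun d e =>
    if h : n ≤ (e + d).degree then if c (e + d) h = d then coeff (e + d) f else 0 else 0
  have : f = ∑ d ∈ D, monomial d 1 * g d := by
    ext e
    rw [map_sum]
    simp_rw [coeff_monomial_mul]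
    by_cases h : n ≤ e.degree
    · rw [Finset.sum_eq_single (c e h)]
      · rw [if_pos (hc e h), one_mul]
        have e1 : e - c e h + c e h = e := tsub_add_cancel_of_le (hc e h)
        change _ = (if h : _ then _ else _)
        simp_rw [e1]
        simp [h]
      · intro d _ hne
        split_ifs with hde
        · have e1 : e - d + d = e := tsub_add_cancel_of_le hde
          rw [one_mul]
          change (if h : _ then _ else _) = _
          simp_rw [e1]
          rw [dif_pos h, if_neg (Ne.symm hne)]
        · rfl
      · intro hn
        exact absurd (by simp [D, hcn]) hn
    · rw [hf e (by omega), Finset.sum_eq_zero]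
      intro d hd
      rw [if_neg]
      intro hde
      have : d.degree = n := by simpa [D] using hd
      have := Finsupp.degree_mono hde
      omega
  rw [this]
  refine sum_mem fun d hd => Ideal.mul_mem_right _ _ ?_
  have : d.degree = n := by simpa [D] using hd
  rw [← this]
  exact monomial_one_mem_pow d

theorem mem_extIdeal_pow [Finite σ] {I : Ideal T} {n : ℕ} {f : MvPowerSeries σ T} :
    f ∈ extIdeal σ I ^ n ↔ ∀ d : σ →₀ ℕ, coeff d f ∈ I ^ (n - d.degree) := by
  classical
  constructor
  · intro h
    have hmul : ∀ a b (f g : MvPowerSeries σ T),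
        (∀ d : σ →₀ ℕ, coeff d f ∈ I ^ (a - d.degree)) →
        (∀ d : σ →₀ ℕ, coeff d g ∈ I ^ (b - d.degree)) →
        ∀ d : σ →₀ ℕ, coeff d (f * g) ∈ I ^ (a + b - d.degree) := by
      intro a b f g hf hg d
      rw [coeff_mul]
      refine sum_mem fun p hp => ?_
      have := Ideal.mul_mem_mul (hf p.1) (hg p.2)
      rw [← pow_add] at this
      refine Ideal.pow_le_pow_right ?_ this
      rw [← Finset.HasAntidiagonal.mem_antidiagonal.1 hp, map_add]
      omega
    have hK : ∀ f ∈ extIdeal σ I, ∀ d : σ →₀ ℕ, coeff d f ∈ I ^ (1 - d.degree) := by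
      let L : Ideal (MvPowerSeries σ T) :=
        { carrier := {f | ∀ d : σ →₀ ℕ, coeff d f ∈ I ^ (1 - d.degree)}
          add_mem' := fun ha hb d => by rw [map_add]; exact add_mem (ha d) (hb d)
          zero_mem' := fun d => by simp
          smul_mem' := fun c f hf d => by
            have := hmul 0 1 c f (fun d => by simp) hf d
            rwa [zero_add] at this }
      have : extIdeal σ I ≤ L := by
        refine sup_le (Ideal.map_le_iff_le_comap.2 fun a ha d => ?_) (Ideal.span_le.2 ?_)
        · rw [coeff_C]
          split_ifs with h
          · simpa [h] using ha
          · exact zero_mem _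
        · rintro _ ⟨i, rfl⟩ d
          rw [coeff_X]
          split_ifs with h
          · simp [h]
          · exact zero_mem _
      exact this
    induction n generalizing f with
    | zero => simp
    | succ n ih =>
      rw [pow_succ] at h
      induction h using Submodule.mul_induction_on' with
      | mem_mul_mem a ha b hb => exact hmul n 1 a b (ih ha) (hK b hb)
      | add a _ b _ ha hb => exact fun d => by rw [map_add]; exact add_mem (ha d) (hb d)
  · intro h
    have hfin : {d : σ →₀ ℕ | d.degree ≤ n}.Finite := Finsupp.finite_of_degree_le n
    let D := hfin.toFinset
    have hX : (Ideal.span (Set.range X) : Ideal (MvPowerSeries σ T)) ≤ extIdeal σ I := le_sup_right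
    have h1 : ∑ d ∈ D, C (coeff d f) * monomial d 1 ∈ extIdeal σ I ^ n := by
      refine sum_mem fun d hd => ?_
      have hd : d.degree ≤ n := by simpa [D] using hd
      have : n = (n - d.degree) + d.degree := by omega
      rw [this, pow_add]
      refine Ideal.mul_mem_mul ?_ (Ideal.pow_right_mono hX _ (monomial_one_mem_pow d))
      refine Ideal.pow_right_mono le_sup_left _ ?_
      rw [← Ideal.map_pow]
      exact Ideal.mem_map_of_mem _ (h d)
    have h2 : f - ∑ d ∈ D, C (coeff d f) * monomial d 1 ∈ extIdeal σ I ^ n := by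
      refine Ideal.pow_right_mono hX _ (mem_pow_span_X fun e he => ?_)
      rw [map_sub, map_sum, Finset.sum_eq_single e]
      · simp [coeff_C_mul]
      · intro d _ hne
        rw [coeff_C_mul, coeff_monomial_ne (Ne.symm hne), mul_zero]
      · intro hn
        exact absurd (by simpa [D] using he.le) hn
    simpa using add_mem h2 h1

instance isAdicComplete_extIdeal [Finite σ] (I : Ideal T) [IsAdicComplete I T] :
    IsAdicComplete (extIdeal σ I) (MvPowerSeries σ T) where
  haus' f hf := by
    ext d
    refine IsHausdorff.haus (inferInstance : IsHausdorff I T) _ fun n => ?_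
    rw [SModEq.zero, smul_eq_mul, Ideal.mul_top]
    have := hf (n + d.degree)
    rw [SModEq.zero, smul_eq_mul, Ideal.mul_top, mem_extIdeal_pow] at this
    simpa using this d
  prec' f hf := by
    have key : ∀ d : σ →₀ ℕ, ∃ L, ∀ n, coeff d (f (n + d.degree)) ≡ L [SMOD I ^ n • (⊤ : Ideal T)] :=
      fun d => IsPrecomplete.prec inferInstance fun {m n} hmn => by
        have := hf (Nat.add_le_add_right hmn d.degree)
        rw [SModEq.sub_mem, smul_eq_mul, Ideal.mul_top] at this ⊢
        rw [mem_extIdeal_pow] at this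
        simpa using this d
    choose L hL using key
    let G : MvPowerSeries σ T := L
    have hG : ∀ d, coeff d G = L d := fun d => rfl
    refine ⟨G, fun n => ?_⟩
    rw [SModEq.sub_mem, smul_eq_mul, Ideal.mul_top, mem_extIdeal_pow]
    intro d
    rw [map_sub, hG]
    by_cases h : d.degree ≤ n
    · have := hL d (n - d.degree)
      rw [SModEq.sub_mem, smul_eq_mul, Ideal.mul_top, Nat.sub_add_cancel h] at this
      exact this
    · rw [Nat.sub_eq_zero_of_le (by omega)]
      simp

theorem algHom_ext_of_X [Finite σ] {V B : Type*} [CommRing V] [CommRing B] [Algebra V B]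
    (J : Ideal B) [IsHausdorff J B] {f g : MvPowerSeries σ V →ₐ[V] B}
    (hf : ∀ i, f (X i) ∈ J) (h : ∀ i, f (X i) = g (X i)) : f = g := by
  ext s
  rw [← sub_eq_zero]
  refine IsHausdorff.haus (inferInstance : IsHausdorff J B) _ fun n => ?_
  rw [SModEq.zero, smul_eq_mul, Ideal.mul_top]
  have h0 : (f : MvPowerSeries σ V →+* B).comp (MvPolynomial.coeToMvPowerSeries.ringHom) =
      (g : MvPowerSeries σ V →+* B).comp (MvPolynomial.coeToMvPowerSeries.ringHom) := by
    refine MvPolynomial.ringHom_ext (fun r => ?_) fun i => ?_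
    · have : ((MvPolynomial.C r : MvPolynomial σ V) : MvPowerSeries σ V) = algebraMap V _ r := by
        simp; rfl
      simp only [RingHom.comp_apply, MvPolynomial.coeToMvPowerSeries.ringHom_apply, this,
        RingHom.coe_coe, AlgHom.commutes]
    · simpa using h i
  have h1 : ∀ φ : MvPowerSeries σ V →ₐ[V] B, (∀ i, φ (X i) ∈ J) →
      φ (s - (truncTotal n s : MvPolynomial σ V)) ∈ J ^ n := by
    intro φ hφ
    have : (Ideal.span (Set.range X) : Ideal (MvPowerSeries σ V)) ≤ J.comap φ :=
      Ideal.span_le.2 (by rintro _ ⟨i, rfl⟩; exact hφ i)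
    refine (Ideal.pow_right_mono this n).trans (Ideal.le_comap_pow _ _) (mem_pow_span_X ?_)
    intro d hd
    rw [map_sub, MvPolynomial.coeff_coe, coeff_truncTotal _ hd, sub_self]
  have h2 := DFunLike.congr_fun h0 (truncTotal n s)
  simp only [RingHom.comp_apply, MvPolynomial.coeToMvPowerSeries.ringHom_apply,
    RingHom.coe_coe] at h2
  have := sub_mem (h1 f hf) (h1 g fun i => h i ▸ hf i)
  rwa [map_sub, map_sub, h2, sub_sub_sub_cancel_right] at this

theorem exists_algHom_X [Finite σ] {V B : Type*} [CommRing V] [CommRing B] [Algebra V B]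
    (J : Ideal B) [IsAdicComplete J B] (a : σ → B) (ha : ∀ i, a i ∈ J) :
    ∃ f : MvPowerSeries σ V →ₐ[V] B, ∀ i, f (X i) = a i := by
  have hv : ∀ n, ∀ p ∈ MvPolynomial.idealOfVars σ V ^ n,
      ((Ideal.Quotient.mkₐ V (J ^ n)).comp (MvPolynomial.aeval a)) p = 0 := by
    intro n p hp
    have : MvPolynomial.idealOfVars σ V ≤ J.comap (MvPolynomial.aeval (R := V) a) :=
      Ideal.span_le.2 (by rintro _ ⟨i, rfl⟩; simpa using ha i)
    exact Ideal.Quotient.eq_zero_iff_mem.2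
      ((Ideal.pow_right_mono this n).trans (Ideal.le_comap_pow _ _) hp)
  let F : ∀ n, MvPowerSeries σ V →ₐ[V] B ⧸ J ^ n := fun n =>
    (Ideal.Quotient.liftₐ _ ((Ideal.Quotient.mkₐ V (J ^ n)).comp (MvPolynomial.aeval a))
      (hv n)).comp ((truncTotalAlgHom σ V n).restrictScalars V)
  have hF : ∀ n s, F n s = Ideal.Quotient.mk (J ^ n) (MvPolynomial.aeval a (truncTotal n s)) :=
    fun n s => rfl
  have hcomp : ∀ {m n : ℕ} (hle : m ≤ n),
      (Ideal.Quotient.factorₐ V (Ideal.pow_le_pow_right hle)).comp (F n) = F m := by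
    intro m n hle
    ext s
    change Ideal.Quotient.mk (J ^ m) (MvPolynomial.aeval a (truncTotal n s)) =
      Ideal.Quotient.mk (J ^ m) (MvPolynomial.aeval a (truncTotal m s))
    rw [← sub_eq_zero, ← map_sub, ← map_sub]
    exact hv m _ (truncTotal_sub_truncTotal_mem_pow_idealOfVars hle le_rfl s)
  refine ⟨IsAdicComplete.liftAlgHom J F hcomp, fun i => ?_⟩
  rw [← sub_eq_zero]
  refine IsHausdorff.haus (inferInstance : IsHausdorff J B) _ fun n => ?_
  rw [SModEq.zero, smul_eq_mul, Ideal.mul_top]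
  refine Ideal.pow_le_pow_right (by omega : n ≤ n + 2) ?_
  rw [← Ideal.Quotient.eq_zero_iff_mem, map_sub]
  have := IsAdicComplete.mk_liftAlgHom J F hcomp (n + 2) (X i)
  rw [this, hF, ← MvPolynomial.coe_X, truncTotal_coe_eq_self_iff _ (by omega) |>.2, MvPolynomial.aeval_X,
    sub_self]
  refine (MvPolynomial.totalDegree_monomial_le (Finsupp.single i 1) (1 : V)).trans_lt ?_
  simp

end PowerSeriesIdeals
end ExtRigid

namespace ExtRigid

/-- Products of copies of a Noetherian ring are flat. -/
theorem flat_pi (Q : Type*) [CommRing Q] [IsNoetherianRing Q] (ι : Type*) :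
    Module.Flat Q (ι → Q) := by
  rw [Module.Flat.iff_forall_isTrivialRelation]
  intro l f x hx
  let N : Submodule Q (Fin l → Q) := LinearMap.ker (Fintype.linearCombination Q f)
  have hN : ∀ a, a ∈ N ↔ ∑ i, f i * a i = 0 := fun a => by
    rw [LinearMap.mem_ker, Fintype.linearCombination_apply]
    simp [mul_comm]
  obtain ⟨k, a, ha⟩ := Submodule.fg_iff_exists_fin_generating_family.1 (IsNoetherian.noetherian N)
  have hxN : ∀ s, (fun i => x i s) ∈ Submodule.span Q (Set.range a) := fun s => by
    rw [ha, hN]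
    simpa using congrFun hx s
  simp_rw [Submodule.mem_span_range_iff_exists_fun] at hxN
  choose c hc using hxN
  refine ⟨k, fun i j => a j i, fun j s => c s j, fun i => ?_, fun j => ?_⟩
  · funext s
    have := congrFun (hc s) i
    simp only [Finset.sum_apply, Pi.smul_apply, smul_eq_mul] at this ⊢
    rw [← this]
    exact Finset.sum_congr rfl fun j _ => mul_comm _ _
  · exact (hN _).1 (ha ▸ Submodule.subset_span ⟨j, rfl⟩)

section
open MvPowerSeries

theorem exists_ringHom_X {σ : Type*} [Finite σ] {V B : Type*} [CommRing V] [CommRing B]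
    (φ : V →+* B) (J : Ideal B) [IsAdicComplete J B] (a : σ → B) (ha : ∀ i, a i ∈ J) :
    ∃ f : MvPowerSeries σ V →+* B, f.comp C = φ ∧ ∀ i, f (X i) = a i := by
  let _ := φ.toAlgebra
  obtain ⟨f, hf⟩ := exists_algHom_X (V := V) J a ha
  exact ⟨f, RingHom.ext fun v => f.commutes v, hf⟩

theorem ringHom_ext_of_X {σ : Type*} [Finite σ] {V B : Type*} [CommRing V] [CommRing B]
    (J : Ideal B) [IsHausdorff J B] {f g : MvPowerSeries σ V →+* B} (hC : f.comp C = g.comp C)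
    (hf : ∀ i, f (X i) ∈ J) (h : ∀ i, f (X i) = g (X i)) : f = g := by
  let _ := (f.comp C).toAlgebra
  let f' : MvPowerSeries σ V →ₐ[V] B := { f with commutes' := fun v => rfl }
  let g' : MvPowerSeries σ V →ₐ[V] B :=
    { g with commutes' := fun v => (RingHom.congr_fun hC v).symm }
  have : f' = g' := algHom_ext_of_X J hf h
  exact RingHom.ext fun s => DFunLike.congr_fun this s

theorem sub_C_constantCoeff_mem {σ T : Type*} [Finite σ] [CommRing T] (s : MvPowerSeries σ T) :
    s - C (constantCoeff s) ∈ (Ideal.span (Set.range X) : Ideal (MvPowerSeries σ T)) := by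
  have := mem_pow_span_X (n := 1) (f := s - C (constantCoeff s)) fun d hd => by
    have : d = 0 := (Finsupp.degree_eq_zero_iff d).1 (by omega)
    subst this
    simp
  rwa [pow_one] at this

theorem maximalIdeal_mvPowerSeries {σ T : Type*} [Finite σ] [CommRing T] [IsLocalRing T] :
    maximalIdeal (MvPowerSeries σ T) = extIdeal σ (maximalIdeal T) := by
  refine le_antisymm (fun s hs => ?_) (sup_le (Ideal.map_le_iff_le_comap.2 fun a ha => ?_)
    (Ideal.span_le.2 ?_))
  · have : constantCoeff s ∈ maximalIdeal T := by
      rw [mem_maximalIdeal, mem_nonunits_iff, ← isUnit_iff_constantCoeff]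
      exact hs
    rw [← sub_add_cancel s (C (constantCoeff s))]
    exact add_mem (Ideal.mem_sup_right (sub_C_constantCoeff_mem s)) (C_mem_extIdeal this)
  · rw [Ideal.mem_comap, mem_maximalIdeal, mem_nonunits_iff, isUnit_iff_constantCoeff]
    simpa using ha
  · rintro _ ⟨i, rfl⟩
    rw [SetLike.mem_coe, mem_maximalIdeal, mem_nonunits_iff, isUnit_iff_constantCoeff]
    simp

/-- `Q` behaves like a power series ring in the variables `x` over a complete ring `V` with
maximal ideal generated by the nonzerodivisor `π`. -/
structure PSData {σ : Type} {V Q : Type u} [CommRing V] [CommRing Q] [IsLocalRing Q]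
    (φ : V →+* Q) (π : V) (x : σ → Q) : Prop where
  maximal : maximalIdeal Q = Ideal.span {φ π} ⊔ Ideal.span (Set.range x)
  complete : IsAdicComplete (maximalIdeal Q) Q
  lift : ∀ (B : Type u) [CommRing B] (ψ : V →+* B) (J : Ideal B) [IsAdicComplete J B] (a : σ → B),
    (∀ i, a i ∈ J) → ∃ f : Q →+* B, f.comp φ = ψ ∧ ∀ i, f (x i) = a i
  ext : ∀ (B : Type u) [CommRing B] (J : Ideal B) [IsHausdorff J B] (f g : Q →+* B),
    f.comp φ = g.comp φ → (∀ i, f (x i) ∈ J) → (∀ i, f (x i) = g (x i)) → f = g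
  reg : ∀ q, φ π * q = 0 → q = 0

theorem psData_mvPowerSeries {σ : Type} [Finite σ] {V : Type u} [CommRing V] [IsLocalRing V]
    {π : V} (hπ : maximalIdeal V = Ideal.span {π}) (hreg : ∀ v, π * v = 0 → v = 0)
    [IsAdicComplete (maximalIdeal V) V] :
    PSData (C : V →+* MvPowerSeries σ V) π X where
  maximal := by
    rw [maximalIdeal_mvPowerSeries, extIdeal, hπ, Ideal.map_span, Set.image_singleton]
  complete := by
    rw [maximalIdeal_mvPowerSeries]
    infer_instance
  lift B _ ψ J _ a ha := exists_ringHom_X ψ J a ha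
  ext B _ J _ f g hC hf h := ringHom_ext_of_X J hC hf h
  reg q hq := by
    ext d
    have := congrArg (coeff d) hq
    rw [coeff_C_mul, map_zero] at this
    rw [hreg _ this, map_zero]

variable {σ : Type} [Fintype σ] {V Q : Type u} [CommRing V] [CommRing Q] [IsLocalRing Q]
  {φ : V →+* Q} {π : V} {x : σ → Q}

theorem isAdicComplete_maximalIdeal_mvPowerSeries {T : Type*} [CommRing T] [IsLocalRing T]
    [IsAdicComplete (maximalIdeal T) T] :
    IsAdicComplete (maximalIdeal (MvPowerSeries σ T)) (MvPowerSeries σ T) := by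
  rw [maximalIdeal_mvPowerSeries]
  infer_instance

theorem C_mem_maximalIdeal {T : Type*} [CommRing T] [IsLocalRing T] {a : T}
    (ha : a ∈ maximalIdeal T) : (C a : MvPowerSeries σ T) ∈ maximalIdeal _ := by
  rw [maximalIdeal_mvPowerSeries]
  exact C_mem_extIdeal ha

theorem X_mem_maximalIdeal {T : Type*} [CommRing T] [IsLocalRing T] (i : σ) :
    (X i : MvPowerSeries σ T) ∈ maximalIdeal _ := by
  rw [maximalIdeal_mvPowerSeries]
  exact X_mem_extIdeal _ _

/-- The involution of `Q[[Y]]` exchanging the two embeddings of `Q`. -/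
theorem PSData.exists_involution (h : PSData φ π x) :
    ∃ Φ : MvPowerSeries σ Q →+* MvPowerSeries σ Q, (∀ s, Φ (Φ s) = s) ∧
      (∀ v, Φ (C (φ v)) = C (φ v)) ∧ (∀ i, Φ (X i) = - X i) ∧
      ∀ i, Φ (C (x i)) = C (x i) + X i := by
  have := h.complete
  have := isAdicComplete_maximalIdeal_mvPowerSeries (σ := σ) (T := Q)
  have hx : ∀ i, x i ∈ maximalIdeal Q := fun i => by
    rw [h.maximal]
    exact Ideal.mem_sup_right (Ideal.subset_span ⟨i, rfl⟩)
  obtain ⟨ι, hι, hιx⟩ := h.lift (MvPowerSeries σ Q) ((C : Q →+* _).comp φ) (maximalIdeal _)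
    (fun i => C (x i) + X i) fun i => add_mem (C_mem_maximalIdeal (hx i)) (X_mem_maximalIdeal i)
  obtain ⟨Φ, hΦ, hΦX⟩ := exists_ringHom_X ι (maximalIdeal (MvPowerSeries σ Q)) (fun i => - X i)
    fun i => neg_mem (X_mem_maximalIdeal i)
  have hΦC : ∀ q, Φ (C q) = ι q := fun q => RingHom.congr_fun hΦ q
  have hιφ : ∀ v, ι (φ v) = C (φ v) := fun q => RingHom.congr_fun hι q
  have h1 : Φ.comp ι = C := by
    refine h.ext _ (maximalIdeal _) _ _ ?_ (fun i => ?_) fun i => ?_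
    · exact RingHom.ext fun v => by simp [hιφ, hΦC]
    · simp only [RingHom.comp_apply, hιx, map_add, hΦC, hΦX, add_neg_cancel_right]
      exact C_mem_maximalIdeal (hx i)
    · simp only [RingHom.comp_apply, hιx, map_add, hΦC, hΦX, add_neg_cancel_right]
  refine ⟨Φ, fun s => ?_, fun v => by rw [hΦC, hιφ], hΦX, fun i => by rw [hΦC, hιx]⟩
  have : Φ.comp Φ = RingHom.id _ := by
    refine ringHom_ext_of_X (maximalIdeal _) ?_ (fun i => ?_) fun i => ?_
    · rw [RingHom.comp_assoc, hΦ, h1, RingHom.id_comp]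
    · simp only [RingHom.comp_apply, hΦX, map_neg, neg_neg]
      exact X_mem_maximalIdeal i
    · simp only [RingHom.comp_apply, hΦX, map_neg, neg_neg, RingHom.id_apply]
  exact RingHom.congr_fun this s

theorem PSData.exists_retract (h : PSData φ π x) :
    ∃ ε : MvPowerSeries σ Q →+* Q, (∀ q, ε (C q) = q) ∧ ∀ i, ε (X i) = - x i := by
  have := h.complete
  obtain ⟨f, h1, h2⟩ := exists_ringHom_X (RingHom.id Q) (maximalIdeal Q) (fun i => - x i)
    fun i => by
      rw [h.maximal]
      exact neg_mem (Ideal.mem_sup_right (Ideal.subset_span ⟨i, rfl⟩))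
  exact ⟨f, fun q => RingHom.congr_fun h1 q, h2⟩

theorem PSData.sub_C_mem (h : PSData φ π x) (s : MvPowerSeries σ Q) :
    ∃ q, s - C q ∈ Ideal.span (Set.range fun i => (C (x i) + X i : MvPowerSeries σ Q)) := by
  have := h.complete
  have := isAdicComplete_maximalIdeal_mvPowerSeries (σ := σ) (T := Q)
  have hx : ∀ i, x i ∈ maximalIdeal Q := fun i => by
    rw [h.maximal]
    exact Ideal.mem_sup_right (Ideal.subset_span ⟨i, rfl⟩)
  obtain ⟨ψ, hψ, hψX⟩ := exists_ringHom_X (C : Q →+* _) (maximalIdeal (MvPowerSeries σ Q))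
    (fun i => C (x i) + X i) fun i => add_mem (C_mem_maximalIdeal (hx i)) (X_mem_maximalIdeal i)
  obtain ⟨χ, hχ, hχX⟩ := exists_ringHom_X (C : Q →+* _) (maximalIdeal (MvPowerSeries σ Q))
    (fun i => X i - C (x i)) fun i => sub_mem (X_mem_maximalIdeal i) (C_mem_maximalIdeal (hx i))
  have hψC : ∀ q, ψ (C q) = C q := fun q => RingHom.congr_fun hψ q
  have hc : ψ.comp χ = RingHom.id _ := by
    refine ringHom_ext_of_X (maximalIdeal _) ?_ (fun i => ?_) fun i => ?_
    · rw [RingHom.comp_assoc, hχ, hψ, RingHom.id_comp]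
    · simp only [RingHom.comp_apply, hχX, map_sub, hψC, hψX, add_sub_cancel_left]
      exact X_mem_maximalIdeal i
    · simp only [RingHom.comp_apply, hχX, map_sub, hψC, hψX, add_sub_cancel_left,
        RingHom.id_apply]
  refine ⟨constantCoeff (χ s), ?_⟩
  have h1 := Ideal.mem_map_of_mem ψ (sub_C_constantCoeff_mem (χ s))
  rw [map_sub, hψC, ← RingHom.comp_apply, hc, RingHom.id_apply, Ideal.map_span,
    ← Set.range_comp] at h1
  convert h1 using 3
  funext i
  exact (hψX i).symm

/-- The coefficient shift is a retraction of multiplication by a variable. -/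
noncomputable def shift (Q : Type u) [CommRing Q] (i : σ) :
    MvPowerSeries σ Q →ₗ[Q] MvPowerSeries σ Q where
  toFun f := fun d => coeff (d + Finsupp.single i 1) f
  map_add' _ _ := rfl
  map_smul' _ _ := rfl

omit [Fintype σ] [IsLocalRing Q] in
theorem coeff_shift (i : σ) (d : σ →₀ ℕ) (f : MvPowerSeries σ Q) :
    coeff d (shift Q i f) = coeff (d + Finsupp.single i 1) f := rfl

theorem diag_mvPowerSeries :
    Diag Q (MvPowerSeries σ Q) ((Finset.univ : Finset σ).toList.map X) (constantCoeff ·) where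
  nodup := (Finset.nodup_toList _).map fun i j h => X_inj.1 h
  gen s := by
    have : {y : MvPowerSeries σ Q | y ∈ (Finset.univ : Finset σ).toList.map X} = Set.range X := by
      ext y
      simp
    rw [this]
    exact sub_C_constantCoeff_mem s
  retract z hz := by
    classical
    obtain ⟨i, -, rfl⟩ := List.mem_map.1 hz
    refine ⟨shift Q i, fun s => ?_, fun w hw hne s => ?_⟩
    · ext d
      rw [coeff_shift, X, coeff_monomial_mul, if_pos le_add_self, add_tsub_cancel_right, one_mul]
    · obtain ⟨j, -, rfl⟩ := List.mem_map.1 hw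
      have hij : j ≠ i := fun h => hne (h ▸ rfl)
      ext d
      rw [coeff_shift, X, coeff_monomial_mul, coeff_monomial_mul]
      have : Finsupp.single j 1 ≤ d + Finsupp.single i 1 ↔ Finsupp.single j 1 ≤ d := by
        rw [Finsupp.single_le_iff, Finsupp.single_le_iff, Finsupp.add_apply,
          Finsupp.single_eq_of_ne hij, add_zero]
      by_cases hd : Finsupp.single j 1 ≤ d
      · rw [if_pos hd, if_pos (this.2 hd), coeff_shift, tsub_add_eq_add_tsub hd]
      · rw [if_neg hd, if_neg fun h => hd (this.1 h)]

end
end ExtRigid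

namespace ExtRigid
open TensorProduct

/-- The action of a matrix over `A` on columns with entries in an `A`-module. -/
def mact {m n A V : Type*} [Fintype n] [CommRing A] [AddCommGroup V] [Module A V]
    (M : Matrix m n A) : (n → V) →ₗ[A] (m → V) where
  toFun v i := ∑ l, M i l • v l
  map_add' v w := by
    funext i
    simp [smul_add, Finset.sum_add_distrib]
  map_smul' a v := by
    funext i
    simp [Finset.smul_sum, smul_comm a]

theorem mact_apply {m n A V : Type*} [Fintype n] [CommRing A] [AddCommGroup V] [Module A V]
    (M : Matrix m n A) (v : n → V) (i : m) : mact M v i = ∑ l, M i l • v l := rfl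

theorem mact_mul {m n p A V : Type*} [Fintype n] [Fintype p] [CommRing A] [AddCommGroup V]
    [Module A V] (M : Matrix m n A) (N : Matrix n p A) (v : p → V) :
    mact (M * N) v = mact M (mact N v) := by
  funext i
  simp only [mact_apply, Matrix.mul_apply, Finset.sum_smul, Finset.smul_sum, mul_smul]
  exact Finset.sum_comm

section
variable {Q S : Type u} [CommRing Q] [CommRing S] [Algebra Q S] {V : Type u} [AddCommGroup V]
  [Module S V] [Module Q V] [IsScalarTower Q S V]

/-- The comparison of columns over `V` with the tensor product. -/
noncomputable def colBT (Q : Type u) {S V : Type u} [CommRing Q] [CommRing S] [Algebra Q S]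
    [AddCommGroup V] [Module S V] {k : ℕ} (v : Fin k → V) : BT Q S (Fin k → Q) V :=
  ∑ l, bt Q ((1 : S) ⊗ₜ[Q] (Pi.single l 1 : Fin k → Q)) (v l)

/-- The inverse comparison, on coordinates. -/
noncomputable def btCol (Q : Type u) (S V : Type u) [CommRing Q] [CommRing S] [Algebra Q S]
    [AddCommGroup V] [Module S V] {k : ℕ} (i : Fin k) : BT Q S (Fin k → Q) V →ₗ[S] V :=
  (TensorProduct.lid S V).toLinearMap ∘ₗ
    ((Algebra.linearMap Q S ∘ₗ (LinearMap.proj i : (Fin k → Q) →ₗ[Q] Q)).liftBaseChange S).rTensor V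

theorem btCol_bt {k : ℕ} (i : Fin k) (c : Fin k → Q) (v : V) :
    btCol Q S V i (bt Q ((1 : S) ⊗ₜ[Q] c) v) = c i • v := by
  have : btCol Q S V i (bt Q ((1 : S) ⊗ₜ[Q] c) v) =
      ((1 : S) • algebraMap Q S (c i)) • v := rfl
  rw [this, one_smul, algebraMap_smul]

theorem btCol_colBT {k : ℕ} (v : Fin k → V) (i : Fin k) : btCol Q S V i (colBT Q (S := S) v) = v i := by
  rw [colBT, map_sum, Finset.sum_eq_single i]
  · rw [btCol_bt, Pi.single_eq_same, one_smul]
  · intro l _ h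
    rw [btCol_bt, Pi.single_eq_of_ne (Ne.symm h), zero_smul]
  · simp

theorem bt_eq_colBT {k : ℕ} (c : Fin k → Q) (v : V) :
    bt Q ((1 : S) ⊗ₜ[Q] c) v = colBT Q (S := S) fun i => c i • v := by
  have hc : c = ∑ l, c l • (Pi.single l 1 : Fin k → Q) := by
    funext i
    simp [Finset.sum_apply, Pi.single_apply]
  have hadd : ∀ s : Finset (Fin k), bt Q ((1 : S) ⊗ₜ[Q] (∑ l ∈ s, c l • (Pi.single l 1 : Fin k → Q))) v =
      ∑ l ∈ s, bt Q ((1 : S) ⊗ₜ[Q] (Pi.single l 1 : Fin k → Q)) (c l • v) := by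
    intro s
    induction s using Finset.cons_induction with
    | empty => 
      rw [Finset.sum_empty, Finset.sum_empty, tmul_zero]
      exact zero_tmul _ _
    | cons a s ha ih =>
      rw [Finset.sum_cons, Finset.sum_cons, tmul_add, bt_add_left, ih, ← bt_algebraMap_smul,
        algebraMap_smul]
  conv_lhs => rw [hc]
  exact hadd Finset.univ

theorem colBT_add {k : ℕ} (v w : Fin k → V) :
    colBT Q (S := S) (v + w) = colBT Q v + colBT Q w := by
  simp only [colBT, Pi.add_apply, bt_add_right, Finset.sum_add_distrib]

theorem colBT_zero {k : ℕ} : colBT Q (S := S) (0 : Fin k → V) = 0 := by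
  have := colBT_add (Q := Q) (S := S) (0 : Fin k → V) 0
  rwa [add_zero, left_eq_add] at this

theorem colBT_surjective {k : ℕ} (x : BT Q S (Fin k → Q) V) : ∃ v, colBT Q v = x := by
  induction x using bt_ind with
  | h0 => exact ⟨0, colBT_zero⟩
  | ha x y hx hy =>
    obtain ⟨v, rfl⟩ := hx
    obtain ⟨w, rfl⟩ := hy
    exact ⟨v + w, colBT_add v w⟩
  | h1 c u => exact ⟨_, (bt_eq_colBT c u).symm⟩

theorem colBT_eq_zero {k : ℕ} {v : Fin k → V} (h : colBT Q (S := S) v = 0) : v = 0 := by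
  funext i
  rw [← btCol_colBT (Q := Q) (S := S) v i, h, map_zero]
  rfl

theorem colBT_injective {k : ℕ} {v w : Fin k → V} (h : colBT Q (S := S) v = colBT Q w) : v = w := by
  funext i
  rw [← btCol_colBT (Q := Q) (S := S) v i, h, btCol_colBT]

theorem atC_colBT {k l : ℕ} (M : Matrix (Fin k) (Fin l) Q) (v : Fin l → V) :
    atC (mact M) V (colBT Q (S := S) v) = colBT Q (mact M v) := by
  have hsum : ∀ s : Finset (Fin l), ∑ j ∈ s, colBT Q (S := S) (fun i => M i j • v j) =
      colBT Q (fun i => ∑ j ∈ s, M i j • v j) := by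
    intro s
    induction s using Finset.cons_induction with
    | empty =>
      simp only [Finset.sum_empty]
      exact colBT_zero.symm
    | cons a s ha ih =>
      simp only [Finset.sum_cons]
      rw [ih, ← colBT_add]
      rfl
  rw [colBT, map_sum]
  refine Eq.trans (Finset.sum_congr rfl fun j _ => ?_) (hsum Finset.univ)
  rw [atC_bt, LinearMap.baseChange_tmul, bt_eq_colBT]
  congr 1
  funext i
  rw [mact_apply, Finset.sum_eq_single j]
  · simp
  · intro b _ h
    simp [h]
  · simp

end

section
variable {Q₁ Q₂ S : Type u} [CommRing Q₁] [IsLocalRing Q₁] [CommRing Q₂] [IsLocalRing Q₂]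
  [CommRing S] [IsLocalRing S] [Algebra Q₁ S] [Algebra Q₂ S] {π₁ : Q₁} {π₂ : Q₂}
  [IsNoetherianRing Q₁] [IsNoetherianRing Q₂] [IsNoetherianRing S] [IsLocalHom (algebraMap Q₁ S)]
  [IsLocalHom (algebraMap Q₂ S)] [Module.Flat Q₁ S] [Module.Flat Q₂ S] {ys : List S} {δ : S → Q₂}

theorem Half.acyclic_matrix (h : Half Q₁ Q₂ S π₁ π₂) (h' : Half Q₂ Q₁ S π₂ π₁)
    (hδ : Diag Q₂ S ys δ) {g : Q₁} (hg : ∀ q, g * q = 0 → q = 0) (k : ℕ → ℕ)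
    (hk : ∃ K, ∀ j, K ≤ j → k j = 0) (M : ∀ j, Matrix (Fin (k j)) (Fin (k (j + 1))) Q₁)
    (hMM : ∀ j i l, g ∣ (M j * M (j + 1)) i l)
    (hex : ∀ j (x : Fin (k (j + 2)) → Q₁), (∀ i, g ∣ mact (M (j + 1)) x i) →
      ∃ w : Fin (k (j + 3)) → Q₁, ∀ i, g ∣ x i - mact (M (j + 2)) w i)
    (V : Type u) [AddCommGroup V] [Module S V] [Module Q₁ V] [IsScalarTower Q₁ S V] [Module Q₂ V]
    [IsScalarTower Q₂ S V] [Module.Finite Q₂ V] (hys : ∀ y ∈ ys, ∀ v : V, y • v = 0)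
    (hV : ∀ v : V, g • v = 0)
    (h1 : ∀ v : Fin (k 1) → V, mact (M 0) v = 0 → ∃ w, mact (M 1) w = v) :
    ∀ j (v : Fin (k (j + 1)) → V), mact (M j) v = 0 → ∃ w, mact (M (j + 1)) w = v := by
  let A : PreCx Q₁ := { X := fun j => Fin (k j) → Q₁, d := fun j => mact (M j) }
  choose T hT using hMM
  let t : ∀ j, A.X (j + 2) →ₗ[Q₁] A.X j := fun j => mact (V := Q₁) (Matrix.of (T j))
  have ht : ∀ j (x : A.X (j + 1 + 1)), A.d j (A.d (j + 1) x) = g • t j x := by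
    intro j (x : Fin (k (j + 2)) → Q₁)
    change mact (M j) (mact (M (j + 1)) x) = g • mact (V := Q₁) (Matrix.of (T j)) x
    rw [← mact_mul]
    funext i
    rw [mact_apply, Pi.smul_apply, mact_apply, Finset.smul_sum]
    refine Finset.sum_congr rfl fun l _ => ?_
    rw [hT, Matrix.of_apply, mul_smul]
  have hV' : ∀ v : V, algebraMap Q₁ S g • v = 0 := fun v => by rw [algebraMap_smul, hV]
  have : ∀ j, Module.Finite Q₁ (A.X j) :=
    fun j => inferInstanceAs (Module.Finite Q₁ (Fin (k j) → Q₁))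
  have : ∀ j, Module.Free Q₁ (A.X j) :=
    fun j => inferInstanceAs (Module.Free Q₁ (Fin (k j) → Q₁))
  have key := h.acyclic_of_first h' hδ (A := A) ?_ (g := g) ?_ ht ?_ V hys hV' ?_
  · intro j v hv
    obtain ⟨y, hy⟩ := key j (colBT Q₁ v) ((atC_colBT (M j) v).trans (by rw [hv, colBT_zero]; rfl))
    obtain ⟨w, rfl⟩ := colBT_surjective (Q := Q₁) (S := S) (k := k (j + 2)) y
    exact ⟨w, colBT_injective (Q := Q₁) (S := S) ((atC_colBT (M (j + 1)) w).symm.trans hy)⟩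
  · obtain ⟨K, hK⟩ := hk
    refine ⟨K, fun j hj => ?_⟩
    have : IsEmpty (Fin (k j)) := by
      rw [hK j hj]
      infer_instance
    exact inferInstanceAs (Subsingleton (Fin (k j) → Q₁))
  · intro j (x : Fin (k j) → Q₁) hx
    funext i
    exact hg _ (congrFun hx i)
  · rintro j (x : Fin (k (j + 2)) → Q₁) ⟨y, hy⟩
    obtain ⟨w, hw⟩ := hex j x fun i => ⟨_, congrFun hy i⟩
    choose u hu using hw
    refine ⟨w, u, ?_⟩
    funext i
    exact (eq_add_of_sub_eq' (hu i))
  · intro x hx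
    obtain ⟨v, rfl⟩ := colBT_surjective (Q := Q₁) (S := S) (k := k 1) x
    obtain ⟨w, hw⟩ := h1 v (colBT_eq_zero (Q := Q₁) (S := S) ((atC_colBT (M 0) v).symm.trans hx))
    exact ⟨colBT Q₁ w, (atC_colBT (M 1) w).trans (congrArg _ hw)⟩

end

/-- A copy of a type. -/
def Syn (Q : Type u) : Type u := Q

instance (Q : Type u) [CommRing Q] : CommRing (Syn Q) := inferInstanceAs (CommRing Q)

instance (Q : Type u) [CommRing Q] [IsLocalRing Q] : IsLocalRing (Syn Q) :=
  inferInstanceAs (IsLocalRing Q)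

instance (Q : Type u) [CommRing Q] [IsNoetherianRing Q] : IsNoetherianRing (Syn Q) :=
  inferInstanceAs (IsNoetherianRing Q)

section
open MvPowerSeries
variable {σ : Type} [Fintype σ] {V Q : Type u} [CommRing V] [CommRing Q] [IsLocalRing Q]
  [IsNoetherianRing Q] {φ : V →+* Q} {π : V} {x : σ → Q}

theorem flat_C : (C : Q →+* MvPowerSeries σ Q).Flat := by
  have : Module.Flat Q (MvPowerSeries σ Q) := flat_pi Q (σ →₀ ℕ)
  exact RingHom.flat_algebraMap_iff.2 this

theorem PSData.acyclic_matrix (hQ : PSData φ π x) {g : Q} (hg : ∀ q, g * q = 0 → q = 0)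
    (k : ℕ → ℕ) (hk : ∃ K, ∀ j, K ≤ j → k j = 0)
    (M : ∀ j, Matrix (Fin (k j)) (Fin (k (j + 1))) Q)
    (hMM : ∀ j i l, g ∣ (M j * M (j + 1)) i l)
    (hex : ∀ j (x : Fin (k (j + 2)) → Q), (∀ i, g ∣ mact (M (j + 1)) x i) →
      ∃ w : Fin (k (j + 3)) → Q, ∀ i, g ∣ x i - mact (M (j + 2)) w i)
    (N : Type u) [AddCommGroup N] [Module Q N] [Module.Finite Q N] (hN : ∀ v : N, g • v = 0)
    (h1 : ∀ v : Fin (k 1) → N, mact (M 0) v = 0 → ∃ w, mact (M 1) w = v) :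
    ∀ j (v : Fin (k (j + 1)) → N), mact (M j) v = 0 → ∃ w, mact (M (j + 1)) w = v := by
  obtain ⟨Φ, hΦΦ, hΦφ, hΦX, hΦx⟩ := hQ.exists_involution
  obtain ⟨ε, hεC, hεX⟩ := hQ.exists_retract
  have := hQ.complete
  have hx : ∀ i, x i ∈ maximalIdeal Q := fun i => by
    rw [hQ.maximal]
    exact Ideal.mem_sup_right (Ideal.subset_span ⟨i, rfl⟩)
  have hΦb : Function.Bijective Φ :=
    ⟨Function.LeftInverse.injective hΦΦ, Function.RightInverse.surjective hΦΦ⟩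
  let S := MvPowerSeries σ Q
  let ι : Syn Q →+* S := Φ.comp (C : Q →+* S)
  let _ : Algebra (Syn Q) S := ι.toAlgebra
  have hιmap : ∀ s ∈ Ideal.span (Set.range fun i => (C (x i) + X i : S)),
      s ∈ (maximalIdeal (Syn Q)).map ι := by
    intro s hs
    refine (Ideal.span_le (I := (maximalIdeal (Syn Q)).map ι)).2 ?_ hs
    rintro _ ⟨i, rfl⟩
    change C (x i) + X i ∈ _
    rw [← hΦx i]
    exact Ideal.mem_map_of_mem ι (show x i ∈ maximalIdeal Q from hx i)
  have hεφ : ∀ a ∈ maximalIdeal Q, ∃ z, ε (Φ (C a)) = φ π * z := by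
    intro a ha
    have : maximalIdeal Q ≤ (Ideal.span {φ π}).comap (ε.comp (Φ.comp C)) := by
      conv_lhs => rw [hQ.maximal]
      refine sup_le (Ideal.span_le.2 ?_) (Ideal.span_le.2 ?_)
      · rintro _ rfl
        simp only [SetLike.mem_coe, Ideal.mem_comap, RingHom.comp_apply, hΦφ, hεC]
        exact Ideal.mem_span_singleton_self _
      · rintro _ ⟨i, rfl⟩
        simp [hΦx, hεC, hεX]
    exact Ideal.mem_span_singleton.1 (this ha)
  have H : Half (Syn Q) Q S (φ π : Q) (φ π) :=
    { comp := (hΦφ π)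
      mem := by
        change φ π ∈ maximalIdeal Q
        rw [hQ.maximal]
        exact Ideal.mem_sup_left (Ideal.mem_span_singleton_self _)
      reg := hQ.reg
      retract := ⟨ε, hεC, hεφ⟩
      gen := fun s => by
        obtain ⟨q, hq⟩ := hQ.sub_C_mem s
        exact ⟨q, hιmap _ hq⟩ }
  have H' : Half Q (Syn Q) S (φ π) (φ π : Q) :=
    { comp := (hΦφ π).symm
      mem := H.mem
      reg := hQ.reg
      retract := ⟨ε.comp Φ, fun q => by
          exact (congrArg ε (hΦΦ _)).trans (hεC q), hεφ⟩
      gen := fun s => by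
        obtain ⟨q, hq⟩ := hQ.sub_C_mem (Φ s)
        refine ⟨q, ?_⟩
        have := Ideal.mem_map_of_mem Φ (hιmap _ hq)
        rw [map_sub, hΦΦ, Ideal.map_map] at this
        have h2 : Φ.comp ι = (C : Q →+* S) := RingHom.ext fun q => hΦΦ (C q)
        have h3 : Ideal.map (Φ.comp ι) (maximalIdeal (Syn Q)) = (maximalIdeal Q).map (C : Q →+* S) :=
          congrArg (fun f : Q →+* S => (maximalIdeal Q).map f) h2
        rw [h3] at this
        exact this }
  have fl2 : Module.Flat Q S := flat_pi Q (σ →₀ ℕ)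
  have fl1 : Module.Flat (Syn Q) S := by
    have : ι.Flat := flat_C.comp (RingHom.Flat.of_bijective hΦb)
    exact this
  have lh2' : IsLocalHom (C : Q →+* S) := ⟨fun a ha => by
    have := ha.map (constantCoeff (σ := σ) (R := Q))
    rwa [constantCoeff_C] at this⟩
  have lh2 : IsLocalHom (algebraMap Q S) := lh2'
  have lh1 : IsLocalHom (algebraMap (Syn Q) S) := ⟨fun a ha => by
    have h1 : IsUnit (Φ (Φ (C (σ := σ) (R := Q) a))) := ha.map Φ
    rw [hΦΦ] at h1
    exact lh2'.map_nonunit _ h1⟩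
  let _ : Module S N := Module.compHom N (constantCoeff (σ := σ) (R := Q))
  have hS : ∀ (s : S) (v : N), s • v = constantCoeff (σ := σ) (R := Q) s • v := fun _ _ => rfl
  let _ : Module (Syn Q) N := inferInstanceAs (Module Q N)
  have hcc : (constantCoeff (σ := σ) (R := Q)).comp (Φ.comp C) = RingHom.id Q := by
    refine hQ.ext Q (maximalIdeal Q) _ _ ?_ ?_ ?_
    · exact RingHom.ext fun v => by simp [hΦφ]
    · intro i
      simpa [hΦx] using hx i
    · intro i
      simp [hΦx]
  have st1 : IsScalarTower (Syn Q) S N := ⟨fun q s v => by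
    change constantCoeff (σ := σ) (R := Q) (Φ (C (q : Q)) * s) • v = (q : Q) • constantCoeff s • v
    rw [map_mul, mul_smul]
    congr 1
    exact RingHom.congr_fun hcc q⟩
  have st2 : IsScalarTower Q S N := ⟨fun q s v => by
    rw [hS, hS]
    have : constantCoeff (q • s) = q * constantCoeff s := by
      rw [smul_eq_C_mul, map_mul, constantCoeff_C]
    rw [this, mul_smul]⟩
  exact H.acyclic_matrix H' diag_mvPowerSeries (g := (g : Q)) hg k hk M hMM hex N
    (fun y hy v => by
      obtain ⟨i, -, rfl⟩ := List.mem_map.1 hy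
      rw [hS, constantCoeff_X, zero_smul]) hN h1

end
end ExtRigid

universe v

namespace ExtRigid
open TensorProduct

/-- Every field extension of a perfect field is formally smooth. -/
theorem formallySmooth_of_perfectField (K : Type v) (L : Type u) [Field K] [Field L] [Algebra K L]
    [PerfectField K] : Algebra.FormallySmooth K L := by
  rw [Algebra.formallySmooth_iff]
  refine ⟨inferInstance, ?_⟩
  refine subsingleton_of_forall_eq 0 fun y => ?_
  obtain ⟨y, hy⟩ := y
  obtain ⟨⟨f, hf⟩, rfl⟩ := Algebra.Extension.Cotangent.mk_surjective y
  refine Subtype.ext ?_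
  change MvPolynomial L K at f
  have hfa : MvPolynomial.aeval id f = 0 := hf
  obtain ⟨s, hs⟩ : ∃ s, s = f.vars := ⟨_, rfl⟩
  let L' := IntermediateField.adjoin K (s : Set L)
  have hfin : Algebra.EssFiniteType K L' := IntermediateField.essFiniteType_iff.2 ⟨s, rfl⟩
  obtain ⟨f', rfl⟩ := MvPolynomial.exists_rename_eq_of_vars_subset_range f (Subtype.val : L' → L)
    Subtype.val_injective (by
      rw [Subtype.range_coe, ← hs]
      exact IntermediateField.subset_adjoin K (s : Set L))
  have hcomm : ∀ q : MvPolynomial L' K, (MvPolynomial.aeval (id : L' → L') q : L) =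
      MvPolynomial.aeval (id : L → L) (MvPolynomial.rename (Subtype.val : L' → L) q) := by
    intro q
    rw [MvPolynomial.aeval_rename]
    exact (MvPolynomial.aeval_algebraMap_apply L (id : L' → L') q).symm
  have hf' : f' ∈ (Algebra.Generators.self K L').toExtension.ker := by
    change MvPolynomial.aeval id f' = 0
    apply Subtype.val_injective
    rw [hcomm, hfa]; rfl
  have key : ∀ i, MvPolynomial.aeval (id : L' → L') (MvPolynomial.pderiv i f') = 0 := by
    intro i
    apply Subtype.val_injective
    rw [hcomm, ← MvPolynomial.pderiv_rename Subtype.val_injective]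
    have := congrArg (fun z => (Algebra.Generators.self K L).cotangentSpaceBasis.repr z i.1) hy
    have h := (Algebra.Generators.self K L).cotangentSpaceBasis_repr_one_tmul
      (MvPolynomial.rename Subtype.val f') i.1
    exact h.symm.trans (this.trans (by simp))
  have hsm : Algebra.FormallySmooth K L' := inferInstance
  have hsub := hsm.subsingleton_h1Cotangent
  have h0 : (Algebra.Generators.self K L').toExtension.cotangentComplex (.mk ⟨f', hf'⟩) = 0 := by
    apply (Algebra.Generators.self K L').cotangentSpaceBasis.repr.injective
    refine Finsupp.ext fun i => ?_
    refine ((Algebra.Generators.self K L').cotangentSpaceBasis_repr_one_tmul f' i).trans ?_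
    refine (key i).trans (by simp)
  have h1 : (⟨_, h0⟩ : Algebra.H1Cotangent K L') = 0 :=
    @Subsingleton.elim _ hsub _ _
  have h2 := congrArg Subtype.val h1
  change Algebra.Extension.Cotangent.mk _ = 0 at h2
  rw [Algebra.Extension.Cotangent.mk_eq_zero_iff] at h2
  change Algebra.Extension.Cotangent.mk _ = 0
  rw [Algebra.Extension.Cotangent.mk_eq_zero_iff]
  let ρ : MvPolynomial L' K →ₐ[K] MvPolynomial L K := MvPolynomial.rename Subtype.val
  let J : Ideal (MvPolynomial L' K) := (Algebra.Generators.self K L').toExtension.ker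
  have h3 : ρ f' ∈ (J ^ 2).map ρ := Ideal.mem_map_of_mem ρ h2
  rw [Ideal.map_pow] at h3
  let J' : Ideal (MvPolynomial L K) := (Algebra.Generators.self K L).toExtension.ker
  have hJ : J.map ρ ≤ J' := by
    rw [Ideal.map_le_iff_le_comap]
    intro q hq
    change MvPolynomial.aeval id q = 0 at hq
    change MvPolynomial.aeval id _ = 0
    have := hcomm q
    rw [hq] at this
    exact this.symm
  exact Ideal.pow_right_mono hJ 2 h3

end ExtRigid

namespace ExtRigid

/-- The structure map of a ring in which the natural number `p` vanishes. -/
noncomputable def zmodHom (p : ℕ) {A : Type u} [CommRing A] (h : (p : A) = 0) : ZMod p →+* A :=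
  (Ideal.Quotient.lift (Ideal.span {(p : ℤ)}) (Int.castRingHom A) (fun a ha => by
    obtain ⟨c, rfl⟩ := Ideal.mem_span_singleton.1 ha
    simp [h])).comp (Int.quotientSpanNatEquivZMod p).symm.toRingHom

/-- A ring homomorphism from a field of characteristic `p` lifts along surjections with
square-zero kernel. -/
theorem exists_lift_zmod (p : ℕ) [Fact p.Prime] {L B C : Type u} [Field L] [CommRing B]
    [CommRing C] (hL : (p : L) = 0) (hB : (p : B) = 0) (q : B →+* C)
    (hq : Function.Surjective q) (hker : ∀ a b, q a = 0 → q b = 0 → a * b = 0) (f : L →+* C) :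
    ∃ g : L →+* B, q.comp g = f := by
  have hC : (p : C) = 0 := by rw [← map_natCast q, hB, map_zero]
  let _ : Algebra (ZMod p) L := (zmodHom p hL).toAlgebra
  let _ : Algebra (ZMod p) B := (zmodHom p hB).toAlgebra
  let _ : Algebra (ZMod p) C := (zmodHom p hC).toAlgebra
  have := formallySmooth_of_perfectField (ZMod p) L
  let q' : B →ₐ[ZMod p] C := { q with
    commutes' := fun r => RingHom.congr_fun (Subsingleton.elim (q.comp (algebraMap (ZMod p) B))
      (algebraMap (ZMod p) C)) r }
  let f' : L →ₐ[ZMod p] C := { f with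
    commutes' := fun r => RingHom.congr_fun (Subsingleton.elim (f.comp (algebraMap (ZMod p) L))
      (algebraMap (ZMod p) C)) r }
  have hnil : IsNilpotent (RingHom.ker (q' : B →+* C)) := by
    refine ⟨2, ?_⟩
    rw [pow_two, Ideal.zero_eq_bot, eq_bot_iff, Ideal.mul_le]
    intro a ha b hb
    exact hker a b ha hb
  refine ⟨(Algebra.FormallySmooth.liftOfSurjective f' q' hq hnil : L →ₐ[ZMod p] B), ?_⟩
  ext x
  exact Algebra.FormallySmooth.liftOfSurjective_apply f' q' hq hnil x

/-- A ring homomorphism from a ring `V` in which the prime `p` is regular and generates a maximal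
ideal lifts along surjections whose kernel has square zero and is killed by `p`. -/
theorem exists_lift_of_isMaximal_span (p : ℕ) [Fact p.Prime] {V B C : Type u} [CommRing V]
    [CommRing B] [CommRing C] (hV : (Ideal.span {(p : V)}).IsMaximal)
    (hreg : ∀ v : V, p * v = 0 → v = 0) (q : B →+* C)
    (hq : Function.Surjective q) (hker : ∀ a b, q a = 0 → q b = 0 → a * b = 0)
    (hp : ∀ a, q a = 0 → p * a = 0) (f : V →+* C) :
    ∃ g : V →+* B, q.comp g = f := by
  let E : Subring (V × B) := RingHom.eqLocus (f.comp (RingHom.fst V B)) (q.comp (RingHom.snd V B))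
  have memE : ∀ x : V × B, x ∈ E ↔ f x.1 = q x.2 := fun x => Iff.rfl
  let I : Ideal E := Ideal.span {(p : E)}
  let L := V ⧸ Ideal.span {(p : V)}
  let _ : Field L := Ideal.Quotient.field _
  have hL : (p : L) = 0 := by
    rw [← map_natCast (Ideal.Quotient.mk (Ideal.span {(p : V)}))]
    exact Ideal.Quotient.eq_zero_iff_mem.2 (Ideal.mem_span_singleton_self _)
  have hEI : (p : E ⧸ I) = 0 := by
    rw [← map_natCast (Ideal.Quotient.mk I)]
    exact Ideal.Quotient.eq_zero_iff_mem.2 (Ideal.mem_span_singleton_self _)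
  let pr : E →+* V := (RingHom.fst V B).comp E.subtype
  have hpr : Function.Surjective pr := fun v => by
    obtain ⟨b, hb⟩ := hq (f v)
    exact ⟨⟨(v, b), hb.symm⟩, rfl⟩
  have hprk : ∀ a b : E, pr a = 0 → pr b = 0 → a * b = 0 := fun a b ha hb => by
    have ha' : q a.1.2 = 0 := by rw [← (memE a.1).1 a.2]; exact (congrArg f ha).trans f.map_zero
    have hb' : q b.1.2 = 0 := by rw [← (memE b.1).1 b.2]; exact (congrArg f hb).trans f.map_zero
    refine Subtype.ext (Prod.ext ?_ (hker _ _ ha' hb'))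
    change pr a * pr b = 0
    rw [ha, zero_mul]
  have hprp : ∀ a : E, pr (p * a) = 0 → (p : E) * a = 0 := fun a ha => by
    have ha' : pr a = 0 := hreg _ (by rwa [map_mul, map_natCast] at ha)
    have ha2 : q a.1.2 = 0 := by rw [← (memE a.1).1 a.2]; exact (congrArg f ha').trans f.map_zero
    refine Subtype.ext (Prod.ext ?_ ?_)
    · change pr (p * a) = 0
      exact ha
    · have := hp _ ha2
      simpa using this
  let q' : E ⧸ I →+* L := Ideal.Quotient.lift I ((Ideal.Quotient.mk _).comp pr) (fun a ha => by
    obtain ⟨c, rfl⟩ := Ideal.mem_span_singleton.1 ha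
    rw [map_mul, map_natCast, hL, zero_mul])
  have hq' : Function.Surjective q' :=
    Ideal.Quotient.lift_surjective_of_surjective _ _ (Ideal.Quotient.mk_surjective.comp hpr)
  have hkE : ∀ e : E, q' (Ideal.Quotient.mk I e) = 0 →
      ∃ κ : E, pr κ = 0 ∧ Ideal.Quotient.mk I e = Ideal.Quotient.mk I κ := by
    intro e he
    have he' : Ideal.Quotient.mk (Ideal.span {(p : V)}) (pr e) = 0 := he
    obtain ⟨c, hc⟩ := Ideal.mem_span_singleton.1 (Ideal.Quotient.eq_zero_iff_mem.1 he')
    obtain ⟨c, rfl⟩ := hpr c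
    refine ⟨e - p * c, by rw [map_sub, map_mul, map_natCast, hc, sub_self], ?_⟩
    rw [map_sub, map_mul, map_natCast, hEI, zero_mul, sub_zero]
  obtain ⟨s, hs⟩ := exists_lift_zmod p hL hEI q' hq' (fun a b ha hb => by
    obtain ⟨a, rfl⟩ := Ideal.Quotient.mk_surjective a
    obtain ⟨b, rfl⟩ := Ideal.Quotient.mk_surjective b
    obtain ⟨a', ha', h1⟩ := hkE a ha
    obtain ⟨b', hb', h2⟩ := hkE b hb
    rw [h1, h2, ← map_mul, hprk _ _ ha' hb', map_zero]) (RingHom.id L)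
  let D : Subring E := RingHom.eqLocus (Ideal.Quotient.mk I)
    ((s.comp (Ideal.Quotient.mk (Ideal.span {(p : V)}))).comp pr)
  let prD : D →+* V := pr.comp D.subtype
  have hinj : Function.Injective prD := by
    rw [injective_iff_map_eq_zero]
    intro e he
    have h1 : Ideal.Quotient.mk I e.1 = s (Ideal.Quotient.mk _ (pr e.1)) := e.2
    have he' : pr e.1 = 0 := he
    rw [he', map_zero, map_zero] at h1
    obtain ⟨c, hc⟩ := Ideal.mem_span_singleton.1 (Ideal.Quotient.eq_zero_iff_mem.1 h1)
    rw [hc] at he'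
    exact Subtype.ext (hc.trans (hprp c he'))
  have hsurj : Function.Surjective prD := by
    intro v
    obtain ⟨e, rfl⟩ := hpr v
    obtain ⟨d, hd⟩ := Ideal.Quotient.mk_surjective (s (Ideal.Quotient.mk _ (pr e)))
    have : q' (Ideal.Quotient.mk I (e - d)) = 0 := by
      rw [map_sub, map_sub, hd]
      rw [show q' (s _) = _ from RingHom.congr_fun hs _]
      exact sub_self _
    obtain ⟨κ, hκ, h⟩ := hkE _ this
    refine ⟨⟨e - κ, ?_⟩, ?_⟩
    · change Ideal.Quotient.mk I (e - κ) = s (Ideal.Quotient.mk _ (pr (e - κ)))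
      rw [map_sub pr, hκ, sub_zero, ← hd, map_sub, ← h, map_sub]
      ring
    · change pr (e - κ) = _
      rw [map_sub, hκ, sub_zero]
  let eD : D ≃+* V := RingEquiv.ofBijective prD ⟨hinj, hsurj⟩
  refine ⟨((RingHom.snd V B).comp (E.subtype.comp D.subtype)).comp (eD.symm : V →+* D), ?_⟩
  ext v
  have h1 : pr (eD.symm v).1 = v := eD.apply_symm_apply v
  have h2 := (memE (eD.symm v).1.1).1 (eD.symm v).1.2
  change q (eD.symm v).1.1.2 = f v
  rw [← h2]
  exact congrArg f h1

/-- Lifting from the residue ring of an adically complete ring to the ring itself. -/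
theorem exists_lift_of_isAdicComplete {V A : Type u} [CommRing V] [CommRing A] (m : Ideal A)
    [IsAdicComplete m A]
    (H : ∀ n (f : V →+* A ⧸ m ^ (n + 1)), ∃ g : V →+* A ⧸ m ^ (n + 2),
      (Ideal.Quotient.factorPow m (n + 1).le_succ).comp g = f) (f : V →+* A ⧸ m) :
    ∃ F : V →+* A, (Ideal.Quotient.mk m).comp F = f := by
  choose g hg using H
  let G : ∀ n, V →+* A ⧸ m ^ (n + 1) := fun n =>
    Nat.rec ((Ideal.quotEquivOfEq (pow_one m).symm : A ⧸ m →+* A ⧸ m ^ (0 + 1)).comp f)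
      (fun n h => g n h) n
  have hG : ∀ n, (Ideal.Quotient.factorPow m (n + 1).le_succ).comp (G (n + 1)) = G n :=
    fun n => hg n (G n)
  let F : ∀ n, V →+* A ⧸ m ^ n := fun n => (Ideal.Quotient.factorPow m n.le_succ).comp (G n)
  have hF1 : ∀ n, F (n + 1) = G n := hG
  have hF : ∀ {a b : ℕ} (h : a ≤ b), (Ideal.Quotient.factorPow m h).comp (F b) = F a := by
    intro a b h
    induction b, h using Nat.le_induction with
    | base => ext; simp
    | succ n hmn ih =>
      rw [← ih, hF1]
      change _ = (Ideal.Quotient.factorPow m hmn).comp ((Ideal.Quotient.factorPow m n.le_succ).comp (G n))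
      rw [← RingHom.comp_assoc]
      congr 1
      ext; simp
  refine ⟨IsAdicComplete.liftRingHom m F hF, ?_⟩
  ext v
  have h := IsAdicComplete.mk_liftRingHom m F hF 1 v
  rw [show F 1 = G 0 from hF1 0] at h
  obtain ⟨a, ha⟩ := Ideal.Quotient.mk_surjective (f v)
  have h0 : G 0 v = Ideal.Quotient.mk (m ^ 1) a := by
    change (Ideal.quotEquivOfEq (pow_one m).symm) (f v) = _
    rw [← ha]; rfl
  rw [h0, Ideal.Quotient.eq, pow_one] at h
  change Ideal.Quotient.mk m _ = _
  rw [← ha, Ideal.Quotient.eq]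
  exact h

theorem factorPow_apply_eq_zero_mul {A : Type u} [CommRing A] {m : Ideal A} (n : ℕ)
    (a b : A ⧸ m ^ (n + 2)) (ha : Ideal.Quotient.factorPow m (n + 1).le_succ a = 0)
    (hb : b ∈ m.map (Ideal.Quotient.mk _)) : b * a = 0 := by
  obtain ⟨a, rfl⟩ := Ideal.Quotient.mk_surjective a
  obtain ⟨b, hb', rfl⟩ := (Ideal.mem_map_iff_of_surjective _ Ideal.Quotient.mk_surjective).1 hb
  have ha' : Ideal.Quotient.mk (m ^ (n + 1)) a = 0 := ha
  rw [Ideal.Quotient.eq_zero_iff_mem] at ha'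
  rw [← map_mul, Ideal.Quotient.eq_zero_iff_mem, show n + 2 = 1 + (n + 1) by ring, pow_add, pow_one]
  exact Ideal.mul_mem_mul hb' ha'

theorem mem_map_of_factorPow_eq_zero {A : Type u} [CommRing A] {m : Ideal A} (n : ℕ)
    (a : A ⧸ m ^ (n + 2)) (ha : Ideal.Quotient.factorPow m (n + 1).le_succ a = 0) :
    a ∈ m.map (Ideal.Quotient.mk (m ^ (n + 2))) := by
  obtain ⟨a, rfl⟩ := Ideal.Quotient.mk_surjective a
  have ha' : Ideal.Quotient.mk (m ^ (n + 1)) a = 0 := ha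
  rw [Ideal.Quotient.eq_zero_iff_mem] at ha'
  exact Ideal.mem_map_of_mem _ (Ideal.pow_le_self n.succ_ne_zero ha')

/-- The residue field of a complete local ring of mixed or positive characteristic is the image of
any ring `V` in which `p` is regular and generates the maximal ideal. -/
theorem exists_lift_residue_of_isMaximal_span (p : ℕ) [Fact p.Prime] {V A : Type u} [CommRing V]
    [CommRing A] (hV : (Ideal.span {(p : V)}).IsMaximal) (hreg : ∀ v : V, p * v = 0 → v = 0)
    (m : Ideal A) [IsAdicComplete m A] (hp : (p : A) ∈ m) (f : V →+* A ⧸ m) :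
    ∃ F : V →+* A, (Ideal.Quotient.mk m).comp F = f := by
  refine exists_lift_of_isAdicComplete m (fun n f => ?_) f
  refine exists_lift_of_isMaximal_span p hV hreg _ (Ideal.Quotient.factor_surjective _)
    (fun a b ha hb => factorPow_apply_eq_zero_mul n _ _ hb (mem_map_of_factorPow_eq_zero n _ ha))
    (fun a ha => factorPow_apply_eq_zero_mul n _ _ ha ?_) f
  rw [← map_natCast (Ideal.Quotient.mk (m ^ (n + 2)))]
  exact Ideal.mem_map_of_mem _ hp

/-- A complete local ring of equal characteristic `p` contains a coefficient field. -/
theorem exists_lift_residue_of_charP (p : ℕ) [Fact p.Prime] {L A : Type u} [Field L]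
    [CommRing A] (hA : (p : A) = 0) (m : Ideal A) [IsAdicComplete m A] (f : L →+* A ⧸ m)
    (hL : (p : L) = 0) : ∃ F : L →+* A, (Ideal.Quotient.mk m).comp F = f := by
  refine exists_lift_of_isAdicComplete m (fun n f => ?_) f
  refine exists_lift_zmod p hL ?_ _ (Ideal.Quotient.factor_surjective _)
    (fun a b ha hb => factorPow_apply_eq_zero_mul n _ _ hb (mem_map_of_factorPow_eq_zero n _ ha)) f
  rw [← map_natCast (Ideal.Quotient.mk (m ^ (n + 2))), hA, map_zero]

/-- A complete local `ℚ`-algebra contains a coefficient field. -/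
theorem exists_lift_residue_of_rat {L A : Type u} [Field L]
    [CommRing A] [Algebra ℚ A] (m : Ideal A) [IsAdicComplete m A] (f : L →+* A ⧸ m)
    (hf : Function.Bijective f) : ∃ F : L →+* A, (Ideal.Quotient.mk m).comp F = f := by
  let e : L ≃+* A ⧸ m := RingEquiv.ofBijective f hf
  let _ : Algebra ℚ L := ((e.symm : A ⧸ m →+* L).comp (algebraMap ℚ (A ⧸ m))).toAlgebra
  have := formallySmooth_of_perfectField ℚ L
  let f' : L →ₐ[ℚ] A ⧸ m := { f with commutes' := fun r => e.apply_symm_apply _ }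
  obtain ⟨g, hg⟩ := Algebra.FormallySmooth.exists_mkₐ_comp_eq_of_isAdicComplete f'
  exact ⟨g, RingHom.ext fun x => AlgHom.congr_fun hg x⟩

end ExtRigid

namespace ExtRigid

/-- A family generating the maximal ideal of a local ring, with at most `dim Q` members. -/
structure RegGens {Q : Type u} [CommRing Q] [IsLocalRing Q] {ι : Type} [Fintype ι]
    (x : ι → Q) : Prop where
  span : Ideal.span (Set.range x) = maximalIdeal Q
  card_le : ((Fintype.card ι : ℕ) : WithBot ℕ∞) ≤ ringKrullDim Q

theorem isLocalRing_quotient {Q : Type u} [CommRing Q] [IsLocalRing Q] {I : Ideal Q}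
    (hI : I ≤ maximalIdeal Q) : IsLocalRing (Q ⧸ I) := by
  have : Nontrivial (Q ⧸ I) := Ideal.Quotient.nontrivial_iff.2
    (fun h => (maximalIdeal.isMaximal Q).ne_top (top_le_iff.1 (h ▸ hI)))
  exact .of_surjective' (Ideal.Quotient.mk I) Ideal.Quotient.mk_surjective

theorem map_maximalIdeal_quotient {Q : Type u} [CommRing Q] [IsLocalRing Q] {I : Ideal Q}
    [IsLocalRing (Q ⧸ I)] :
    (maximalIdeal Q).map (Ideal.Quotient.mk I) = maximalIdeal (Q ⧸ I) := by
  have := IsLocalHom.of_surjective (Ideal.Quotient.mk I) Ideal.Quotient.mk_surjective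
  apply le_antisymm
  · rw [Ideal.map_le_iff_le_comap]
    intro a ha
    rw [Ideal.mem_comap, mem_maximalIdeal, mem_nonunits_iff, isUnit_map_iff]
    exact ha
  · intro a ha
    obtain ⟨a, rfl⟩ := Ideal.Quotient.mk_surjective a
    rw [mem_maximalIdeal, mem_nonunits_iff, isUnit_map_iff] at ha
    exact Ideal.mem_map_of_mem _ ha

section
variable {Q : Type u} [CommRing Q] [IsLocalRing Q] [IsNoetherianRing Q] {ι : Type} [Fintype ι]
  {x : ι → Q}

theorem RegGens.mem (h : RegGens x) (i : ι) : x i ∈ maximalIdeal Q :=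
  h.span ▸ Ideal.subset_span ⟨i, rfl⟩

theorem RegGens.span_image_le (h : RegGens x) (S : Set ι) :
    Ideal.span (x '' S) ≤ maximalIdeal Q :=
  h.span ▸ Ideal.span_mono (Set.image_subset_range _ _)

theorem ringKrullDim_le_of_span {κ : Type} [Fintype κ] (y : κ → Q)
    (hy : Ideal.span (Set.range y) = maximalIdeal Q) :
    ringKrullDim Q ≤ (Fintype.card κ : ℕ) := by
  refine (ringKrullDim_le_spanFinrank_maximalIdeal Q).trans ?_
  have h : (maximalIdeal Q).spanFinrank ≤ Fintype.card κ := by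
    rw [← hy]
    refine (Submodule.spanFinrank_span_le_ncard_of_finite (Set.finite_range y)).trans ?_
    rw [← Set.image_univ]
    refine (Set.ncard_image_le Set.finite_univ).trans ?_
    rw [Set.ncard_univ, Nat.card_eq_fintype_card]
  exact_mod_cast h

theorem RegGens.card_le_of_span (h : RegGens x) {κ : Type} [Fintype κ] (y : κ → Q)
    (hy : Ideal.span (Set.range y) = maximalIdeal Q) : Fintype.card ι ≤ Fintype.card κ := by
  have := h.card_le.trans (ringKrullDim_le_of_span y hy)
  exact_mod_cast this

theorem RegGens.quotient (h : RegGens x) (S : Finset ι) [DecidableEq ι]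
    [IsLocalRing (Q ⧸ Ideal.span (x '' S))] :
    RegGens fun i : {i // i ∉ S} => Ideal.Quotient.mk (Ideal.span (x '' S)) (x i) := by
  classical
  refine ⟨?_, ?_⟩
  · rw [← map_maximalIdeal_quotient, ← h.span, Ideal.map_span]
    apply le_antisymm
    · exact Ideal.span_mono (by
        rintro _ ⟨i, rfl⟩
        exact Set.mem_image_of_mem _ ⟨i.1, rfl⟩)
    · rw [Ideal.span_le]
      rintro _ ⟨_, ⟨i, rfl⟩, rfl⟩
      by_cases hi : i ∈ S
      · rw [Ideal.Quotient.eq_zero_iff_mem.2 (Ideal.subset_span (Set.mem_image_of_mem x (Finset.mem_coe.2 hi)))]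
        exact zero_mem _
      · exact Ideal.subset_span ⟨⟨i, hi⟩, rfl⟩
  · have h1 := ringKrullDim_le_ringKrullDim_quotient_add_card (S.image x) (by
      rw [IsLocalRing.ringJacobson_eq_maximalIdeal]
      intro a ha
      obtain ⟨i, -, rfl⟩ := Finset.mem_image.1 ha
      exact h.mem i)
    have h2 := h.card_le.trans h1
    rw [Finset.coe_image] at h2
    have h3 : (S.image x).card ≤ S.card := Finset.card_image_le
    have h4 : Fintype.card {i // i ∉ S} + S.card = Fintype.card ι := by
      rw [Fintype.card_subtype_compl, Fintype.card_coe]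
      exact Nat.sub_add_cancel (Finset.card_le_univ S)
    have h5 : ((Fintype.card {i // i ∉ S} : ℕ) : WithBot ℕ∞) + (S.card : ℕ) ≤
        ringKrullDim (Q ⧸ Ideal.span (x '' S)) + (S.card : ℕ) := by
      refine le_trans (le_of_eq ?_) (h2.trans (by gcongr))
      rw [← h4]; push_cast; rfl
    exact ENat.WithBot.add_le_add_natCast_right_iff.1 h5

theorem RegGens.reindex (h : RegGens x) {κ : Type} [Fintype κ] (e : κ ≃ ι) :
    RegGens fun k => x (e k) := by
  refine ⟨?_, ?_⟩
  · rw [← h.span]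
    congr 1
    exact e.surjective.range_comp x
  · rw [Fintype.card_congr e]
    exact h.card_le

/-- An element of a generating family of the maximal ideal may be replaced by any element outside
the square of the maximal ideal. -/
theorem RegGens.exists_update [DecidableEq ι] (h : RegGens x) {y : Q} (hy : y ∈ maximalIdeal Q)
    (hy2 : y ∉ maximalIdeal Q ^ 2) : ∃ i, RegGens (Function.update x i y) := by
  rw [← h.span, Ideal.mem_span_range_iff_exists_fun] at hy
  obtain ⟨c, rfl⟩ := hy
  obtain ⟨i, hi⟩ : ∃ i, IsUnit (c i) := by
    by_contra hc
    push Not at hc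
    apply hy2
    rw [pow_two]
    exact sum_mem fun i _ => Ideal.mul_mem_mul (hc i) (h.mem i)
  refine ⟨i, ?_, h.card_le⟩
  apply le_antisymm
  · rw [Ideal.span_le]
    rintro _ ⟨j, rfl⟩
    by_cases hj : j = i
    · subst hj
      rw [Function.update_self]
      exact sum_mem fun i _ => Ideal.mul_mem_left _ _ (h.mem i)
    · rw [Function.update_of_ne hj]
      exact h.mem j
  · rw [← h.span, Ideal.span_le]
    set I := Ideal.span (Set.range (Function.update x i (∑ i, c i * x i))) with hI
    have hj : ∀ j, j ≠ i → x j ∈ I := fun j hj =>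
      Ideal.subset_span ⟨j, Function.update_of_ne hj _ _⟩
    rintro _ ⟨j, rfl⟩
    by_cases hji : j = i
    · subst hji
      have h1 : ∑ i, c i * x i ∈ I := Ideal.subset_span ⟨j, Function.update_self _ _ _⟩
      rw [← Finset.add_sum_erase _ _ (Finset.mem_univ j)] at h1
      have h2 : ∑ i ∈ Finset.univ.erase j, c i * x i ∈ I :=
        sum_mem fun i hi => Ideal.mul_mem_left _ _ (hj i (Finset.ne_of_mem_erase hi))
      exact (Ideal.unit_mul_mem_iff_mem I hi).1 ((Ideal.add_mem_iff_left I h2).1 h1)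
    · exact hj j hji

end

theorem isDomain_of_maximalIdeal_eq_bot {Q : Type u} [CommRing Q] [IsLocalRing Q]
    (h : maximalIdeal Q = ⊥) : IsDomain Q :=
  (IsLocalRing.isField_iff_maximalIdeal_eq.2 h).isDomain

theorem isDomain_of_regGens_fin (n : ℕ) : ∀ {Q : Type u} [CommRing Q] [IsLocalRing Q]
    [IsNoetherianRing Q] {x : Fin n → Q}, RegGens x → IsDomain Q := by
  classical
  induction n with
  | zero =>
    intro Q _ _ _ x h
    apply isDomain_of_maximalIdeal_eq_bot
    rw [← h.span]
    simp
  | succ n ih =>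
    intro Q _ _ _ x h
    by_cases hm : maximalIdeal Q ≤ maximalIdeal Q ^ 2
    · apply isDomain_of_maximalIdeal_eq_bot
      refine Submodule.eq_bot_of_le_smul_of_le_jacobson_bot (maximalIdeal Q) _
        (IsNoetherian.noetherian _) ?_ ?_
      · rwa [smul_eq_mul, ← pow_two]
      · rw [jacobson_eq_maximalIdeal _ bot_ne_top]
    have hfin := minimalPrimes.finite_of_isNoetherianRing Q
    have hmin : ∀ q ∈ minimalPrimes Q, ¬ maximalIdeal Q ≤ q := by
      intro q hq hle
      have := hq.1.1
      have hq' : q = maximalIdeal Q := le_antisymm (le_maximalIdeal this.ne_top) hle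
      have h0 : (maximalIdeal Q).height = 0 := by
        exact Ideal.height_eq_zero_iff.2 (hq' ▸ hq)
      have h1 := h.card_le
      rw [← IsLocalRing.maximalIdeal_height_eq_ringKrullDim, h0] at h1
      have h2 : Fintype.card (Fin (n + 1)) ≤ 0 := by exact_mod_cast h1
      simp at h2
    obtain ⟨y, hym, hy2, hymin⟩ : ∃ y ∈ maximalIdeal Q, y ∉ maximalIdeal Q ^ 2 ∧
        ∀ q ∈ minimalPrimes Q, y ∉ q := by
      by_contra hc
      push Not at hc
      have := (Ideal.subset_union_prime' (s := hfin.toFinset.image Option.some)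
        (f := fun o : Option (Ideal Q) => o.elim (maximalIdeal Q ^ 2) id) (a := none) (b := none)
        (I := maximalIdeal Q) (fun i hi => by
          obtain ⟨q, hq, rfl⟩ := Finset.mem_image.1 hi
          exact (hfin.mem_toFinset.1 hq).1.1)).1 (fun y hy => by
          by_cases hy2 : y ∈ maximalIdeal Q ^ 2
          · exact Or.inl (Or.inl hy2)
          · obtain ⟨q, hq, hyq⟩ := hc y hy hy2
            refine Or.inr (Set.mem_biUnion (x := some q) ?_ hyq)
            simpa using hq)
      rcases this with h' | h' | ⟨o, ho, h'⟩
      · exact hm h'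
      · exact hm h'
      · obtain ⟨q, hq, rfl⟩ := Finset.mem_image.1 ho
        exact hmin q (hfin.mem_toFinset.1 hq) h'
    obtain ⟨i, hi⟩ := h.exists_update hym hy2
    have hIe : Function.update x i y '' ({i} : Finset (Fin (n + 1))) = {y} := by simp
    have hle := hi.span_image_le ({i} : Finset (Fin (n + 1)))
    have := isLocalRing_quotient hle
    have hq := hi.quotient {i}
    have hcard : Fintype.card (Fin n) = Fintype.card {j // j ∉ ({i} : Finset (Fin (n + 1)))} := by
      rw [Fintype.card_subtype_compl]
      simp
    have hdom := ih (hq.reindex (Fintype.equivOfCardEq hcard))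
    have hprime : (Ideal.span {y}).IsPrime := by
      rw [← hIe]
      exact (Ideal.Quotient.isDomain_iff_prime _).1 hdom
    obtain ⟨q, hq, hqy⟩ := Ideal.exists_minimalPrimes_le (I := ⊥) (J := Ideal.span {y}) bot_le
    have hqp := hq.1.1
    have hyq : y ∉ q := hymin q hq
    have hq0 : q = ⊥ := by
      refine Submodule.eq_bot_of_le_smul_of_le_jacobson_bot (maximalIdeal Q) _
        (IsNoetherian.noetherian _) ?_ ?_
      · intro a ha
        obtain ⟨c, rfl⟩ := Ideal.mem_span_singleton.1 (hqy ha)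
        exact Ideal.mul_mem_mul hym ((hqp.mem_or_mem ha).resolve_left hyq)
      · rw [jacobson_eq_maximalIdeal _ bot_ne_top]
    rw [hq0] at hqp
    exact IsDomain.of_bot_isPrime Q

section
variable {Q : Type u} [CommRing Q] [IsLocalRing Q] [IsNoetherianRing Q] {ι : Type} [Fintype ι]
  {x : ι → Q}

theorem RegGens.isDomain (h : RegGens x) : IsDomain Q :=
  isDomain_of_regGens_fin _ (h.reindex (Fintype.equivFin ι).symm)

theorem RegGens.isPrime (h : RegGens x) (S : Finset ι) : (Ideal.span (x '' S)).IsPrime := by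
  classical
  have := isLocalRing_quotient (h.span_image_le S)
  exact (Ideal.Quotient.isDomain_iff_prime _).1 (h.quotient S).isDomain

theorem RegGens.notMem (h : RegGens x) (S : Finset ι) {i : ι} (hi : i ∉ S) :
    x i ∉ Ideal.span (x '' S) := by
  classical
  intro hx
  have hle : ∀ j, x j ∈ Ideal.span (Set.range fun j : {j // j ≠ i} => x j) := by
    intro j
    by_cases hj : j = i
    · subst hj
      refine Ideal.span_mono ?_ hx
      rintro _ ⟨k, hk, rfl⟩
      exact ⟨⟨k, fun h => hi (h ▸ hk)⟩, rfl⟩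
    · exact Ideal.subset_span ⟨⟨j, hj⟩, rfl⟩
  have hspan : Ideal.span (Set.range fun j : {j // j ≠ i} => x j) = maximalIdeal Q := by
    rw [← h.span]
    apply le_antisymm
    · exact Ideal.span_mono (by rintro _ ⟨j, rfl⟩; exact ⟨j.1, rfl⟩)
    · rw [Ideal.span_le]
      rintro _ ⟨j, rfl⟩
      exact hle j
  have h1 := h.card_le_of_span _ hspan
  have h2 : Fintype.card {j // j ≠ i} < Fintype.card ι :=
    Fintype.card_subtype_lt (x := i) (by simp)
  omega

theorem RegGens.regular (h : RegGens x) (S : Finset ι) {i : ι} (hi : i ∉ S) {a : Q}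
    (ha : x i * a ∈ Ideal.span (x '' S)) : a ∈ Ideal.span (x '' S) :=
  ((h.isPrime S).mem_or_mem ha).resolve_left (h.notMem S hi)

end

end ExtRigid

namespace ExtRigid

section
variable {Q P A : Type u} [CommRing Q] [IsLocalRing Q] [IsNoetherianRing Q]
  [CommRing P] [IsLocalRing P] [IsNoetherianRing P] [CommRing A]
  {ι : Type} [Fintype ι] {y : ι → Q} {Y : ι → P}

omit [IsNoetherianRing P] in
theorem RegGens.sum_mem_maximalIdeal_mul_ker [DecidableEq ι] (h : RegGens y)
    (hY : ∀ i, Y i ∈ maximalIdeal P) {p : Q →+* A} {ψ : P →+* A} (hψ : Function.Surjective ψ)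
    (hYy : ∀ i, ψ (Y i) = p (y i)) (S : Finset ι) :
    ∀ (F : ι → Q) (f : ι → P), (∀ i ∈ S, ψ (f i) = p (F i)) → ∑ i ∈ S, y i * F i = 0 →
      ∑ i ∈ S, Y i * f i ∈ maximalIdeal P * RingHom.ker ψ := by
  induction S using Finset.induction_on with
  | empty => intros; simp
  | insert i S hi ih =>
    intro F f hfF h0
    rw [Finset.sum_insert hi] at h0
    have hmem : F i ∈ Ideal.span (y '' S) := by
      refine h.regular S hi ?_
      rw [eq_neg_of_add_eq_zero_left h0]
      exact neg_mem (sum_mem fun j hj => Ideal.mul_mem_right _ _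
        (Ideal.subset_span (Set.mem_image_of_mem y (Finset.mem_coe.2 hj))))
    obtain ⟨b, hb⟩ : ∃ b : ι → Q, ∑ j ∈ S, b j * y j = F i := by
      obtain ⟨b, hb⟩ := Submodule.mem_span_image_finset_iff_exists_fun Q |>.1 hmem
      refine ⟨fun j => if hj : j ∈ S then b ⟨j, hj⟩ else 0, ?_⟩
      rw [← hb, ← Finset.sum_coe_sort]
      simp
    choose β hβ using fun j => hψ (p (b j))
    have h1 : f i - ∑ j ∈ S, β j * Y j ∈ RingHom.ker ψ := by
      rw [RingHom.mem_ker, map_sub, hfF i (Finset.mem_insert_self _ _), ← hb]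
      simp [hβ, hYy]
    have h2 := ih (fun j => F j + y i * b j) (fun j => f j + Y i * β j)
      (fun j hj => by simp [hfF j (Finset.mem_insert_of_mem hj), hYy, hβ]) (by
        rw [← h0, ← hb, Finset.mul_sum, ← Finset.sum_add_distrib]
        exact Finset.sum_congr rfl fun j _ => by ring)
    have h3 := add_mem (Ideal.mul_mem_mul (hY i) h1) h2
    convert h3 using 1
    rw [Finset.sum_insert hi, mul_sub, sub_add_eq_add_sub, add_sub_assoc, add_right_inj,
      Finset.mul_sum, ← Finset.sum_sub_distrib]
    exact Finset.sum_congr rfl fun j _ => by ring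

theorem RegGens.exists_ker_eq_span [Nontrivial A] (h : RegGens y)
    (hY : Ideal.span (Set.range Y) = maximalIdeal P) {p : Q →+* A} (hp : Function.Surjective p)
    {ψ : P →+* A} (hψ : Function.Surjective ψ) (hYy : ∀ i, ψ (Y i) = p (y i)) {x : Q}
    (hx : RingHom.ker p = Ideal.span {x}) : ∃ z, RingHom.ker ψ = Ideal.span {z} := by
  classical
  have hYm : ∀ i, Y i ∈ maximalIdeal P := fun i => hY ▸ Ideal.subset_span ⟨i, rfl⟩
  have hxp : p x = 0 := by
    rw [← RingHom.mem_ker, hx]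
    exact Ideal.mem_span_singleton_self x
  have hxm : x ∈ maximalIdeal Q := by
    rw [mem_maximalIdeal, mem_nonunits_iff]
    intro hu
    exact (hu.map p).ne_zero hxp
  rw [← h.span, Ideal.mem_span_range_iff_exists_fun] at hxm
  obtain ⟨q, hq⟩ := hxm
  choose z hz using fun i => hψ (p (q i))
  have hz0 : ψ (∑ i, Y i * z i) = 0 := by
    rw [← hxp, ← hq]
    simp [hz, hYy, mul_comm]
  refine ⟨∑ i, Y i * z i, le_antisymm ?_ ?_⟩
  · refine Submodule.le_of_le_smul_of_le_jacobson_bot (I := maximalIdeal P)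
      (IsNoetherian.noetherian _) (IsLocalRing.jacobson_eq_maximalIdeal _ bot_ne_top).ge ?_
    intro f hf
    have hfm : f ∈ maximalIdeal P := by
      rw [mem_maximalIdeal, mem_nonunits_iff]
      intro hu
      exact (hu.map ψ).ne_zero hf
    rw [← hY, Ideal.mem_span_range_iff_exists_fun] at hfm
    obtain ⟨c, hc⟩ := hfm
    choose F hF using fun i => hp (ψ (c i))
    have h1 : ∑ i, F i * y i ∈ RingHom.ker p := by
      rw [RingHom.mem_ker]
      rw [RingHom.mem_ker, ← hc] at hf
      simpa [hF, hYy] using hf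
    rw [hx, Ideal.mem_span_singleton] at h1
    obtain ⟨a, ha⟩ := h1
    obtain ⟨b, hb⟩ := hψ (p a)
    have h2 := h.sum_mem_maximalIdeal_mul_ker hYm hψ hYy Finset.univ
      (fun i => F i - q i * a) (fun i => c i - z i * b) (fun i _ => by simp [hF, hz, hb]) (by
        rw [← sub_eq_zero.2 ha, ← hq, Finset.sum_mul, ← Finset.sum_sub_distrib]
        exact Finset.sum_congr rfl fun j _ => by ring)
    have h3 : ∑ i, Y i * (c i - z i * b) = f - (∑ i, Y i * z i) * b := by
      rw [← hc, Finset.sum_mul, ← Finset.sum_sub_distrib]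
      exact Finset.sum_congr rfl fun j _ => by ring
    rw [h3] at h2
    have h4 := Submodule.add_mem_sup
      (Ideal.mul_mem_right b _ (Ideal.mem_span_singleton_self (∑ i, Y i * z i))) h2
    rwa [add_sub_cancel] at h4
  · rw [Ideal.span_singleton_le_iff_mem]
    exact hz0

end

theorem ringKrullDim_add_le_mvPowerSeries (V : Type u) [CommRing V] [IsLocalRing V]
    [IsAdicComplete (maximalIdeal V) V] (n : ℕ) :
    ringKrullDim V + n ≤ ringKrullDim (MvPowerSeries (Fin n) V) := by
  induction n with
  | zero =>
    simp only [Nat.cast_zero, add_zero]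
    exact ringKrullDim_le_of_surjective (MvPowerSeries.constantCoeff (σ := Fin 0) (R := V))
      fun v => ⟨MvPowerSeries.C v, by simp⟩
  | succ n ih =>
    have c0 := isAdicComplete_maximalIdeal_mvPowerSeries (σ := Fin n) (T := V)
    have c1 := isAdicComplete_maximalIdeal_mvPowerSeries (σ := Fin (n + 1)) (T := V)
    obtain ⟨f, hfC, hfX⟩ := exists_ringHom_X (σ := Fin (n + 1)) (MvPowerSeries.C (R := V))
      (maximalIdeal (MvPowerSeries (Fin n) V))
      (Fin.cons 0 MvPowerSeries.X : Fin (n + 1) → MvPowerSeries (Fin n) V) (Fin.cases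
        (by simp) fun i => by exact X_mem_maximalIdeal i)
    obtain ⟨g, hgC, hgX⟩ := exists_ringHom_X (σ := Fin n) (MvPowerSeries.C (R := V)) _
      (fun i => (MvPowerSeries.X i.succ : MvPowerSeries (Fin (n + 1)) V))
      fun i => X_mem_maximalIdeal (σ := Fin (n + 1)) (T := V) i.succ
    have hfg : f.comp g = RingHom.id _ := by
      refine ringHom_ext_of_X (maximalIdeal _) ?_ (fun i => ?_) fun i => ?_
      · rw [RingHom.comp_assoc, hgC, hfC, RingHom.id_comp]
      · simpa [hgX, hfX] using X_mem_maximalIdeal i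
      · simp [hgX, hfX]
    push_cast
    rw [← add_assoc]
    refine le_trans (by gcongr) (ringKrullDim_succ_le_of_surjective f (fun s => ⟨g s, ?_⟩)
      (MvPowerSeries.X_mem_nonzeroDivisors (i := (0 : Fin (n + 1)))) (by simp [hfX]))
    exact RingHom.congr_fun hfg s

theorem exists_ringHom_mvPowerSeries {Q A V : Type u} [CommRing Q] [IsLocalRing Q]
    [IsNoetherianRing Q] [CommRing A] [IsLocalRing A] [IsAdicComplete (maximalIdeal A) A]
    [CommRing V] [IsLocalRing V] [IsNoetherianRing V] [IsDomain V]
    [IsAdicComplete (maximalIdeal V) V] {r : ℕ} {y : Fin (r + 1) → Q} (h : RegGens y)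
    {p : Q →+* A} (hp : Function.Surjective p) {x : Q} (hx : x ∈ nonZeroDivisors Q)
    (hker : RingHom.ker p = Ideal.span {x}) {π : V} (hπ : maximalIdeal V = Ideal.span {π})
    (hπ0 : π ≠ 0) {φ : V →+* A} (hφπ : φ π = p (y 0))
    (hφ : Function.Surjective ((Ideal.Quotient.mk (maximalIdeal A)).comp φ)) :
    ∃ ψ : MvPowerSeries (Fin r) V →+* A, Function.Surjective ψ ∧
      ∃ z, z ≠ 0 ∧ RingHom.ker ψ = Ideal.span {z} := by
  have hloc := IsLocalHom.of_surjective p hp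
  have hpm : ∀ q ∈ maximalIdeal Q, p q ∈ maximalIdeal A := fun q hq => by
    rw [mem_maximalIdeal, mem_nonunits_iff, isUnit_map_iff]
    exact hq
  obtain ⟨ψ, hψC, hψX⟩ := exists_ringHom_X (σ := Fin r) φ (maximalIdeal A)
    (fun i => p (y i.succ)) fun i => hpm _ (h.mem _)
  let Y : Fin (r + 1) → MvPowerSeries (Fin r) V := Fin.cons (MvPowerSeries.C π) MvPowerSeries.X
  have hY : Ideal.span (Set.range Y) = maximalIdeal _ := by
    rw [maximalIdeal_mvPowerSeries, extIdeal, hπ, Ideal.map_span, Set.image_singleton,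
      Fin.range_cons, Ideal.span_insert]
  have hYy : ∀ i, ψ (Y i) = p (y i) := by
    refine Fin.cases ?_ fun i => ?_
    · rw [← hφπ, ← hψC]
      rfl
    · exact hψX i
  have hmap : (maximalIdeal (MvPowerSeries (Fin r) V)).map ψ = maximalIdeal A := by
    rw [← hY, Ideal.map_span, ← Set.range_comp]
    have : ψ ∘ Y = p ∘ y := funext hYy
    rw [this, Set.range_comp, ← Ideal.map_span, h.span]
    refine le_antisymm (Ideal.map_le_iff_le_comap.2 hpm) fun a ha => ?_
    obtain ⟨q, rfl⟩ := hp a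
    refine Ideal.mem_map_of_mem _ ?_
    rw [mem_maximalIdeal, mem_nonunits_iff, isUnit_map_iff] at ha
    exact ha
  have hψ : Function.Surjective ψ := by
    have c1 := isAdicComplete_maximalIdeal_mvPowerSeries (σ := Fin r) (T := V)
    have : IsHausdorff ((maximalIdeal (MvPowerSeries (Fin r) V)).map ψ) A := by
      rw [hmap]
      infer_instance
    refine surjective_of_mk_map_comp_surjective (I := maximalIdeal (MvPowerSeries (Fin r) V)) ψ
      fun a => ?_
    obtain ⟨a, rfl⟩ := Ideal.Quotient.mk_surjective a
    obtain ⟨v, hv⟩ := hφ (Ideal.Quotient.mk _ a)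
    refine ⟨MvPowerSeries.C v, ?_⟩
    rw [← hψC, RingHom.comp_apply, Ideal.Quotient.eq] at hv
    rw [RingHom.comp_apply, Ideal.Quotient.eq, hmap]
    exact hv
  obtain ⟨z, hz⟩ := h.exists_ker_eq_span hY hp hψ hYy hker
  refine ⟨ψ, hψ, z, ?_, hz⟩
  rintro rfl
  rw [Ideal.span_singleton_eq_bot.2 rfl] at hz
  have hinj := (RingHom.injective_iff_ker_eq_bot ψ).2 hz
  have h1 : ringKrullDim (MvPowerSeries (Fin r) V) = ringKrullDim (Q ⧸ Ideal.span {x}) :=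
    ringKrullDim_eq_of_ringEquiv ((RingEquiv.ofBijective ψ ⟨hinj, hψ⟩).trans
      ((RingHom.quotientKerEquivOfSurjective hp).symm.trans (Ideal.quotEquivOfEq hker)))
  have h2 := ringKrullDim_quotient_succ_le_of_nonZeroDivisor hx
  have h3 := ringKrullDim_le_of_span y h.span
  have h4 := ringKrullDim_add_le_mvPowerSeries V r
  have h5 : (1 : WithBot ℕ∞) ≤ ringKrullDim V := by
    have := ringKrullDim_quotient_succ_le_of_nonZeroDivisor (mem_nonZeroDivisors_of_ne_zero hπ0)
    have hnt : Nontrivial (V ⧸ Ideal.span {π}) := by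
      rw [← hπ]
      infer_instance
    refine le_trans ?_ this
    exact le_add_of_nonneg_left ringKrullDim_nonneg_of_nontrivial
  have h6 : (1 : WithBot ℕ∞) + r + 1 ≤ (r + 1 : ℕ) := by
    calc (1 : WithBot ℕ∞) + r + 1 ≤ ringKrullDim V + r + 1 := by gcongr
      _ ≤ _ := (add_le_add_left h4 1).trans (by rw [h1]; exact h2.trans (by simpa using h3))
  have h7 : 1 + r + 1 ≤ r + 1 := by exact_mod_cast h6
  omega

end ExtRigid

namespace ExtRigid

theorem exists_eq_pow_mul_unit {V : Type u} [CommRing V] [IsLocalRing V]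
    [IsHausdorff (maximalIdeal V) V] {π : V} (hπ : maximalIdeal V = Ideal.span {π}) {a : V}
    (ha : a ≠ 0) : ∃ (n : ℕ) (v : Vˣ), a = π ^ n * v := by
  classical
  obtain ⟨n, hn⟩ : ∃ n : ℕ, a ∉ maximalIdeal V ^ n := by
    by_contra hc
    push Not at hc
    refine ha (IsHausdorff.haus (inferInstance : IsHausdorff (maximalIdeal V) V) _ fun n => ?_)
    rw [SModEq.zero, smul_eq_mul, Ideal.mul_top]
    exact hc n
  induction n generalizing a with
  | zero => simp at hn
  | succ n ih =>
    by_cases hu : IsUnit a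
    · exact ⟨0, hu.unit, by simp⟩
    · have : a ∈ maximalIdeal V := hu
      rw [hπ, Ideal.mem_span_singleton] at this
      obtain ⟨b, rfl⟩ := this
      obtain ⟨m, v, rfl⟩ := ih (a := b) (right_ne_zero_of_mul ha) (fun h => hn (by
        rw [pow_succ']
        exact Ideal.mul_mem_mul (hπ ▸ Ideal.mem_span_singleton_self π) h))
      exact ⟨m + 1, v, by ring⟩

theorem isDomain_of_maximalIdeal_eq_span {V : Type u} [CommRing V] [IsLocalRing V]
    [IsHausdorff (maximalIdeal V) V] {π : V} (hπ : maximalIdeal V = Ideal.span {π})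
    (hreg : ∀ v, π * v = 0 → v = 0) : IsDomain V := by
  have hpow : ∀ (n : ℕ) v, π ^ n * v = 0 → v = 0 := by
    intro n
    induction n with
    | zero => simp
    | succ n ih =>
      intro v hv
      rw [pow_succ, mul_assoc] at hv
      exact hreg v (ih _ hv)
  have : NoZeroDivisors V := ⟨by
    intro a b hab
    by_contra! hc
    obtain ⟨n, v, rfl⟩ := exists_eq_pow_mul_unit hπ hc.1
    rw [mul_assoc] at hab
    exact hc.2 ((v.isUnit.mul_right_eq_zero).1 (hpow n _ hab))⟩
  exact NoZeroDivisors.to_isDomain V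

theorem isNoetherianRing_of_maximalIdeal_eq_span {V : Type u} [CommRing V] [IsLocalRing V]
    [IsDomain V] [IsHausdorff (maximalIdeal V) V] {π : V} (hπ : maximalIdeal V = Ideal.span {π})
    (h0 : π ≠ 0) : IsNoetherianRing V := by
  have : IsDiscreteValuationRing V :=
    IsDiscreteValuationRing.ofHasUnitMulPowIrreducibleFactorization
      ⟨π, IsDiscreteValuationRing.irreducible_of_span_eq_maximalIdeal π h0 hπ, fun {x} hx => by
        obtain ⟨n, v, rfl⟩ := exists_eq_pow_mul_unit hπ hx
        exact ⟨n, v, rfl⟩⟩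
  infer_instance

/-- The output of the presentation theorem: a complete local ring is a quotient of a power
series ring over a complete discrete valuation ring by a nonzero principal ideal. -/
def HasPresentation (A : Type u) [CommRing A] : Prop :=
  ∃ (r : ℕ) (V : Type u) (_ : CommRing V) (_ : IsLocalRing V) (_ : IsNoetherianRing V)
    (_ : IsDomain V) (_ : IsAdicComplete (maximalIdeal V) V) (π : V),
    maximalIdeal V = Ideal.span {π} ∧ π ≠ 0 ∧
    ∃ ψ : MvPowerSeries (Fin r) V →+* A, Function.Surjective ψ ∧
      ∃ z, z ≠ 0 ∧ RingHom.ker ψ = Ideal.span {z}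

section
variable {Q A : Type u} [CommRing Q] [IsLocalRing Q] [IsNoetherianRing Q] [CommRing A]
  [IsLocalRing A] [IsAdicComplete (maximalIdeal A) A] {r : ℕ} {y : Fin (r + 1) → Q}
  {p : Q →+* A} {x : Q}

theorem hasPresentation_of_coefficientField (h : RegGens y) (hp : Function.Surjective p)
    (hx : x ∈ nonZeroDivisors Q) (hker : RingHom.ker p = Ideal.span {x}) {L : Type u} [Field L]
    {F : L →+* A} (hF : Function.Surjective ((Ideal.Quotient.mk (maximalIdeal A)).comp F)) :
    HasPresentation A := by
  have hL : maximalIdeal L = ⊥ := (IsLocalRing.isField_iff_maximalIdeal_eq.1 (Field.toIsField L))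
  have : IsAdicComplete (maximalIdeal L) L := by
    rw [hL]
    infer_instance
  have := isAdicComplete_maximalIdeal_mvPowerSeries (σ := Fin 1) (T := L)
  have hloc := IsLocalHom.of_surjective p hp
  obtain ⟨φ, hφC, hφX⟩ := exists_ringHom_X (σ := Fin 1) F (maximalIdeal A) (fun _ => p (y 0))
    fun _ => by
      rw [mem_maximalIdeal, mem_nonunits_iff, isUnit_map_iff]
      exact h.mem 0
  have hπ : maximalIdeal (MvPowerSeries (Fin 1) L) =
      Ideal.span {(MvPowerSeries.X 0 : MvPowerSeries (Fin 1) L)} := by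
    rw [maximalIdeal_mvPowerSeries, extIdeal, hL, Ideal.map_bot, bot_sup_eq, Set.range_unique]
    rfl
  have hX : (MvPowerSeries.X 0 : MvPowerSeries (Fin 1) L) ≠ 0 :=
    nonZeroDivisors.ne_zero MvPowerSeries.X_mem_nonzeroDivisors
  have hdom : IsDomain (MvPowerSeries (Fin 1) L) := NoZeroDivisors.to_isDomain _
  refine ⟨r, MvPowerSeries (Fin 1) L, inferInstance, inferInstance, inferInstance, hdom,
    inferInstance, MvPowerSeries.X 0, hπ, hX, ?_⟩
  refine exists_ringHom_mvPowerSeries h hp hx hker hπ hX (hφX 0) fun a => ?_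
  obtain ⟨l, hl⟩ := hF a
  refine ⟨MvPowerSeries.C l, ?_⟩
  rw [← hl, ← hφC]
  rfl

theorem hasPresentation_of_natCast (h : RegGens y) (hp : Function.Surjective p)
    (hx : x ∈ nonZeroDivisors Q) (hker : RingHom.ker p = Ideal.span {x}) (q : ℕ) [Fact q.Prime]
    (hq : y 0 = q) : HasPresentation A := by
  classical
  have hloc := IsLocalHom.of_surjective p hp
  have hpm : ∀ a, a ∈ maximalIdeal Q → p a ∈ maximalIdeal A := fun a ha => by
    rw [mem_maximalIdeal, mem_nonunits_iff, isUnit_map_iff]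
    exact ha
  let S : Finset (Fin (r + 1)) := Finset.univ.erase 0
  have hS : ∀ i, i ∉ S ↔ i = 0 := by simp [S]
  let W := Q ⧸ Ideal.span (y '' S)
  have hWl : IsLocalRing W := isLocalRing_quotient (h.span_image_le S)
  have hWr := h.quotient S
  have hWd : IsDomain W := hWr.isDomain
  have hW : maximalIdeal W = Ideal.span {(q : W)} := by
    rw [← hWr.span]
    congr 1
    ext w
    simp only [Set.mem_range, Set.mem_singleton_iff, Subtype.exists]
    constructor
    · rintro ⟨i, hi, rfl⟩
      rw [(hS i).1 hi, hq, map_natCast]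
    · rintro rfl
      exact ⟨0, (hS 0).2 rfl, by rw [hq, map_natCast]⟩
  have hW0 : (q : W) ≠ 0 := by
    intro h0
    refine h.notMem S ((hS 0).2 rfl) (Ideal.Quotient.eq_zero_iff_mem.1 ?_)
    rw [hq, map_natCast]
    exact h0
  let V := AdicCompletion (maximalIdeal W) W
  have hV : maximalIdeal V = Ideal.span {(q : V)} := by
    refine AdicCompletion.maximalIdeal_eq_map.trans ((congrArg (Ideal.map _) hW).trans ?_)
    rw [Ideal.map_span, Set.image_singleton, map_natCast]
  have hreg : ∀ v : V, (q : V) * v = 0 → v = 0 := by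
    have := IsSMulRegular.of_flat (S := V) (x := (q : W)) (fun a b hab => by
      simpa [hW0] using hab)
    rw [map_natCast] at this
    intro v hv
    exact this.right_eq_zero_of_smul hv
  have hVd : IsDomain V := isDomain_of_maximalIdeal_eq_span hV hreg
  have hV0 : (q : V) ≠ 0 := fun h0 => one_ne_zero (hreg 1 (by rw [h0, zero_mul]))
  have hVn : IsNoetherianRing V := isNoetherianRing_of_maximalIdeal_eq_span hV hV0
  let f₀ : W →+* A ⧸ maximalIdeal A := Ideal.Quotient.lift _ ((Ideal.Quotient.mk _).comp p) (by
    intro a ha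
    exact Ideal.Quotient.eq_zero_iff_mem.2 (hpm a (h.span_image_le S ha)))
  let f₁ : W ⧸ maximalIdeal W →+* A ⧸ maximalIdeal A := Ideal.Quotient.lift _ f₀ (by
    intro a ha
    rw [hW, Ideal.mem_span_singleton] at ha
    obtain ⟨b, rfl⟩ := ha
    rw [map_mul]
    have : f₀ (q : W) = Ideal.Quotient.mk _ (p (y 0)) := by
      rw [hq]
      simp
    rw [this, Ideal.Quotient.eq_zero_iff_mem.2 (hpm _ (h.mem 0)), zero_mul])
  have hf₁ : Function.Surjective f₁ := Ideal.Quotient.lift_surjective_of_surjective _ _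
    (Ideal.Quotient.lift_surjective_of_surjective _ _ (Ideal.Quotient.mk_surjective.comp hp))
  let f : V →+* A ⧸ maximalIdeal A :=
    f₁.comp (AdicCompletion.evalOneₐ (maximalIdeal W)).toRingHom
  have hf : Function.Surjective f := hf₁.comp (AdicCompletion.evalOneₐ_surjective _)
  obtain ⟨F, hF⟩ := exists_lift_residue_of_isMaximal_span q (hV ▸ maximalIdeal.isMaximal V) hreg
    (maximalIdeal A) (by
      rw [← map_natCast p, ← hq]
      exact hpm _ (h.mem 0)) f
  refine ⟨r, V, inferInstance, inferInstance, hVn, hVd, inferInstance, q, hV, hV0, ?_⟩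
  exact exists_ringHom_mvPowerSeries h hp hx hker hV hV0 (by rw [hq, map_natCast, map_natCast])
    (φ := F) (by rw [hF]; exact hf)

end

theorem notMem_sq_of_map_eq_algebraMap {R : Type u} [CommRing R] [IsLocalRing R] [IsNoetherianRing R]
    {Q : Type u} [CommRing Q] [IsLocalRing Q] (p : Q →+* AdicCompletion (maximalIdeal R) R)
    (hp : Function.Surjective p) {a : R} (ha : a ∉ maximalIdeal R ^ 2) {b : Q}
    (hb : p b = algebraMap R _ a) : b ∉ maximalIdeal Q ^ 2 := by
  have hloc := IsLocalHom.of_surjective p hp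
  intro hb2
  have h1 : p b ∈ maximalIdeal (AdicCompletion (maximalIdeal R) R) ^ 2 := by
    have h : (maximalIdeal Q).map p ≤ maximalIdeal (AdicCompletion (maximalIdeal R) R) := by
      rw [Ideal.map_le_iff_le_comap]
      intro c hc
      rw [Ideal.mem_comap, mem_maximalIdeal, mem_nonunits_iff, isUnit_map_iff]
      exact hc
    refine Ideal.pow_right_mono h 2 ?_
    rw [← Ideal.map_pow]
    exact Ideal.mem_map_of_mem _ hb2
  have h2 : (maximalIdeal (AdicCompletion (maximalIdeal R) R) ^ 2).map
      (AdicCompletion.evalₐ (maximalIdeal R) 2).toRingHom ≤ ⊥ := by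
    rw [AdicCompletion.maximalIdeal_eq_map, ← Ideal.map_pow, Ideal.map_map,
      Ideal.map_le_iff_le_comap]
    intro c hc
    rw [Ideal.mem_comap, Ideal.mem_bot]
    change AdicCompletion.evalₐ (maximalIdeal R) 2 (algebraMap R _ c) = 0
    rw [AlgHom.commutes]
    exact Ideal.Quotient.eq_zero_iff_mem.2 hc
  have h3 := h2 (Ideal.mem_map_of_mem _ h1)
  rw [hb, Ideal.mem_bot] at h3
  change AdicCompletion.evalₐ (maximalIdeal R) 2 (algebraMap R _ a) = 0 at h3
  rw [AlgHom.commutes] at h3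
  exact ha (Ideal.Quotient.eq_zero_iff_mem.1 h3)

theorem hasPresentation_adicCompletion {R : Type u} [CommRing R] [IsLocalRing R]
    [IsNoetherianRing R] (hunr : IsUnramifiedLocal R) (P : HypersurfacePresentation R) :
    HasPresentation (AdicCompletion (maximalIdeal R) R) := by
  classical
  let _ := P.commRing
  have := P.localRing
  obtain ⟨hn, s, hs, hcard⟩ := P.regular
  let A := AdicCompletion (maximalIdeal R) R
  let p : P.Q →+* A := (P.equiv.symm : P.Q ⧸ Ideal.span {P.x} →+* A).comp (Ideal.Quotient.mk _)
  have hp : Function.Surjective p := P.equiv.symm.surjective.comp Ideal.Quotient.mk_surjective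
  have hker : RingHom.ker p = Ideal.span {P.x} := by
    ext a
    rw [RingHom.mem_ker, ← Ideal.Quotient.eq_zero_iff_mem]
    exact EmbeddingLike.map_eq_zero_iff (f := P.equiv.symm)
  have hloc := IsLocalHom.of_surjective p hp
  obtain ⟨n, y, hy⟩ : ∃ (n : ℕ) (y : Fin n → P.Q), RegGens y := by
    refine ⟨s.card, fun i => s.equivFin.symm i, ?_, ?_⟩
    · rw [← hs]
      congr 1
      have := s.equivFin.symm.surjective.range_comp (fun i : s => (i : P.Q))
      rw [Subtype.range_coe_subtype] at this
      exact this
    · rw [Fintype.card_fin, ← hcard]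
      rfl
  obtain _ | r := n
  · have h0 : P.x = 0 := by
      have := Ideal.pow_le_self two_ne_zero P.mem_sq
      rw [← hy.span] at this
      simpa using this
    exact absurd P.nonzerodivisor (h0 ▸ zero_notMem_nonZeroDivisors)
  let f : ResidueField A →+* A ⧸ maximalIdeal A := RingHom.id _
  have hf : Function.Bijective f := Function.bijective_id
  have hunit : ∀ m : ℕ, (m : ResidueField R) ≠ 0 → IsUnit (m : R) := fun m hm => by
    rw [← map_natCast (residue R)] at hm
    exact (isUnit_map_iff (residue R) _).1 (isUnit_iff_ne_zero.2 hm)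
  by_cases hc : ringChar (ResidueField R) = 0
  · obtain ⟨_⟩ : Nonempty (Algebra ℚ A) := by
      refine (EqualCharZero.nonempty_algebraRat_iff A).2 fun I hI => ?_
      have := Ideal.Quotient.nontrivial_iff.2 hI
      refine charZero_of_inj_zero fun m hm => ?_
      by_contra h0
      have h1 : IsUnit (m : R) := hunit m fun h => h0 (by
        rw [ringChar.spec, hc, zero_dvd_iff] at h
        exact h)
      have h2 := h1.map ((Ideal.Quotient.mk I).comp (algebraMap R A))
      rw [map_natCast, hm] at h2
      exact not_isUnit_zero h2
    obtain ⟨F, hF⟩ := exists_lift_residue_of_rat (maximalIdeal A) f hf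
    exact hasPresentation_of_coefficientField hy hp P.nonzerodivisor hker (F := F)
      (by rw [hF]; exact hf.2)
  have hprime : Fact (ringChar (ResidueField R)).Prime :=
    ⟨(CharP.char_is_prime_or_zero (ResidueField R) _).resolve_right hc⟩
  have hR : (ringChar (ResidueField R) : R) ∈ maximalIdeal R := by
    rw [← residue_eq_zero_iff, map_natCast, ringChar.Nat.cast_ringChar]
  have hA : (ringChar (ResidueField R) : A) ∈ maximalIdeal A := by
    rw [AdicCompletion.maximalIdeal_eq_map, ← map_natCast (algebraMap R A)]
    exact Ideal.mem_map_of_mem _ hR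
  obtain heq | ⟨-, hmix⟩ := hunr
  · have h0 : ((ringChar (ResidueField R) : ℕ) : A) = 0 := by
      rw [← map_natCast (algebraMap R A), ← heq, ringChar.Nat.cast_ringChar, map_zero]
    obtain ⟨F, hF⟩ := exists_lift_residue_of_charP (L := ResidueField A) _ h0 (maximalIdeal A) f (by
      rw [← map_natCast (residue A), h0, map_zero])
    exact hasPresentation_of_coefficientField hy hp P.nonzerodivisor hker (F := F)
      (by rw [hF]; exact hf.2)
  · have hq2 : (ringChar (ResidueField R) : P.Q) ∉ maximalIdeal P.Q ^ 2 :=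
      notMem_sq_of_map_eq_algebraMap p hp hmix (by rw [map_natCast, map_natCast])
    have hq : (ringChar (ResidueField R) : P.Q) ∈ maximalIdeal P.Q := by
      rw [← map_natCast p] at hA
      rw [mem_maximalIdeal, mem_nonunits_iff] at hA ⊢
      exact fun h => hA (h.map p)
    obtain ⟨i, hi⟩ := hy.exists_update hq hq2
    exact hasPresentation_of_natCast (hi.reindex (Equiv.swap 0 i)) hp P.nonzerodivisor hker
      (ringChar (ResidueField R)) (by simp)

end ExtRigid

namespace ExtRigid
open TensorProduct

section freeResolution
variable {R : Type u} [CommRing R]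

theorem mact_single {m n : Type*} [Fintype n] [DecidableEq n] {A : Type*} [CommRing A]
    (M : Matrix m n A) (l : n) (i : m) : mact M (Pi.single l (1 : A)) i = M i l := by
  rw [mact_apply, Finset.sum_eq_single l]
  · simp
  · intro b _ hb
    rw [Pi.single_eq_of_ne hb, smul_zero]
  · simp

theorem exists_matrix_mact_eq {m n : Type*} [Fintype n] [DecidableEq n]
    (f : (n → R) →ₗ[R] (m → R)) : ∃ M : Matrix m n R, mact M = f := by
  refine ⟨fun i l => f (Pi.single l 1) i, LinearMap.pi_ext' fun l => LinearMap.ext_ring ?_⟩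
  funext i
  exact mact_single (fun i l => f (Pi.single l 1) i : Matrix m n R) l i

theorem exists_matrix_exact [IsNoetherianRing R] {a b : ℕ} (D : Matrix (Fin a) (Fin b) R) :
    ∃ (c : ℕ) (E : Matrix (Fin b) (Fin c) R), ∀ x : Fin b → R,
      mact D x = 0 ↔ ∃ w : Fin c → R, mact E w = x := by
  obtain ⟨c, f, hf⟩ := Module.Finite.exists_fin' R (LinearMap.ker (mact (V := R) D))
  obtain ⟨E, hE⟩ := exists_matrix_mact_eq ((LinearMap.ker (mact (V := R) D)).subtype ∘ₗ f)
  refine ⟨c, E, fun x => ⟨fun hx => ?_, ?_⟩⟩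
  · obtain ⟨w, hw⟩ := hf ⟨x, hx⟩
    exact ⟨w, by rw [hE, LinearMap.comp_apply, hw]; rfl⟩
  · rintro ⟨w, rfl⟩
    rw [hE]
    exact (f w).2

/-- A resolution of `M` by finitely generated free modules, given by matrices. -/
structure FreeRes (R : Type u) [CommRing R] (M : Type u) [AddCommGroup M] [Module R M] where
  k : ℕ → ℕ
  D : ∀ j, Matrix (Fin (k j)) (Fin (k (j + 1))) R
  ε : (Fin (k 0) → R) →ₗ[R] M
  surj : Function.Surjective ε
  exact_zero : ∀ x, ε x = 0 ↔ ∃ w : Fin (k 1) → R, mact (D 0) w = x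
  exact_succ : ∀ j (x : Fin (k (j + 1)) → R),
    mact (D j) x = 0 ↔ ∃ w : Fin (k (j + 2)) → R, mact (D (j + 1)) w = x

theorem nonempty_freeRes [IsNoetherianRing R] (M : Type u) [AddCommGroup M] [Module R M]
    [Module.Finite R M] : Nonempty (FreeRes R M) := by
  obtain ⟨a, ε, hε⟩ := Module.Finite.exists_fin' R M
  obtain ⟨b, f, hf⟩ := Module.Finite.exists_fin' R (LinearMap.ker ε)
  obtain ⟨E, hE⟩ := exists_matrix_mact_eq ((LinearMap.ker ε).subtype ∘ₗ f)
  choose c F hF using fun (s : Σ a b : ℕ, Matrix (Fin a) (Fin b) R) => exists_matrix_exact s.2.2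
  let S : ℕ → Σ a b : ℕ, Matrix (Fin a) (Fin b) R :=
    fun j => Nat.rec ⟨a, b, E⟩ (fun _ s => ⟨s.2.1, c s, F s⟩) j
  exact ⟨{
    k := fun j => (S j).1
    D := fun j => (S j).2.2
    ε := ε
    surj := hε
    exact_zero := fun x => by
      refine ⟨fun hx => ?_, ?_⟩
      · obtain ⟨w, hw⟩ := hf ⟨x, hx⟩
        exact ⟨w, (congrFun (congrArg DFunLike.coe hE) w).trans (by
          rw [LinearMap.comp_apply, hw]; rfl)⟩
      · rintro ⟨w, rfl⟩
        have h : ε (mact E w) = 0 := by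
          rw [hE]
          exact (f w).2
        exact h
    exact_succ := fun j x => hF (S j) x }⟩

namespace FreeRes
variable {M : Type u} [AddCommGroup M] [Module R M] (P : FreeRes R M)

theorem mact_mact (j : ℕ) (x : Fin (P.k (j + 2)) → R) : mact (P.D j) (mact (P.D (j + 1)) x) = 0 :=
  (P.exact_succ j _).2 ⟨x, rfl⟩

/-- The chain complex of a free resolution. -/
noncomputable def complex : ChainComplex (ModuleCat.{u} R) ℕ :=
  ChainComplex.of (fun j => ModuleCat.of R (Fin (P.k j) → R))
    (fun j => ModuleCat.ofHom (mact (P.D j))) fun j => by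
      ext1
      exact LinearMap.ext fun x => P.mact_mact j x

theorem complex_d (j : ℕ) : P.complex.d (j + 1) j = ModuleCat.ofHom (mact (P.D j)) :=
  ChainComplex.of_d (fun j => ModuleCat.of R (Fin (P.k j) → R))
    (fun j => ModuleCat.ofHom (mact (P.D j))) j

theorem exactAt_succ (j : ℕ) : P.complex.ExactAt (j + 1) := by
  rw [HomologicalComplex.exactAt_iff' _ (j + 2) (j + 1) j (by simp) (by simp)]
  rw [ShortComplex.moduleCat_exact_iff]
  intro (x : Fin (P.k (j + 1)) → R) hx
  have hx' : P.complex.d (j + 1) j x = 0 := hx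
  rw [complex_d] at hx'
  obtain ⟨w, hw⟩ := (P.exact_succ j x).1 hx'
  refine ⟨w, ?_⟩
  change P.complex.d (j + 2) (j + 1) w = x
  rw [complex_d]
  exact hw

theorem complex_d_π : P.complex.d 1 0 ≫ ModuleCat.ofHom P.ε = 0 := by
  rw [complex_d]
  ext1
  exact LinearMap.ext fun x => (P.exact_zero _).2 ⟨x, rfl⟩

theorem toSingle₀_f_zero :
    ((ChainComplex.toSingle₀Equiv P.complex (ModuleCat.of R M)).symm
      ⟨ModuleCat.ofHom P.ε, P.complex_d_π⟩).f 0 = ModuleCat.ofHom P.ε :=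
  ChainComplex.toSingle₀Equiv_symm_apply_f_zero _ _

/-- A free resolution as a projective resolution. -/
noncomputable def projectiveResolution : ProjectiveResolution (ModuleCat.of R M) where
  complex := P.complex
  projective j := by
    change Projective (ModuleCat.of R (Fin (P.k j) → R))
    infer_instance
  π := (ChainComplex.toSingle₀Equiv _ _).symm ⟨ModuleCat.ofHom P.ε, P.complex_d_π⟩
  quasiIso := ⟨fun n => by
    cases n
    · rw [ChainComplex.quasiIsoAt₀_iff, ShortComplex.quasiIso_iff_of_zeros']
      · refine (ShortComplex.exact_and_epi_g_iff_of_iso (S₂ := ShortComplex.mk (P.complex.d 1 0)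
          (ModuleCat.ofHom P.ε) P.complex_d_π) ?_).2 ⟨?_, ?_⟩
        · exact ShortComplex.isoMk (Iso.refl _) (Iso.refl _) (Iso.refl _)
            ((Category.id_comp _).trans (Category.comp_id _).symm)
            ((Category.id_comp (ModuleCat.ofHom P.ε)).trans
              (P.toSingle₀_f_zero.symm.trans (Category.comp_id _).symm))
        · rw [ShortComplex.moduleCat_exact_iff]
          intro (x : Fin (P.k 0) → R) (hx : P.ε x = 0)
          obtain ⟨w, hw⟩ := (P.exact_zero x).1 hx
          refine ⟨w, ?_⟩
          change P.complex.d 1 0 w = x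
          rw [complex_d]
          exact hw
        · exact (ModuleCat.epi_iff_surjective _).2 P.surj
      all_goals rfl
    · rw [quasiIsoAt_iff_exactAt']
      · apply P.exactAt_succ
      · apply ChainComplex.exactAt_succ_single_obj⟩

end FreeRes
end freeResolution
end ExtRigid

namespace ExtRigid
open TensorProduct

/-- The ranks of the dual of a truncation of a free resolution. -/
def revk (k : ℕ → ℕ) : ℕ → ℕ → ℕ
  | 0, n => k n
  | _ + 1, 0 => 0
  | j + 1, n + 1 => revk k j n

/-- The matrices of the dual of a truncation of a free resolution. -/
def revM {R : Type u} [CommRing R] {k : ℕ → ℕ} (D : ∀ j, Matrix (Fin (k j)) (Fin (k (j + 1))) R) :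
    ∀ j n, Matrix (Fin (revk k j (n + 1))) (Fin (revk k (j + 1) (n + 1))) R
  | 0, n => (D n).transpose
  | _ + 1, 0 => 0
  | j + 1, n + 1 => revM D j n

theorem revk_eq_zero (k : ℕ → ℕ) : ∀ j n, n < j → revk k j n = 0
  | 0, _, h => absurd h (Nat.not_lt_zero _)
  | _ + 1, 0, _ => rfl
  | j + 1, n + 1, h => revk_eq_zero k j n (Nat.lt_of_succ_lt_succ h)

section
variable {R : Type u} [CommRing R] {k : ℕ → ℕ} (D : ∀ j, Matrix (Fin (k j)) (Fin (k (j + 1))) R)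

theorem revM_mul (hD : ∀ j, D j * D (j + 1) = 0) : ∀ j n, revM D j n * revM D (j + 1) n = 0
  | 0, 0 => Matrix.mul_zero _
  | 0, n + 1 => by
    change (D (n + 1)).transpose * (D n).transpose = 0
    rw [← Matrix.transpose_mul, hD, Matrix.transpose_zero]
  | _ + 1, 0 => Matrix.mul_zero _
  | j + 1, n + 1 => revM_mul hD j n

/-- Exactness of the dual complex with coefficients in `N` at one spot. -/
def RevExact (N : Type u) [AddCommGroup N] [Module R N] (j n : ℕ) : Prop :=
  ∀ v : Fin (revk k (j + 1) (n + 1)) → N, mact (revM D j n) v = 0 →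
    ∃ w, mact (revM D (j + 1) n) w = v

theorem revExact_iff (N : Type u) [AddCommGroup N] [Module R N] :
    ∀ j n, RevExact D N j n ↔ (j ≤ n → RevExact D N 0 (n - j))
  | 0, n => by simp
  | j + 1, 0 => by
    have h : RevExact D N (j + 1) 0 := fun v _ => ⟨0, by
      funext i
      exact i.elim0⟩
    simp [h]
  | j + 1, n + 1 => by
    rw [Nat.add_le_add_iff_right, Nat.add_sub_add_right]
    exact revExact_iff N j n

end

section
variable {R : Type u} [CommRing R] {M : Type u} [AddCommGroup M] [Module R M] (P : FreeRes R M)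
  (N : Type u) [AddCommGroup N] [Module R N]

namespace FreeRes

theorem subsingleton_extMod_iff_exactAt (n : ℕ) :
    Subsingleton (extMod R n M N) ↔
      (P.complex.linearYonedaObj R (ModuleCat.of R N)).ExactAt n := by
  rw [HomologicalComplex.exactAt_iff_isZero_homology,
    ← ModuleCat.isZero_iff_subsingleton]
  exact (P.projectiveResolution.isoExt (R := R) n (ModuleCat.of R N)).isZero_iff

/-- A linear map out of a free module, as a column. -/
def homCol {m : ℕ} (f : (Fin m → R) →ₗ[R] N) (l : Fin m) : N := f (Pi.single l 1)

theorem homCol_injective {m : ℕ} : Function.Injective (homCol (R := R) N (m := m)) := fun _ _ h =>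
  LinearMap.pi_ext' fun l => LinearMap.ext_ring (congrFun h l)

theorem homCol_surjective {m : ℕ} : Function.Surjective (homCol (R := R) N (m := m)) := fun v =>
  ⟨Fintype.linearCombination R v, funext fun l => by simp [homCol]⟩

theorem homCol_comp_mact {m p : ℕ} (f : (Fin m → R) →ₗ[R] N) (E : Matrix (Fin m) (Fin p) R) :
    homCol N (f ∘ₗ mact E) = mact E.transpose (homCol N f) := by
  funext l
  rw [mact_apply]
  have : mact E (Pi.single l (1 : R)) = ∑ i, E i l • (Pi.single i (1 : R) : Fin m → R) := by
    funext i
    rw [mact_single]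
    simp [Finset.sum_apply, Pi.single_apply]
  simp only [homCol, LinearMap.comp_apply, this, map_sum, map_smul, Matrix.transpose_apply]

theorem subsingleton_extMod_iff (n : ℕ) :
    Subsingleton (extMod R n M N) ↔ RevExact P.D N 0 n := by
  have hd : ∀ j (f : (Fin (P.k j) → R) →ₗ[R] N),
      ((P.complex.linearYonedaObj R (ModuleCat.of R N)).d j (j + 1) (ModuleCat.ofHom f) :
        P.complex.X (j + 1) ⟶ ModuleCat.of R N) = ModuleCat.ofHom (f ∘ₗ mact (P.D j)) := fun j f => by
    have : ((P.complex.linearYonedaObj R (ModuleCat.of R N)).d j (j + 1) (ModuleCat.ofHom f) :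
        P.complex.X (j + 1) ⟶ ModuleCat.of R N) = P.complex.d (j + 1) j ≫ ModuleCat.ofHom f := rfl
    rw [this, complex_d]
    rfl
  rw [P.subsingleton_extMod_iff_exactAt]
  cases n with
  | zero =>
    rw [HomologicalComplex.exactAt_iff' _ 0 0 1 (by simp) (by simp),
      ShortComplex.moduleCat_exact_iff]
    constructor
    · intro h v hv
      obtain ⟨f, hfv⟩ := homCol_surjective (R := R) N (m := P.k 0) v
      subst hfv
      have h0 : f ∘ₗ mact (P.D 0) = 0 := homCol_injective N (by
        rw [homCol_comp_mact]
        exact hv)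
      obtain ⟨w, hw⟩ := h (ModuleCat.ofHom f) (by
        refine (hd 0 f).trans ?_
        rw [h0]
        rfl)
      have hw' : (P.complex.linearYonedaObj R (ModuleCat.of R N)).d 0 0 w = ModuleCat.ofHom f := hw
      rw [HomologicalComplex.shape _ _ _ (by simp)] at hw'
      have hf : f = 0 := (congrArg ModuleCat.Hom.hom hw').symm
      exact ⟨0, by rw [map_zero, hf]; rfl⟩
    · intro h (f : ModuleCat.of R (Fin (P.k 0) → R) ⟶ ModuleCat.of R N) hf
      have h0 : f.hom ∘ₗ mact (P.D 0) = 0 := congrArg ModuleCat.Hom.hom ((hd 0 f.hom).symm.trans hf)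
      obtain ⟨w, hw⟩ := h (homCol N f.hom) (by
        refine (homCol_comp_mact N f.hom (P.D 0)).symm.trans ?_
        rw [h0]
        rfl)
      have hf0 : f.hom = 0 := homCol_injective N (by
        refine hw.symm.trans ?_
        have hw0 : w = 0 := funext fun i => i.elim0
        rw [hw0, map_zero]
        rfl)
      refine ⟨0, ?_⟩
      rw [map_zero]
      exact (ModuleCat.hom_ext hf0).symm
  | succ n =>
    rw [HomologicalComplex.exactAt_iff' _ n (n + 1) (n + 2) (by simp) (by simp),
      ShortComplex.moduleCat_exact_iff]
    constructor
    · intro h v hv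
      obtain ⟨f, hfv⟩ := homCol_surjective (R := R) N (m := P.k (n + 1)) v
      subst hfv
      have h0 : f ∘ₗ mact (P.D (n + 1)) = 0 := homCol_injective N (by
        rw [homCol_comp_mact]
        exact hv)
      obtain ⟨w, hw⟩ := h (ModuleCat.ofHom f) (by
        refine (hd (n + 1) f).trans ?_
        rw [h0]
        rfl)
      let w' : ModuleCat.of R (Fin (P.k n) → R) ⟶ ModuleCat.of R N := w
      have hw' : w'.hom ∘ₗ mact (P.D n) = f :=
        congrArg ModuleCat.Hom.hom ((hd n w'.hom).symm.trans hw)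
      refine ⟨homCol N w'.hom, ?_⟩
      rw [← hw', homCol_comp_mact]
      rfl
    · intro h (f : ModuleCat.of R (Fin (P.k (n + 1)) → R) ⟶ ModuleCat.of R N) hf
      have h0 : f.hom ∘ₗ mact (P.D (n + 1)) = 0 :=
        congrArg ModuleCat.Hom.hom ((hd (n + 1) f.hom).symm.trans hf)
      obtain ⟨w, hw⟩ := h (homCol N f.hom) (by
        refine (homCol_comp_mact N f.hom (P.D (n + 1))).symm.trans ?_
        rw [h0]
        rfl)
      obtain ⟨w', rfl⟩ := homCol_surjective (R := R) N (m := P.k n) w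
      refine ⟨ModuleCat.ofHom w', (hd n w').trans (ModuleCat.hom_ext (homCol_injective N ?_))⟩
      exact (homCol_comp_mact N w' (P.D n)).trans hw

end FreeRes
end
end ExtRigid

namespace ExtRigid
open TensorProduct

section
variable {R : Type u} [CommRing R] {a b c : ℕ} (E : Matrix (Fin a) (Fin b) R)
  (F : Matrix (Fin b) (Fin c) R)

theorem exact_mact_iff (h : E * F = 0) (N : Type u) [AddCommGroup N] [Module R N] :
    Function.Exact (mact (V := N) F) (mact (V := N) E) ↔
      ∀ v : Fin b → N, mact E v = 0 → ∃ w, mact F w = v := by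
  refine ⟨fun H v hv => (H v).1 hv, fun H v => ⟨H v, ?_⟩⟩
  rintro ⟨w, rfl⟩
  rw [← mact_mul, h]
  exact funext fun i => by simp [mact_apply]

variable (A N N' : Type u) [AddCommGroup A] [Module R A] [AddCommGroup N] [Module R N]
  [AddCommGroup N'] [Module R N']

theorem piRight_lTensor_mact (x : A ⊗[R] (Fin b → N)) :
    piRight R R A (fun _ : Fin a => N) ((mact E).lTensor A x) =
      mact E (piRight R R A (fun _ : Fin b => N) x) := by
  induction x with
  | zero => simp only [map_zero]
  | add x y hx hy => simp only [map_add, hx, hy]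
  | tmul s v =>
    funext i
    rw [LinearMap.lTensor_tmul, mact_apply]
    simp only [piRight_apply, piRightHom_tmul, mact_apply, tmul_sum, tmul_smul]

theorem exact_mact_tensor_iff [Module.FaithfullyFlat R A] :
    Function.Exact (mact (V := A ⊗[R] N) F) (mact (V := A ⊗[R] N) E) ↔
      Function.Exact (mact (V := N) F) (mact (V := N) E) := by
  rw [← Module.FaithfullyFlat.lTensor_exact_iff_exact R A (mact (V := N) F) (mact (V := N) E)]
  exact Function.Exact.iff_of_ladder_linearEquiv
    (e₁ := piRight R R A (fun _ : Fin c => N)) (e₂ := piRight R R A (fun _ : Fin b => N))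
    (e₃ := piRight R R A (fun _ : Fin a => N))
    (LinearMap.ext fun x => (piRight_lTensor_mact F A N x).symm)
    (LinearMap.ext fun x => (piRight_lTensor_mact E A N x).symm)

variable {N N'} in
theorem mact_equiv (e : N ≃ₗ[R] N') (v : Fin b → N) :
    mact E (fun l => e (v l)) = fun i => e (mact E v i) := by
  funext i
  simp [mact_apply]

variable {N N'} in
theorem exact_mact_equiv (e : N ≃ₗ[R] N')
    (H : ∀ v : Fin b → N, mact E v = 0 → ∃ w, mact F w = v) (v : Fin b → N')
    (hv : mact E v = 0) : ∃ w, mact F w = v := by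
  obtain ⟨w, hw⟩ := H (fun l => e.symm (v l)) (by
    rw [mact_equiv, hv]
    exact funext fun i => map_zero e.symm)
  refine ⟨fun l => e (w l), ?_⟩
  rw [mact_equiv, hw]
  exact funext fun i => e.apply_symm_apply _
end

theorem acyclic_of_presentation {R A V Q : Type u} [CommRing R] [CommRing A] [Algebra R A]
    [Module.FaithfullyFlat R A] [CommRing V] [CommRing Q] [IsLocalRing Q] [IsNoetherianRing Q]
    {σ : Type} [Fintype σ] {φ : V →+* Q} {π : V} {x : σ → Q} (hQ : PSData φ π x)
    (ψ : Q →+* A) (hψ : Function.Surjective ψ) {g : Q} (hker : RingHom.ker ψ = Ideal.span {g})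
    (hg : ∀ q, g * q = 0 → q = 0)
    (k : ℕ → ℕ) (hk : ∃ K, ∀ j, K ≤ j → k j = 0)
    (M : ∀ j, Matrix (Fin (k j)) (Fin (k (j + 1))) R)
    (hMM : ∀ j, M j * M (j + 1) = 0)
    (hex : ∀ j (x : Fin (k (j + 2)) → R), mact (M (j + 1)) x = 0 →
      ∃ w : Fin (k (j + 3)) → R, mact (M (j + 2)) w = x)
    (N : Type u) [AddCommGroup N] [Module R N] [Module.Finite R N]
    (h1 : ∀ v : Fin (k 1) → N, mact (M 0) v = 0 → ∃ w, mact (M 1) w = v) :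
    ∀ j (v : Fin (k (j + 1)) → N), mact (M j) v = 0 → ∃ w, mact (M (j + 1)) w = v := by
  let algQ : Algebra Q A := ψ.toAlgebra
  have hdvd : ∀ q, g ∣ q ↔ ψ q = 0 := fun q => by
    rw [← RingHom.mem_ker, hker, Ideal.mem_span_singleton]
  choose s hs using fun r : R => hψ (algebraMap R A r)
  let L : ∀ j, Matrix (Fin (k j)) (Fin (k (j + 1))) Q := fun j => (M j).map s
  have comm : SMulCommClass R Q A := ⟨fun r q y => by
    simp only [Algebra.smul_def]
    exact mul_left_comm _ _ _⟩
  have hsmul : ∀ (q : Q) (t : A ⊗[R] N), q • t = ψ q • t := fun q t => (algebraMap_smul A q t).symm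
  have finA : Module.Finite Q A := Module.Finite.of_surjective (Algebra.linearMap Q A) hψ
  have finN : Module.Finite Q (A ⊗[R] N) := Module.Finite.trans A _
  have hL : ∀ j (v : Fin (k (j + 1)) → A ⊗[R] N), mact (L j) v = mact (M j) v := fun j v => by
    funext i
    rw [mact_apply, mact_apply]
    refine Finset.sum_congr rfl fun l _ => ?_
    refine (hsmul _ _).trans ?_
    change ψ (s (M j i l)) • v l = _
    rw [hs, algebraMap_smul]
  have hLA : ∀ j (v : Fin (k (j + 1)) → Q) i,
      ψ (mact (L j) v i) = mact (M j) (fun l => ψ (v l)) i := fun j v i => by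
    rw [mact_apply, mact_apply, map_sum]
    refine Finset.sum_congr rfl fun l _ => ?_
    rw [smul_eq_mul, map_mul, Algebra.smul_def, ← hs]
    rfl
  have key := hQ.acyclic_matrix hg k hk L (fun j i l => ?_) (fun j y hy => ?_) (A ⊗[R] N)
    (fun v => ?_) (fun v hv => ?_)
  · intro j
    refine (exact_mact_iff _ _ (hMM j) N).1 ((exact_mact_tensor_iff _ _ A N).1
      ((exact_mact_iff _ _ (hMM j) (A ⊗[R] N)).2 fun v hv => ?_))
    obtain ⟨w, hw⟩ := key j v (by rw [hL, hv])
    exact ⟨w, by rw [← hL, hw]⟩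
  · rw [hdvd, Matrix.mul_apply, map_sum]
    have := congrFun (congrFun (hMM j) i) l
    rw [Matrix.mul_apply] at this
    have h2 := congrArg (algebraMap R A) this
    rw [map_sum, Matrix.zero_apply, map_zero] at h2
    rw [← h2]
    refine Finset.sum_congr rfl fun p _ => ?_
    rw [map_mul, map_mul, ← hs, ← hs]
    rfl
  · have hexA := exact_mact_equiv (M (j + 1)) (M (j + 2)) (TensorProduct.rid R A)
      ((exact_mact_iff _ _ (hMM (j + 1)) (A ⊗[R] R)).1 ((exact_mact_tensor_iff _ _ A R).2
        ((exact_mact_iff _ _ (hMM (j + 1)) R).2 (hex j))))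
    obtain ⟨w, hw⟩ := hexA (fun l => ψ (y l)) (funext fun i => by
      rw [← hLA, Pi.zero_apply, ← hdvd]
      exact hy i)
    choose w' hw' using fun l => hψ (w l)
    refine ⟨w', fun i => ?_⟩
    rw [hdvd, map_sub, hLA, sub_eq_zero]
    simp only [hw']
    rw [hw]
  · have : ψ g = 0 := (hdvd g).1 dvd_rfl
    rw [hsmul, this, zero_smul]
  · obtain ⟨w, hw⟩ := (exact_mact_iff _ _ (hMM 0) (A ⊗[R] N)).1 ((exact_mact_tensor_iff _ _ A N).2
      ((exact_mact_iff _ _ (hMM 0) N).2 h1)) v (by rw [← hL, hv])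
    exact ⟨w, by rw [hL, hw]⟩

end ExtRigid

open ExtRigid in
/-- Over an unramified hypersurface, every nonzero finitely generated module `M` is Ext
rigid: if `Ext^n(M, N) = 0` for some `n ≤ grade M` and finitely generated `N`, then
`Ext^i(M, N) = 0` for all `i ≤ n`. -/
theorem ext_rigid_of_unramified_hypersurface
    (R : Type u) [CommRing R] [IsLocalRing R] [IsNoetherianRing R]
    (hunr : IsUnramifiedLocal R) (hhyp : IsHypersurface R)
    (M : Type u) [AddCommGroup M] [Module R M] [Module.Finite R M] (hM : Nontrivial M)
    (N : Type u) [AddCommGroup N] [Module R N] [Module.Finite R N]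
    (n : ℕ) (hn : n ≤ moduleGrade R M)
    (hvanish : Subsingleton (extMod R n M N)) :
    ∀ i ≤ n, Subsingleton (extMod R i M N) := by
  obtain ⟨-, ⟨P⟩⟩ := hhyp
  obtain ⟨r, V, _, _, _, _, _, π, hπ, hπ0, ψ, hψ, z, hz0, hker⟩ := hasPresentation_adicCompletion hunr P
  obtain ⟨F⟩ := nonempty_freeRes (R := R) M
  have hgrade : ∀ i < n, RevExact F.D R 0 i := fun i hi => by
    rw [← F.subsingleton_extMod_iff]
    by_contra h
    exact absurd (Nat.sInf_le h) (not_le.2 (hi.trans_le hn))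
  have : Module.FaithfullyFlat R (AdicCompletion (maximalIdeal R) R) :=
    Module.FaithfullyFlat.of_flat_of_isLocalHom
  have hD : ∀ j, F.D j * F.D (j + 1) = 0 := fun j => by
    ext i l
    rw [← mact_single (F.D j * F.D (j + 1)) l i, mact_mul, F.mact_mact]
    rfl
  have key := acyclic_of_presentation
    (psData_mvPowerSeries (σ := Fin r) hπ fun v hv => (mul_eq_zero.1 hv).resolve_left hπ0)
    ψ hψ hker (fun q hq => (mul_eq_zero.1 hq).resolve_left hz0)
    (fun j => revk F.k j (n + 1)) ⟨n + 2, fun j hj => revk_eq_zero _ _ _ hj⟩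
    (fun j => revM F.D j n) (fun j => revM_mul F.D hD j n)
    (fun j => (revExact_iff F.D R (j + 1) n).2 fun hj => hgrade _ (by omega)) N
    ((F.subsingleton_extMod_iff N n).1 hvanish)
  intro i hi
  rw [F.subsingleton_extMod_iff]
  have h := (revExact_iff F.D N (n - i) n).1 (key (n - i)) (Nat.sub_le _ _)
  rwa [Nat.sub_sub_self hi] at h
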